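/- arXiv:1206.0835 — 2 statements merged into one kernel-verified Lean document; each statement's English description precedes it below -/
import Mathlib

section
/- For every $q>2$ there exists a constant $C>0$ such that the radial $L^q$ norm of the Schrödinger kernel satisfies $\|s_t\|_{L^q(\mathbb{T})}\le C$ if $|t|<1$ and $\|s_t\|_{L^q(\mathbb{T})}\le C\,|t|^{-3/2}$ if $|t|\ge1$, where for $q<\infty$, $\|s_t\|_{L^q(\mathbb{T})}^q=|s_t(0)|^q+(Q+1)\sum_{n\ge1}Q^{n-1}|s_t(n)|^q$ and $\|s_t\|_{L^\infty(\mathbb{T})}=\sup_{n\ge0}|s_t(n)|$. -/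
noncomputable section

open Complex MeasureTheory Filter
open scoped ENNReal NNReal Topology

/-- `γ(0) = 2/(Q^{1/2} + Q^{-1/2})`. -/
def gammaZero (Q : ℕ) : ℝ := 2 / (Real.sqrt Q + (Real.sqrt Q)⁻¹)

/-- The radial Schrödinger kernel
`s_t(n) = e^{it} (2/π) ∑_{k≥0} Q^{-n/2-k} ∫₀^π e^{-iγ(0)t cos λ} sin λ sin((n+2k+1)λ) dλ`. -/
def schKernel (Q : ℕ) (t : ℝ) (n : ℕ) : ℂ :=
  Complex.exp (Complex.I * t) * (2 / Real.pi) *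
    ∑' k : ℕ, (((Q : ℝ) ^ (-(n : ℝ) / 2 - (k : ℝ)) : ℝ) : ℂ) *
      ∫ l in (0 : ℝ)..Real.pi,
        Complex.exp (-Complex.I * (gammaZero Q) * t * Real.cos l) *
          (Real.sin l : ℂ) * (Real.sin (((n : ℝ) + 2 * k + 1) * l) : ℂ)

/-- The `L^q` norm (valued in `ℝ≥0∞`) of a radial function on the tree:
`(|f(0)|^q + (Q+1) ∑_{n≥1} Q^{n-1} |f(n)|^q)^{1/q}`. -/
def radNorm (Q : ℕ) (q : ℝ) (f : ℕ → ℂ) : ℝ≥0∞ :=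
  ((‖f 0‖₊ : ℝ≥0∞) ^ q +
    ∑' n : ℕ, ((Q : ℝ≥0∞) + 1) * (Q : ℝ≥0∞) ^ n * (‖f (n + 1)‖₊ : ℝ≥0∞) ^ q) ^ (1 / q)

/-- The exponential factor `e^{-is cos l}` has modulus one. -/
lemma norm_exp_neg_I_mul_cos (s l : ℝ) : ‖Complex.exp (-Complex.I * s * Real.cos l)‖ = 1 := by
  have h : -Complex.I * s * Real.cos l = ((-(s * Real.cos l) : ℝ) : ℂ) * Complex.I := by
    push_cast; ring
  rw [h, Complex.norm_exp_ofReal_mul_I]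

lemma hasDerivAt_exp_neg_I_mul_cos (s l : ℝ) :
    HasDerivAt (fun x : ℝ => Complex.exp (-Complex.I * s * Real.cos x))
      (Complex.exp (-Complex.I * s * Real.cos l) * (Complex.I * s * Real.sin l)) l := by
  convert (((Real.hasDerivAt_cos l).ofReal_comp).const_mul (-Complex.I * s)).cexp using 1
  push_cast; ring

lemma continuous_exp_neg_I_mul_cos (s : ℝ) :
    Continuous fun x : ℝ => Complex.exp (-Complex.I * s * Real.cos x) :=
  continuous_iff_continuousAt.2 fun l => (hasDerivAt_exp_neg_I_mul_cos s l).continuousAt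

lemma hasDerivAt_cos_mul_div_sin (m : ℕ) {l : ℝ} (hl : Real.sin l ≠ 0) :
    HasDerivAt (fun x : ℝ => Real.cos (m * x) / Real.sin x)
      ((-(m * Real.sin (m * l)) * Real.sin l - Real.cos (m * l) * Real.cos l) / Real.sin l ^ 2)
      l := by
  have h1 : HasDerivAt (fun x : ℝ => Real.cos (m * x)) (-(m * Real.sin (m * l))) l := by
    simpa [mul_comm] using ((hasDerivAt_id l).const_mul (m : ℝ)).cos
  exact h1.div (Real.hasDerivAt_sin l) hl

lemma abs_deriv_cos_mul_div_sin_le (m : ℕ) (l : ℝ) :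
    |(-(m * Real.sin (m * l)) * Real.sin l - Real.cos (m * l) * Real.cos l) / Real.sin l ^ 2|
      ≤ (m + 1) / Real.sin l ^ 2 := by
  rw [abs_div, abs_of_nonneg (sq_nonneg (Real.sin l))]
  gcongr
  refine (abs_sub _ _).trans ?_
  rw [abs_mul, abs_mul, abs_neg, abs_mul, Nat.abs_cast]
  have h1 := Real.abs_sin_le_one (m * l)
  have h2 := Real.abs_sin_le_one l
  have h3 := Real.abs_cos_le_one (m * l)
  have h4 := Real.abs_cos_le_one l
  have h5 : (m : ℝ) * |Real.sin (m * l)| * |Real.sin l| ≤ m * 1 * 1 := by gcongr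
  have h6 : |Real.cos (m * l)| * |Real.cos l| ≤ 1 * 1 := by gcongr
  linarith

lemma sin_pos_of_mem_uIcc {δ l : ℝ} (hδ : 0 < δ) (hδ' : δ ≤ Real.pi / 2)
    (hl : l ∈ Set.uIcc δ (Real.pi - δ)) : 0 < Real.sin l := by
  rw [Set.uIcc_of_le (by linarith)] at hl
  exact Real.sin_pos_of_pos_of_lt_pi (by linarith [hl.1]) (by linarith [hl.2])

lemma intervalIntegrable_inv_sin_sq {δ : ℝ} (hδ : 0 < δ) (hδ' : δ ≤ Real.pi / 2) (c : ℝ) :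
    IntervalIntegrable (fun l => c / Real.sin l ^ 2) volume δ (Real.pi - δ) := by
  apply ContinuousOn.intervalIntegrable
  refine continuousOn_const.div (by fun_prop) fun l hl => ?_
  exact (pow_pos (sin_pos_of_mem_uIcc hδ hδ' hl) 2).ne'

lemma integral_div_sin_sq {δ : ℝ} (hδ : 0 < δ) (hδ' : δ ≤ Real.pi / 2) (c : ℝ) :
    ∫ l in δ..(Real.pi - δ), c / Real.sin l ^ 2 = 2 * c * (Real.cos δ / Real.sin δ) := by
  have hd : ∀ l ∈ Set.uIcc δ (Real.pi - δ),
      HasDerivAt (fun x => -c * (Real.cos x / Real.sin x)) (c / Real.sin l ^ 2) l := by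
    intro l hl
    have hs := (sin_pos_of_mem_uIcc hδ hδ' hl).ne'
    refine (((Real.hasDerivAt_cos l).div (Real.hasDerivAt_sin l) hs).const_mul (-c)).congr_deriv ?_
    rw [mul_div_assoc']
    congr 1
    linear_combination c * Real.sin_sq_add_cos_sq l
  rw [intervalIntegral.integral_eq_sub_of_hasDerivAt hd
    (intervalIntegrable_inv_sin_sq hδ hδ' c), Real.cos_pi_sub, Real.sin_pi_sub]
  ring

/-- Nonstationary part of the Bessel integral, away from the critical points `0` and `π`. -/
lemma norm_integral_middle_le (m : ℕ) {s δ : ℝ} (hs : s ≠ 0) (hδ : 0 < δ)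
    (hδ' : δ ≤ Real.pi / 2) :
    ‖∫ l in δ..(Real.pi - δ), Complex.exp (-Complex.I * s * Real.cos l) * (Real.cos (m * l) : ℂ)‖
      ≤ 2 * (m + 2) / (|s| * Real.sin δ) := by
  have hsin : 0 < Real.sin δ := Real.sin_pos_of_pos_of_lt_pi hδ (by linarith [Real.pi_pos])
  have hle : δ ≤ Real.pi - δ := by linarith
  have hpos : ∀ l ∈ Set.uIcc δ (Real.pi - δ), 0 < Real.sin l :=
    fun l hl => sin_pos_of_mem_uIcc hδ hδ' hl
  set u : ℝ → ℂ := fun l => ((Real.cos (m * l) / Real.sin l : ℝ) : ℂ) with hu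
  set u' : ℝ → ℂ := fun l => (((-(m * Real.sin (m * l)) * Real.sin l
    - Real.cos (m * l) * Real.cos l) / Real.sin l ^ 2 : ℝ) : ℂ) with hu'
  set v : ℝ → ℂ := fun l => Complex.exp (-Complex.I * s * Real.cos l) with hv
  have hparts := intervalIntegral.integral_mul_deriv_eq_deriv_mul (u := u) (u' := u') (v := v)
    (v' := fun l => v l * (Complex.I * s * Real.sin l)) (a := δ) (b := Real.pi - δ)
    (fun l hl => (hasDerivAt_cos_mul_div_sin m (hpos l hl).ne').ofReal_comp)
    (fun l _ => hasDerivAt_exp_neg_I_mul_cos s l)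
    (by
      apply ContinuousOn.intervalIntegrable
      refine Complex.continuous_ofReal.comp_continuousOn ?_
      refine ContinuousOn.div (by fun_prop) (by fun_prop) fun l hl => ?_
      exact (pow_pos (hpos l hl) 2).ne')
    (by
      apply Continuous.intervalIntegrable
      have := continuous_exp_neg_I_mul_cos s
      fun_prop)
  have hcongr : ∫ l in δ..(Real.pi - δ), u l * (v l * (Complex.I * s * Real.sin l))
      = (Complex.I * s) * ∫ l in δ..(Real.pi - δ), v l * (Real.cos (m * l) : ℂ) := by
    rw [← intervalIntegral.integral_const_mul]
    refine intervalIntegral.integral_congr fun l hl => ?_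
    have : (Real.sin l : ℂ) ≠ 0 := by exact_mod_cast (hpos l hl).ne'
    simp only [hu, Complex.ofReal_div]
    field_simp
  have hv1 : ∀ l, ‖v l‖ = 1 := norm_exp_neg_I_mul_cos s
  have hu1 : ∀ l, 0 < Real.sin l → ‖u l‖ ≤ 1 / Real.sin l := by
    intro l hl
    rw [hu, Complex.norm_real, Real.norm_eq_abs, abs_div, abs_of_pos hl]
    gcongr
    exact Real.abs_cos_le_one _
  have hrem : ‖∫ l in δ..(Real.pi - δ), u' l * v l‖ ≤ 2 * (m + 1) * (1 / Real.sin δ) := by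
    refine (intervalIntegral.norm_integral_le_of_norm_le hle (Eventually.of_forall fun l _ => ?_)
      (intervalIntegrable_inv_sin_sq hδ hδ' (m + 1))).trans ?_
    · rw [norm_mul, hv1, mul_one, hu', Complex.norm_real]
      exact abs_deriv_cos_mul_div_sin_le m l
    · rw [integral_div_sin_sq hδ hδ']
      gcongr
      exact Real.cos_le_one δ
  have hb1 : ‖u (Real.pi - δ) * v (Real.pi - δ)‖ ≤ 1 / Real.sin δ := by
    rw [norm_mul, hv1, mul_one]
    simpa using hu1 (Real.pi - δ) (by simpa using hsin)
  have hb2 : ‖u δ * v δ‖ ≤ 1 / Real.sin δ := by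
    rw [norm_mul, hv1, mul_one]
    exact hu1 δ hsin
  have hnorm : |s| * ‖∫ l in δ..(Real.pi - δ), v l * (Real.cos (m * l) : ℂ)‖
      ≤ 2 * (m + 2) / Real.sin δ := by
    have h := congrArg norm (hcongr.symm.trans hparts)
    rw [norm_mul, norm_mul, Complex.norm_I, one_mul, Complex.norm_real, Real.norm_eq_abs] at h
    rw [h]
    calc _ ≤ ‖u (Real.pi - δ) * v (Real.pi - δ)‖ + ‖u δ * v δ‖
          + ‖∫ l in δ..(Real.pi - δ), u' l * v l‖ :=
          (norm_sub_le _ _).trans (by gcongr; exact norm_sub_le _ _)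
      _ ≤ 1 / Real.sin δ + 1 / Real.sin δ + 2 * (m + 1) * (1 / Real.sin δ) := by gcongr
      _ = 2 * (m + 2) / Real.sin δ := by ring
  rw [← div_div, div_right_comm, le_div_iff₀' (abs_pos.2 hs)]
  exact hnorm

lemma norm_exp_mul_cos_le_one (m : ℕ) (s l : ℝ) :
    ‖Complex.exp (-Complex.I * s * Real.cos l) * (Real.cos (m * l) : ℂ)‖ ≤ 1 := by
  rw [norm_mul, norm_exp_neg_I_mul_cos, one_mul, Complex.norm_real]
  exact Real.abs_cos_le_one _

/-- Decay of the Bessel integral, with polynomial dependence on the order. -/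
lemma norm_integral_exp_mul_cos_le (m : ℕ) {s : ℝ} (hs : s ≠ 0) :
    ‖∫ l in (0 : ℝ)..Real.pi,
        Complex.exp (-Complex.I * s * Real.cos l) * (Real.cos (m * l) : ℂ)‖
      ≤ 8 * (m + 2) * |s| ^ (-(1 / 2) : ℝ) := by
  have hs0 : 0 < |s| := abs_pos.2 hs
  have hpi := Real.pi_le_four
  have hpi3 := Real.pi_gt_three
  set f : ℝ → ℂ := fun l => Complex.exp (-Complex.I * s * Real.cos l) * (Real.cos (m * l) : ℂ)
    with hf
  have hf1 : ∀ l, ‖f l‖ ≤ 1 := norm_exp_mul_cos_le_one m s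
  have hfc : Continuous f := by
    have := continuous_exp_neg_I_mul_cos s
    fun_prop
  have hfi : ∀ a b, IntervalIntegrable f volume a b := fun a b => hfc.intervalIntegrable a b
  have htriv : ∀ a b, ‖∫ l in a..b, f l‖ ≤ |b - a| := fun a b => by
    simpa using intervalIntegral.norm_integral_le_of_norm_le_const (a := a) (b := b)
      (fun l _ => hf1 l)
  set δ : ℝ := |s| ^ (-(1 / 2) : ℝ) with hδdef
  have hδ : 0 < δ := Real.rpow_pos_of_pos hs0 _
  rcases le_or_gt |s| 1 with h1 | h1
  · have hδ1 : 1 ≤ δ := Real.one_le_rpow_of_pos_of_le_one_of_nonpos hs0 h1 (by norm_num)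
    have h2 := htriv 0 Real.pi
    rw [sub_zero, abs_of_pos Real.pi_pos] at h2
    have : 8 * ((m : ℝ) + 2) * 1 ≤ 8 * (m + 2) * δ := by gcongr
    have hm : (0 : ℝ) ≤ m := m.cast_nonneg
    linarith
  · have hδ1 : δ ≤ 1 := Real.rpow_le_one_of_one_le_of_nonpos h1.le (by norm_num)
    have hδ' : δ ≤ Real.pi / 2 := by linarith
    have hsq : |s| * δ * δ = 1 := by
      rw [mul_assoc, hδdef, ← Real.rpow_add hs0]
      nth_rewrite 1 [← Real.rpow_one |s|]
      rw [← Real.rpow_add hs0]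
      norm_num
    have hsin : δ / 2 ≤ Real.sin δ := by
      refine le_trans ?_ (Real.mul_le_sin hδ.le hδ')
      rw [div_eq_inv_mul]
      gcongr
      rw [inv_eq_one_div, div_le_div_iff₀ two_pos Real.pi_pos]
      linarith
    have hmid := norm_integral_middle_le m hs hδ hδ'
    have hmid' : 2 * ((m : ℝ) + 2) / (|s| * Real.sin δ) ≤ 4 * (m + 2) * δ := by
      have hsinpos : 0 < Real.sin δ := by linarith
      rw [div_le_iff₀ (by positivity)]
      calc 2 * ((m : ℝ) + 2) = 4 * (m + 2) * δ * (|s| * (δ / 2)) := by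
            linear_combination (-(2 * ((m : ℝ) + 2))) * hsq
        _ ≤ _ := by gcongr
    have hsplit : ∫ l in (0 : ℝ)..Real.pi, f l = (∫ l in (0 : ℝ)..δ, f l)
        + (∫ l in δ..(Real.pi - δ), f l) + ∫ l in (Real.pi - δ)..Real.pi, f l := by
      rw [intervalIntegral.integral_add_adjacent_intervals (hfi _ _) (hfi _ _),
        intervalIntegral.integral_add_adjacent_intervals (hfi _ _) (hfi _ _)]
    have hl := htriv 0 δ
    have hr := htriv (Real.pi - δ) Real.pi
    rw [sub_zero, abs_of_pos hδ] at hl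
    rw [sub_sub_cancel, abs_of_pos hδ] at hr
    rw [hsplit]
    refine (norm_add₃_le).trans ?_
    have hm : (0 : ℝ) ≤ m * δ := by positivity
    linarith

/-- Integration by parts turns the spherical kernel integral into a Bessel integral. -/
lemma integral_exp_mul_sin_mul_sin (m : ℕ) (s : ℝ) :
    (Complex.I * s) * ∫ l in (0 : ℝ)..Real.pi, Complex.exp (-Complex.I * s * Real.cos l) *
        (Real.sin l : ℂ) * (Real.sin (m * l) : ℂ)
      = -(m * ∫ l in (0 : ℝ)..Real.pi,
        Complex.exp (-Complex.I * s * Real.cos l) * (Real.cos (m * l) : ℂ)) := by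
  have hc := continuous_exp_neg_I_mul_cos s
  have hu : ∀ l : ℝ, HasDerivAt (fun x : ℝ => ((Real.sin (m * x) : ℝ) : ℂ))
      ((m * Real.cos (m * l) : ℝ) : ℂ) l := by
    intro l
    refine HasDerivAt.ofReal_comp ?_
    simpa [mul_comm] using ((hasDerivAt_id l).const_mul (m : ℝ)).sin
  have hparts := intervalIntegral.integral_mul_deriv_eq_deriv_mul (a := 0) (b := Real.pi)
    (fun l _ => hu l) (fun l _ => hasDerivAt_exp_neg_I_mul_cos s l)
    (Continuous.intervalIntegrable (by fun_prop) _ _)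
    (Continuous.intervalIntegrable (by fun_prop) _ _)
  rw [mul_zero, Real.sin_zero, Real.sin_nat_mul_pi, Complex.ofReal_zero, zero_mul, zero_mul,
    sub_zero, zero_sub] at hparts
  rw [← intervalIntegral.integral_const_mul, ← intervalIntegral.integral_const_mul]
  convert hparts using 1
  · congr 1; ext l; ring
  · congr 2; ext l; push_cast; ring

lemma norm_integral_exp_mul_sin_mul_sin_le (m : ℕ) {s : ℝ} (hs : s ≠ 0) :
    ‖∫ l in (0 : ℝ)..Real.pi, Complex.exp (-Complex.I * s * Real.cos l) *
        (Real.sin l : ℂ) * (Real.sin (m * l) : ℂ)‖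
      ≤ 8 * (m + 2) ^ 2 * |s| ^ (-(3 / 2) : ℝ) := by
  have hs0 : 0 < |s| := abs_pos.2 hs
  have h := congrArg norm (integral_exp_mul_sin_mul_sin m s)
  rw [norm_neg, norm_mul, norm_mul, norm_mul, Complex.norm_I, one_mul, Complex.norm_real,
    Real.norm_eq_abs, Complex.norm_natCast] at h
  have hpow : |s| ^ (-(1 / 2) : ℝ) = |s| * |s| ^ (-(3 / 2) : ℝ) := by
    nth_rewrite 2 [← Real.rpow_one |s|]
    rw [← Real.rpow_add hs0]
    norm_num
  refine le_of_mul_le_mul_left ?_ hs0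
  rw [h]
  calc _ ≤ ((m : ℝ) + 2) * (8 * (m + 2) * |s| ^ (-(1 / 2) : ℝ)) := by
        gcongr
        · linarith
        · exact norm_integral_exp_mul_cos_le m hs
    _ = _ := by rw [hpow]; ring

lemma norm_integral_exp_mul_sin_mul_sin_le_pi (m : ℕ) (s : ℝ) :
    ‖∫ l in (0 : ℝ)..Real.pi, Complex.exp (-Complex.I * s * Real.cos l) *
        (Real.sin l : ℂ) * (Real.sin (m * l) : ℂ)‖ ≤ Real.pi := by
  have h := intervalIntegral.norm_integral_le_of_norm_le_const (a := 0) (b := Real.pi) (C := 1)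
    (f := fun l : ℝ => Complex.exp (-Complex.I * s * Real.cos l) *
      (Real.sin l : ℂ) * (Real.sin (m * l) : ℂ)) (fun l _ => by
        rw [norm_mul, norm_mul, norm_exp_neg_I_mul_cos, one_mul, Complex.norm_real,
          Complex.norm_real]
        exact mul_le_one₀ (Real.abs_sin_le_one _) (abs_nonneg _) (Real.abs_sin_le_one _))
  simpa [abs_of_pos Real.pi_pos] using h

/-- Polynomially weighted geometric series with a shifted polynomial factor are summable. -/
lemma summable_add_pow_mul_geometric (k a : ℕ) {r : ℝ} (hr0 : 0 < r) (hr : r < 1) :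
    Summable fun n : ℕ => ((n : ℝ) + a) ^ k * r ^ n := by
  have h := summable_pow_mul_geometric_of_norm_lt_one k
    (show ‖r‖ < 1 by rwa [Real.norm_eq_abs, abs_of_pos hr0])
  refine (((summable_nat_add_iff a).2 h).mul_left (r ^ a)⁻¹).congr fun n => ?_
  rw [pow_add]
  push_cast
  field_simp

/-- Spatial envelope of the Schrödinger kernel: a quadratic factor times `Q^{-n/2}`. -/
def envelope (Q n : ℕ) : ℝ := (Q : ℝ) ^ (-(n : ℝ) / 2) * ((n : ℝ) + 3) ^ 2

lemma envelope_nonneg (Q n : ℕ) : 0 ≤ envelope Q n := by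
  unfold envelope; positivity

lemma exists_envelope_le {Q : ℕ} (hQ : 2 ≤ Q) : ∃ G : ℝ, 0 < G ∧ ∀ n, envelope Q n ≤ G := by
  have hQ1 : (1 : ℝ) < Q := by exact_mod_cast hQ
  have hQ0 : (0 : ℝ) < Q := by linarith
  have hr : (Q : ℝ) ^ (-(1 / 2) : ℝ) < 1 := Real.rpow_lt_one_of_one_lt_of_neg hQ1 (by norm_num)
  have hs : Summable (envelope Q) := by
    refine (summable_add_pow_mul_geometric 2 3 (Real.rpow_pos_of_pos hQ0 _) hr).congr fun n => ?_
    rw [envelope, ← Real.rpow_mul_natCast hQ0.le, mul_comm]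
    congr 2
    ring
  refine ⟨∑' n, envelope Q n + 1, ?_, fun n => ?_⟩
  · linarith [(tsum_nonneg (envelope_nonneg Q) : 0 ≤ ∑' n, envelope Q n)]
  · linarith [hs.le_tsum n fun j _ => envelope_nonneg Q j]

/-- A polynomial bound on the oscillatory integrals yields the envelope bound on the kernel. -/
lemma exists_norm_schKernel_le {Q : ℕ} (hQ : 2 ≤ Q) : ∃ D : ℝ, 0 < D ∧ ∀ (t B : ℝ),
    (∀ m : ℕ, ‖∫ l in (0 : ℝ)..Real.pi,
      Complex.exp (-Complex.I * ((gammaZero Q * t : ℝ) : ℂ) * Real.cos l) *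
        (Real.sin l : ℂ) * (Real.sin (m * l) : ℂ)‖ ≤ B * (m + 2) ^ 2) →
    ∀ n, ‖schKernel Q t n‖ ≤ D * B * envelope Q n := by
  have hQ1 : (1 : ℝ) < Q := by exact_mod_cast hQ
  have hQ0 : (0 : ℝ) < Q := by linarith
  have hsum := (summable_add_pow_mul_geometric 2 1 (inv_pos.2 hQ0)
    (inv_lt_one_of_one_lt₀ hQ1)).mul_left 4
  have hnn : 0 ≤ ∑' k : ℕ, 4 * (((k : ℝ) + (1 : ℕ)) ^ 2 * (Q : ℝ)⁻¹ ^ k) :=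
    tsum_nonneg fun k => by positivity
  refine ⟨∑' k : ℕ, 4 * (((k : ℝ) + (1 : ℕ)) ^ 2 * (Q : ℝ)⁻¹ ^ k) + 1, by linarith,
    fun t B hB n => ?_⟩
  have hB0 : 0 ≤ B := by
    have := (norm_nonneg _).trans (hB 0)
    norm_num at this
    linarith
  have he := envelope_nonneg Q n
  have hterm : ∀ k : ℕ, ‖(((Q : ℝ) ^ (-(n : ℝ) / 2 - (k : ℝ)) : ℝ) : ℂ) *
      ∫ l in (0 : ℝ)..Real.pi, Complex.exp (-Complex.I * (gammaZero Q) * t * Real.cos l) *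
        (Real.sin l : ℂ) * (Real.sin (((n : ℝ) + 2 * k + 1) * l) : ℂ)‖
      ≤ B * envelope Q n * (4 * (((k : ℝ) + (1 : ℕ)) ^ 2 * (Q : ℝ)⁻¹ ^ k)) := by
    intro k
    have h := hB (n + 2 * k + 1)
    push_cast at h
    rw [← mul_assoc (-Complex.I) (gammaZero Q : ℂ) (t : ℂ)] at h
    have hpow : (Q : ℝ) ^ (-(n : ℝ) / 2 - (k : ℝ)) = (Q : ℝ) ^ (-(n : ℝ) / 2) * (Q : ℝ)⁻¹ ^ k := by
      rw [Real.rpow_sub hQ0, Real.rpow_natCast, inv_pow, div_eq_mul_inv]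
    rw [norm_mul, Complex.norm_real, Real.norm_of_nonneg (by positivity), hpow, envelope]
    push_cast
    have hn : (0 : ℝ) ≤ n := n.cast_nonneg
    have hk : (0 : ℝ) ≤ k := k.cast_nonneg
    calc _ ≤ (Q : ℝ) ^ (-(n : ℝ) / 2) * (Q : ℝ)⁻¹ ^ k * (B * (n + 2 * k + 1 + 2) ^ 2) := by gcongr
      _ ≤ (Q : ℝ) ^ (-(n : ℝ) / 2) * (Q : ℝ)⁻¹ ^ k * (B * ((n + 3) * (2 * (k + 1))) ^ 2) := by
        gcongr
        nlinarith [mul_nonneg hn hk]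
      _ = _ := by ring
  have htsum := tsum_of_norm_bounded (hsum.mul_left (B * envelope Q n)).hasSum hterm
  rw [tsum_mul_left] at htsum
  have hexp : ‖Complex.exp (Complex.I * t)‖ = 1 := by
    rw [mul_comm, Complex.norm_exp_ofReal_mul_I]
  have hpi : ‖(2 / Real.pi : ℂ)‖ ≤ 1 := by
    rw [norm_div, Complex.norm_real, Real.norm_of_nonneg Real.pi_pos.le, Complex.norm_ofNat,
      div_le_one Real.pi_pos]
    linarith [Real.pi_gt_three]
  rw [schKernel, norm_mul, norm_mul, hexp, one_mul]
  have hBe : 0 ≤ B * envelope Q n := by positivity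
  calc _ ≤ 1 * _ := mul_le_mul hpi htsum (norm_nonneg _) zero_le_one
    _ ≤ _ := by linarith

/-- The radial norm is monotone and homogeneous with respect to pointwise bounds. -/
lemma radNorm_le_of_norm_le (Q : ℕ) {q A : ℝ} (hq : 0 < q) (hA : 0 ≤ A) {f : ℕ → ℂ} {g : ℕ → ℝ}
    (hg : ∀ n, 0 ≤ g n) (h : ∀ n, ‖f n‖ ≤ A * g n) :
    radNorm Q q f ≤ ENNReal.ofReal A * radNorm Q q fun n => (g n : ℂ) := by
  have hpt : ∀ n, (‖f n‖₊ : ℝ≥0∞) ^ q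
      ≤ ENNReal.ofReal A ^ q * (‖(g n : ℂ)‖₊ : ℝ≥0∞) ^ q := by
    intro n
    rw [← ENNReal.mul_rpow_of_nonneg _ _ hq.le]
    refine ENNReal.rpow_le_rpow ?_ hq.le
    rw [← enorm_eq_nnnorm, ← enorm_eq_nnnorm, ← ofReal_norm, ← ofReal_norm,
      ← ENNReal.ofReal_mul hA, Complex.norm_real, Real.norm_of_nonneg (hg n)]
    exact ENNReal.ofReal_le_ofReal (h n)
  have hroot : ENNReal.ofReal A = (ENNReal.ofReal A ^ q) ^ (1 / q) := by
    rw [← ENNReal.rpow_mul, mul_one_div_cancel hq.ne', ENNReal.rpow_one]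
  rw [hroot, radNorm, radNorm, ← ENNReal.mul_rpow_of_nonneg _ _ (by positivity)]
  refine ENNReal.rpow_le_rpow ?_ (by positivity)
  rw [mul_add, ← ENNReal.tsum_mul_left]
  refine add_le_add (hpt 0) (ENNReal.tsum_le_tsum fun n => ?_)
  rw [mul_left_comm]
  gcongr
  exact hpt (n + 1)

lemma radNorm_envelope_ne_top {Q : ℕ} (hQ : 2 ≤ Q) {q : ℝ} (hq : 2 < q) :
    radNorm Q q (fun n => (envelope Q n : ℂ)) ≠ ⊤ := by
  have hQ1 : (1 : ℝ) < Q := by exact_mod_cast hQ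
  have hQ0 : (0 : ℝ) < Q := by linarith
  have hq0 : 0 < q := by linarith
  refine ENNReal.rpow_ne_top_of_nonneg (by positivity) (ENNReal.add_ne_top.2
    ⟨ENNReal.rpow_ne_top_of_nonneg hq0.le ENNReal.coe_ne_top, ?_⟩)
  obtain ⟨k, hk⟩ := exists_nat_ge (2 * q)
  have hr : (Q : ℝ) ^ (1 - q / 2) < 1 := Real.rpow_lt_one_of_one_lt_of_neg hQ1 (by linarith)
  have hs := (summable_add_pow_mul_geometric k 4 (Real.rpow_pos_of_pos hQ0 _) hr).mul_left
    ((Q : ℝ) + 1)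
  refine ne_top_of_le_ne_top hs.tsum_ofReal_ne_top (ENNReal.tsum_le_tsum fun n => ?_)
  have hconv : ((Q : ℝ≥0∞) + 1) * (Q : ℝ≥0∞) ^ n * (‖(envelope Q (n + 1) : ℂ)‖₊ : ℝ≥0∞) ^ q
      = ENNReal.ofReal (((Q : ℝ) + 1) * (Q : ℝ) ^ n * envelope Q (n + 1) ^ q) := by
    rw [ENNReal.ofReal_mul (by positivity), ENNReal.ofReal_mul (by positivity),
      ENNReal.ofReal_add hQ0.le zero_le_one, ENNReal.ofReal_one, ENNReal.ofReal_pow hQ0.le,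
      ENNReal.ofReal_natCast, ← ENNReal.ofReal_rpow_of_nonneg (envelope_nonneg Q _) hq0.le,
      ← enorm_eq_nnnorm, ← ofReal_norm, Complex.norm_real,
      Real.norm_of_nonneg (envelope_nonneg Q _)]
  rw [hconv]
  refine ENNReal.ofReal_le_ofReal ?_
  rw [mul_assoc]
  refine mul_le_mul_of_nonneg_left ?_ (by positivity)
  have hn : (0 : ℝ) ≤ n := n.cast_nonneg
  have hpoly : (((n : ℝ) + 4) ^ 2) ^ q ≤ ((n : ℝ) + 4) ^ k := by
    rw [← Real.rpow_natCast, ← Real.rpow_natCast, ← Real.rpow_mul (by positivity)]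
    exact Real.rpow_le_rpow_of_exponent_le (by linarith) (by exact_mod_cast hk)
  have hgeom : (Q : ℝ) ^ n * ((Q : ℝ) ^ (-((n + 1 : ℕ) : ℝ) / 2)) ^ q
      ≤ ((Q : ℝ) ^ (1 - q / 2)) ^ n := by
    rw [← Real.rpow_mul hQ0.le, ← Real.rpow_natCast, ← Real.rpow_add hQ0,
      ← Real.rpow_mul_natCast hQ0.le]
    refine Real.rpow_le_rpow_of_exponent_le hQ1.le ?_
    push_cast
    linarith
  have hcast : ((n + 1 : ℕ) : ℝ) + 3 = n + 4 := by push_cast; ring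
  rw [envelope, hcast, Real.mul_rpow (by positivity) (by positivity), ← mul_assoc,
    mul_comm (((n : ℝ) + (4 : ℕ)) ^ k)]
  exact mul_le_mul hgeom hpoly (by positivity) (by positivity)

/-- Pointwise dispersive estimate for the Schrödinger kernel. -/
lemma exists_norm_schKernel_le_envelope {Q : ℕ} (hQ : 2 ≤ Q) : ∃ A : ℝ, 0 < A ∧ ∀ t : ℝ,
    (∀ n, ‖schKernel Q t n‖ ≤ A * envelope Q n) ∧
    (1 ≤ |t| → ∀ n, ‖schKernel Q t n‖ ≤ A * |t| ^ (-(3 / 2) : ℝ) * envelope Q n) := by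
  have hQ0 : (0 : ℝ) < Q := by exact_mod_cast (show 0 < Q by omega)
  have hγ : 0 < gammaZero Q := by unfold gammaZero; positivity
  obtain ⟨D, hD, hker⟩ := exists_norm_schKernel_le hQ
  have hc : 0 < gammaZero Q ^ (-(3 / 2) : ℝ) := Real.rpow_pos_of_pos hγ _
  refine ⟨D * (4 + 8 * gammaZero Q ^ (-(3 / 2) : ℝ)), by positivity, fun t => ⟨fun n => ?_,
    fun ht n => ?_⟩⟩
  · refine hker t _ (fun m => ?_) n
    refine (norm_integral_exp_mul_sin_mul_sin_le_pi m _).trans (Real.pi_le_four.trans ?_)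
    have h1 : (1 : ℝ) ≤ (m + 2) ^ 2 := one_le_pow₀ (by linarith [m.cast_nonneg (α := ℝ)])
    nlinarith
  · rw [mul_assoc D]
    refine hker t _ (fun m => ?_) n
    have ht0 : t ≠ 0 := by
      rintro rfl
      norm_num at ht
    refine (norm_integral_exp_mul_sin_mul_sin_le m (mul_ne_zero hγ.ne' ht0)).trans ?_
    rw [abs_mul, abs_of_pos hγ, Real.mul_rpow hγ.le (abs_nonneg t)]
    have h0 : 0 ≤ 4 * |t| ^ (-(3 / 2) : ℝ) * ((m : ℝ) + 2) ^ 2 := by positivity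
    linarith

/-- `L^q` estimates for the Schrödinger kernel, for every `q > 2` (including
`q = ∞`, expressed as a sup bound): `‖s_t‖_{L^q} ≲ 1` for `|t| < 1` and
`‖s_t‖_{L^q} ≲ |t|^{-3/2}` for `|t| ≥ 1`. -/
theorem kernel_lq_estimates (Q : ℕ) (hQ : 2 ≤ Q) :
    (∀ q : ℝ, 2 < q → ∃ C : ℝ≥0, 0 < C ∧ ∀ t : ℝ,
      (|t| < 1 → radNorm Q q (schKernel Q t) ≤ (C : ℝ≥0∞)) ∧
      (1 ≤ |t| → radNorm Q q (schKernel Q t) ≤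
        (C : ℝ≥0∞) * ENNReal.ofReal (|t| ^ (-(3 / 2) : ℝ)))) ∧
    (∃ C : ℝ, 0 < C ∧ ∀ t : ℝ,
      (|t| < 1 → ∀ n : ℕ, ‖schKernel Q t n‖ ≤ C) ∧
      (1 ≤ |t| → ∀ n : ℕ, ‖schKernel Q t n‖ ≤ C * |t| ^ (-(3 / 2) : ℝ))) := by
  obtain ⟨A, hA, hker⟩ := exists_norm_schKernel_le_envelope hQ
  refine ⟨fun q hq => ?_, ?_⟩
  · have hq0 : 0 < q := by linarith
    obtain ⟨N, hN⟩ : ∃ N : ℝ≥0, (N : ℝ≥0∞) = radNorm Q q fun n => (envelope Q n : ℂ) :=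
      ⟨_, ENNReal.coe_toNNReal (radNorm_envelope_ne_top hQ hq)⟩
    have hle : ∀ a b : ℝ≥0, (a : ℝ≥0∞) * b ≤ ((a * b + 1 : ℝ≥0) : ℝ≥0∞) := fun a b => by
      rw [← ENNReal.coe_mul]
      exact ENNReal.coe_le_coe.2 le_self_add
    refine ⟨A.toNNReal * N + 1, by positivity, fun t => ⟨fun _ => ?_, fun ht => ?_⟩⟩
    · refine (radNorm_le_of_norm_le Q hq0 hA.le (envelope_nonneg Q) (hker t).1).trans ?_
      rw [← hN]
      exact hle _ _
    · refine (radNorm_le_of_norm_le Q hq0 (by positivity) (envelope_nonneg Q)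
        ((hker t).2 ht)).trans ?_
      rw [← hN, ENNReal.ofReal_mul hA.le, mul_right_comm]
      gcongr
      exact hle _ _
  · obtain ⟨G, hG, hbound⟩ := exists_envelope_le hQ
    refine ⟨A * G, by positivity, fun t => ⟨fun _ n => ?_, fun ht n => ?_⟩⟩
    · refine ((hker t).1 n).trans ?_
      gcongr
      exact hbound n
    · refine ((hker t).2 ht n).trans ?_
      rw [mul_right_comm]
      gcongr
      exact hbound n
end
end

section
/- (Strichartz estimates) Assume $(\frac1p,\frac1q)$ and $(\frac1{\tilde p},\frac1{\tilde q})$ belong to the set $\mathcal{C}=\bigl((0,\frac12]\times[0,\frac12)\bigr)\cup\{(0,\frac12)\}$. Then there is a constant $C>0$ such that for every $f\in L^2(\mathbb{T})$ and every $F\in L^{\tilde p'}(\mathbb{R};L^{\tilde q'}(\mathbb{T}))$, the function $u(t)=e^{it\mathcal{L}}f-i\int_0^t e^{i(t-s)\mathcal{L}}F(s)\,ds$ satisfies $\|u\|_{L^p(\mathbb{R};L^q(\mathbb{T}))}\le C\bigl(\|f\|_{L^2(\mathbb{T})}+\|F\|_{L^{\tilde p'}(\mathbb{R};L^{\tilde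 q'}(\mathbb{T}))}\bigr)$. -/
noncomputable section

open Complex MeasureTheory Filter
open scoped ENNReal NNReal Topology

/-- A homogeneous tree of degree `Q+1`: a connected acyclic graph in which every
vertex has exactly `Q+1` neighbours. -/
structure HomTree (Q : ℕ) : Type 1 where
  V : Type
  graph : SimpleGraph V
  isTree : graph.IsTree
  regular : ∀ x : V, {y : V | graph.Adj x y}.ncard = Q + 1

/-- The sum of `g` over the sphere of radius `n` centred at `x`. -/
def sphereSum {Q : ℕ} (T : HomTree Q) (g : T.V → ℂ) (x : T.V) (n : ℕ) : ℂ :=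
  ∑' y : {y : T.V // T.graph.dist x y = n}, g y

/-- The Schrödinger propagator `e^{itℒ}`, realised (and extended to all
`L^p` spaces) as convolution with the radial kernel `s_t`:
`e^{itℒ}g(x) = ∑_{n≥0} s_t(n) ∑_{d(x,y)=n} g(y)`. -/
def propagate {Q : ℕ} (T : HomTree Q) (t : ℝ) (g : T.V → ℂ) (x : T.V) : ℂ :=
  ∑' n : ℕ, schKernel Q t n * sphereSum T g x n

/-- The `L^q(𝕋)` norm (with the counting measure), valued in `ℝ≥0∞`, for an
exponent `q : ℝ≥0∞`. -/
def spaceNorm {Q : ℕ} (T : HomTree Q) (q : ℝ≥0∞) (g : T.V → ℂ) : ℝ≥0∞ :=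
  if q = ∞ then ⨆ x : T.V, (‖g x‖₊ : ℝ≥0∞)
  else (∑' x : T.V, (‖g x‖₊ : ℝ≥0∞) ^ q.toReal) ^ (1 / q.toReal)

/-- The mixed Lebesgue norm `L^p_t L^q_x` over a time set `A ⊆ ℝ`
(with `sup` in time when `p = ∞`), valued in `ℝ≥0∞`. -/
def mixedNorm {Q : ℕ} (T : HomTree Q) (p q : ℝ≥0∞) (A : Set ℝ)
    (u : ℝ → T.V → ℂ) : ℝ≥0∞ :=
  if p = ∞ then ⨆ t ∈ A, spaceNorm T q (u t)
  else (∫⁻ t in A, (spaceNorm T q (u t)) ^ p.toReal) ^ (1 / p.toReal)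

/-- The admissible set `𝒞 = ((0,1/2] × [0,1/2)) ∪ {(0,1/2)}` for the couple
`(1/p, 1/q)`. -/
def admissiblePair (p q : ℝ≥0∞) : Prop :=
  (0 < p⁻¹ ∧ p⁻¹ ≤ 2⁻¹ ∧ q⁻¹ < 2⁻¹) ∨ (p⁻¹ = 0 ∧ q⁻¹ = 2⁻¹)

namespace HomTree

variable {Q : ℕ} (T : HomTree Q)

lemma finite_neighbors (x : T.V) : {y : T.V | T.graph.Adj x y}.Finite :=
  Set.finite_of_ncard_ne_zero (by rw [T.regular x]; omega)

/-- The neighbours of a vertex, as a finset. -/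
def nbr (x : T.V) : Finset T.V := (T.finite_neighbors x).toFinset

@[simp] lemma mem_nbr {x y : T.V} : y ∈ T.nbr x ↔ T.graph.Adj x y := by simp [nbr]

lemma card_nbr (x : T.V) : (T.nbr x).card = Q + 1 := by
  rw [nbr, ← Set.ncard_eq_toFinset_card _ (T.finite_neighbors x), T.regular x]

lemma finite_ball (x : T.V) (n : ℕ) : {y : T.V | T.graph.dist x y ≤ n}.Finite := by
  induction n generalizing x with
  | zero =>
    refine (Set.finite_singleton x).subset fun y hy => ?_
    have : T.graph.dist x y = 0 := by simpa using hy
    simpa using (T.isTree.connected.dist_eq_zero_iff.1 this).symm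
  | succ n ih =>
    refine ((Set.finite_singleton x).union
      ((T.finite_neighbors x).biUnion fun z _ => ih z)).subset fun y hy => ?_
    obtain ⟨p, hp⟩ := T.isTree.connected.exists_walk_length_eq_dist x y
    cases p with
    | nil => left; simp
    | @cons _ z _ hadj q =>
      right
      simp only [SimpleGraph.Walk.length_cons] at hp
      simp only [Set.mem_iUnion]
      refine ⟨z, hadj, ?_⟩
      have := SimpleGraph.dist_le q
      simp only [Set.mem_ofPred_eq] at hy ⊢
      omega

/-- The ball of radius `n`, as a finset. -/
def ballFinset (x : T.V) (n : ℕ) : Finset T.V := (T.finite_ball x n).toFinset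

@[simp] lemma mem_ballFinset {x y : T.V} {n : ℕ} :
    y ∈ T.ballFinset x n ↔ T.graph.dist x y ≤ n := by simp [ballFinset]

lemma exists_closer_nbr {x y : T.V} (h : x ≠ y) :
    ∃ z, T.graph.Adj x z ∧ T.graph.dist x y = T.graph.dist z y + 1 ∧
      ∀ w, T.graph.Adj x w → w ≠ z → T.graph.dist w y = T.graph.dist x y + 1 := by
  obtain ⟨p, hp⟩ := T.isTree.connected.exists_walk_length_eq_dist x y
  have hpp := p.isPath_of_length_eq_dist hp
  cases p with
  | nil => exact absurd rfl h
  | @cons _ z _ hadj q =>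
    have h1 := SimpleGraph.dist_le q
    simp only [SimpleGraph.Walk.length_cons] at hp
    have key : ∀ w, T.graph.Adj x w → T.graph.dist x y = T.graph.dist w y + 1 ∨
        T.graph.dist w y = T.graph.dist x y + 1 := fun w hw => by
      simpa [SimpleGraph.dist_comm] using T.isTree.dist_eq_dist_add_one_of_adj y hw
    refine ⟨z, hadj, ?_, fun w hw hne => ?_⟩
    · rcases key z hadj with h | h <;> omega
    · rcases key w hw with h2 | h2
      · exfalso
        obtain ⟨q', hq'⟩ := T.isTree.connected.exists_walk_length_eq_dist w y
        have hp2 := (SimpleGraph.Walk.cons hw q').isPath_of_length_eq_dist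
          (by simp [hq', h2])
        have := (T.isTree.isAcyclic.subsingleton_path x y).elim ⟨_, hpp⟩ ⟨_, hp2⟩
        have h3 := congrArg SimpleGraph.Walk.snd (Subtype.mk.inj this)
        simp at h3
        exact hne h3.symm
      · exact h2

lemma sum_nbr_dist {α : Type*} [AddCommMonoid α] (φ : ℕ → α) {x y : T.V} (h : x ≠ y) :
    ∑ z ∈ T.nbr x, φ (T.graph.dist z y) =
      φ (T.graph.dist x y - 1) + Q • φ (T.graph.dist x y + 1) := by
  classical
  obtain ⟨z, hz, hd, hw⟩ := T.exists_closer_nbr h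
  rw [← Finset.add_sum_erase _ _ (T.mem_nbr.2 hz), hd, Nat.add_sub_cancel]
  congr 1
  rw [Finset.sum_congr rfl (g := fun _ => φ (T.graph.dist z y + 1 + 1)), Finset.sum_const,
    Finset.card_erase_of_mem (T.mem_nbr.2 hz), card_nbr, Nat.add_sub_cancel]
  intro w hw'
  rw [Finset.mem_erase, mem_nbr] at hw'
  rw [hw w hw'.2 hw'.1, hd]

lemma sum_nbr_dist_self {α : Type*} [AddCommMonoid α] (φ : ℕ → α) (x : T.V) :
    ∑ z ∈ T.nbr x, φ (T.graph.dist z x) = (Q + 1) • φ 1 := by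
  rw [Finset.sum_congr rfl (g := fun _ => φ 1), Finset.sum_const, card_nbr]
  intro z hz
  rw [SimpleGraph.dist_comm, SimpleGraph.dist_eq_one_iff_adj.2 (T.mem_nbr.1 hz)]

/-- The kernel of the Chebyshev-type operator `U_n` is `Q^{-n/2}` times the indicator function of
this relation. -/
def parityBall (n d : ℕ) : Prop := d ≤ n ∧ d % 2 = n % 2

instance (n d : ℕ) : Decidable (parityBall n d) := instDecidableAnd

lemma sum_nbr_parityBall (n : ℕ) (x y : T.V) :
    (∑ z ∈ T.nbr x, if parityBall (n + 1) (T.graph.dist z y) then (1 : ℝ) else 0) =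
      (if parityBall (n + 2) (T.graph.dist x y) then 1 else 0) +
        Q * (if parityBall n (T.graph.dist x y) then 1 else 0) := by
  rcases eq_or_ne x y with rfl | h
  · rw [T.sum_nbr_dist_self (fun d => if parityBall (n + 1) d then (1 : ℝ) else 0)]
    simp only [SimpleGraph.dist_self, parityBall]
    rcases Nat.mod_two_eq_zero_or_one n with h | h
    · have h1 : (n + 1) % 2 = 1 := by omega
      have h2 : (n + 2) % 2 = 0 := by omega
      simp [h, h1, h2]; ring
    · have h1 : (n + 1) % 2 = 0 := by omega
      have h2 : (n + 2) % 2 = 1 := by omega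
      simp [h, h1, h2]
  · rw [T.sum_nbr_dist (fun d => if parityBall (n + 1) d then (1 : ℝ) else 0) h]
    have hpos := T.isTree.connected.pos_dist_of_ne h
    obtain ⟨d, hd⟩ : ∃ d, T.graph.dist x y = d + 1 := ⟨T.graph.dist x y - 1, by omega⟩
    simp only [hd, Nat.add_sub_cancel, nsmul_eq_mul]
    congr 1
    · congr 1; simp only [parityBall]; rw [eq_iff_iff]; omega
    · congr 2; simp only [parityBall]; rw [eq_iff_iff]; omega

lemma sum_nbr_parityBall_zero (x y : T.V) :
    (∑ z ∈ T.nbr x, if parityBall 0 (T.graph.dist z y) then (1 : ℝ) else 0) =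
      (if parityBall 1 (T.graph.dist x y) then 1 else 0) := by
  rcases eq_or_ne x y with rfl | h
  · rw [T.sum_nbr_dist_self (fun d => if parityBall 0 d then (1 : ℝ) else 0)]
    simp [parityBall]
  · rw [T.sum_nbr_dist (fun d => if parityBall 0 d then (1 : ℝ) else 0) h]
    have hpos := T.isTree.connected.pos_dist_of_ne h
    obtain ⟨d, hd⟩ : ∃ d, T.graph.dist x y = d + 1 := ⟨T.graph.dist x y - 1, by omega⟩
    simp only [hd, Nat.add_sub_cancel, nsmul_eq_mul, parityBall]
    have : ((d ≤ 0 ∧ d % 2 = 0 % 2) ↔ (d + 1 ≤ 1 ∧ (d + 1) % 2 = 1 % 2)) := by omega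
    simp only [this]
    simp

/-- The (unnormalised) spherical function at the bottom of the spectrum. -/
def ground (Q n : ℕ) : ℝ := (1 + ((Q : ℝ) - 1) / (Q + 1) * n) * (Real.sqrt Q)⁻¹ ^ n

lemma ground_pos (hQ : 2 ≤ Q) (n : ℕ) : 0 < ground Q n := by
  have h2 : (2 : ℝ) ≤ Q := by exact_mod_cast hQ
  have : 0 ≤ ((Q : ℝ) - 1) / (Q + 1) * n := by
    have : (0 : ℝ) ≤ (Q : ℝ) - 1 := by linarith
    positivity
  have : 0 < Real.sqrt Q := Real.sqrt_pos.2 (by linarith)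
  unfold ground
  positivity

lemma sum_nbr_ground (hQ : 2 ≤ Q) (x y : T.V) :
    ∑ z ∈ T.nbr x, ground Q (T.graph.dist z y) = 2 * Real.sqrt Q * ground Q (T.graph.dist x y) := by
  have h2 : (2 : ℝ) ≤ Q := by exact_mod_cast hQ
  have hs : 0 < Real.sqrt Q := Real.sqrt_pos.2 (by linarith)
  have hss : (Q : ℝ) = Real.sqrt Q ^ 2 := (Real.sq_sqrt (by linarith)).symm
  set s := Real.sqrt Q with hsdef
  rcases eq_or_ne x y with rfl | h
  · rw [T.sum_nbr_dist_self]
    simp only [SimpleGraph.dist_self, ground, ← hsdef, nsmul_eq_mul]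
    push_cast
    rw [hss]
    field_simp
    ring
  · rw [T.sum_nbr_dist _ h]
    have hpos := T.isTree.connected.pos_dist_of_ne h
    obtain ⟨d, hd⟩ : ∃ d, T.graph.dist x y = d + 1 := ⟨T.graph.dist x y - 1, by omega⟩
    simp only [hd, Nat.add_sub_cancel, ground, ← hsdef, nsmul_eq_mul]
    push_cast
    rw [hss]
    have e1 : s⁻¹ ^ (d + 1) = s⁻¹ ^ d * s⁻¹ := pow_succ _ _
    have e2 : s⁻¹ ^ (d + 1 + 1) = s⁻¹ ^ d * s⁻¹ * s⁻¹ := by rw [pow_succ, pow_succ]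
    rw [e1, e2]
    generalize s⁻¹ ^ d = r
    field_simp
    ring

/-- The kernel of `U_n`. -/
def ker (n : ℕ) (x y : T.V) : ℝ :=
  (Real.sqrt Q)⁻¹ ^ n * if parityBall n (T.graph.dist x y) then 1 else 0

lemma ker_nonneg (n : ℕ) (x y : T.V) : 0 ≤ T.ker n x y := by
  unfold ker; positivity

lemma ker_comm (n : ℕ) (x y : T.V) : T.ker n x y = T.ker n y x := by
  rw [ker, ker, SimpleGraph.dist_comm]

lemma ker_le (n : ℕ) (x y : T.V) : T.ker n x y ≤ (Real.sqrt Q)⁻¹ ^ n := by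
  unfold ker
  split_ifs <;> simp

lemma ker_eq_zero {n : ℕ} {x y : T.V} (h : y ∉ T.ballFinset x n) : T.ker n x y = 0 := by
  rw [mem_ballFinset] at h
  simp [ker, parityBall, h]

lemma ker_zero (x y : T.V) [Decidable (x = y)] : T.ker 0 x y = if x = y then 1 else 0 := by
  have : T.graph.dist x y = 0 ↔ x = y := T.isTree.connected.dist_eq_zero_iff
  simp only [ker, parityBall, pow_zero, one_mul, Nat.le_zero, ← this]
  congr 1
  rw [eq_iff_iff]; omega

lemma ker_one (x y : T.V) :
    T.ker 1 x y = (Real.sqrt Q)⁻¹ * ∑ z ∈ T.nbr x, T.ker 0 z y := by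
  simp only [ker, pow_zero, one_mul, pow_one, sum_nbr_parityBall_zero]

lemma ker_add_two (hQ : 2 ≤ Q) (n : ℕ) (x y : T.V) :
    T.ker (n + 2) x y = (Real.sqrt Q)⁻¹ * ∑ z ∈ T.nbr x, T.ker (n + 1) z y - T.ker n x y := by
  have h2 : (2 : ℝ) ≤ Q := by exact_mod_cast hQ
  have hs : 0 < Real.sqrt Q := Real.sqrt_pos.2 (by linarith)
  have hss : (Q : ℝ) = Real.sqrt Q ^ 2 := (Real.sq_sqrt (by linarith)).symm
  simp only [ker]
  rw [← Finset.mul_sum, sum_nbr_parityBall]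
  generalize (if parityBall (n + 2) (T.graph.dist x y) then (1 : ℝ) else 0) = a
  generalize (if parityBall n (T.graph.dist x y) then (1 : ℝ) else 0) = b
  set s := Real.sqrt Q
  rw [hss]
  have e1 : s⁻¹ ^ (n + 1) = s⁻¹ ^ n * s⁻¹ := pow_succ _ _
  have e2 : s⁻¹ ^ (n + 2) = s⁻¹ ^ n * s⁻¹ * s⁻¹ := by rw [pow_succ, pow_succ]
  rw [e1, e2]
  generalize s⁻¹ ^ n = r
  field_simp
  ring

/-- The spherical function `ground` is an eigenfunction of every `U_n`. -/
lemma sum_ker_ground (hQ : 2 ≤ Q) (o : T.V) (n : ℕ) (x : T.V) (S : Finset T.V)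
    (hS : T.ballFinset x n ⊆ S) :
    ∑ y ∈ S, T.ker n x y * ground Q (T.graph.dist y o) = (n + 1) * ground Q (T.graph.dist x o) := by
  classical
  have hs : 0 < Real.sqrt Q := Real.sqrt_pos.2 (by exact_mod_cast (by omega : 0 < Q))
  induction n using Nat.twoStepInduction generalizing x S with
  | zero =>
    have hx : x ∈ S := hS (by simp)
    simp [ker_zero, hx]
  | one =>
    have h0 : ∀ z ∈ T.nbr x, T.ballFinset z 0 ⊆ S := fun z hz y hy => hS <| by
      have h1 : z = y := by simpa [T.isTree.connected.dist_eq_zero_iff] using hy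
      subst h1; simp [(SimpleGraph.dist_eq_one_iff_adj.2 (T.mem_nbr.1 hz)).le]
    have hk : ∀ z ∈ T.nbr x, ∑ y ∈ S, T.ker 0 z y * ground Q (T.graph.dist y o) =
        ground Q (T.graph.dist z o) := fun z hz => by
      have hx : z ∈ S := h0 z hz (by simp)
      simp [ker_zero, hx]
    simp_rw [ker_one, mul_assoc, Finset.sum_mul]
    rw [← Finset.mul_sum, Finset.sum_comm, Finset.sum_congr rfl hk, sum_nbr_ground T hQ]
    push_cast
    field_simp
    ring
  | more n ih0 ih1 =>
    have h0 : ∀ z ∈ T.nbr x, T.ballFinset z (n + 1) ⊆ S := fun z hz y hy => hS <| by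
      have := SimpleGraph.dist_eq_one_iff_adj.2 (T.mem_nbr.1 hz)
      have h3 := T.isTree.connected.dist_triangle (u := x) (v := z) (w := y)
      rw [mem_ballFinset] at hy ⊢
      omega
    have h1 : T.ballFinset x n ⊆ S := fun y hy => hS <| by
      rw [mem_ballFinset] at hy ⊢
      omega
    simp_rw [ker_add_two T hQ, sub_mul, mul_assoc, Finset.sum_mul]
    rw [Finset.sum_sub_distrib, ← Finset.mul_sum, Finset.sum_comm,
      Finset.sum_congr rfl (fun z hz => ih1 z S (h0 z hz)), ih0 x S h1, ← Finset.mul_sum,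
      sum_nbr_ground T hQ]
    push_cast
    field_simp
    ring

end HomTree

namespace OscInt

/-- `∫₀^π e^{-iτ cos l} cos(ml) dl`, a multiple of a Bessel function. -/
def cosInt (τ : ℝ) (m : ℕ) : ℂ :=
  ∫ l in (0 : ℝ)..Real.pi, exp (-I * τ * Real.cos l) * (Real.cos (m * l) : ℂ)

/-- `∫₀^π e^{-iτ cos l} sin l sin(ml) dl`. -/
def sinInt (τ : ℝ) (m : ℕ) : ℂ :=
  ∫ l in (0 : ℝ)..Real.pi, exp (-I * τ * Real.cos l) * (Real.sin l : ℂ) * (Real.sin (m * l) : ℂ)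

lemma norm_phase (τ l : ℝ) : ‖exp (-I * τ * Real.cos l)‖ = 1 := by
  rw [show -I * τ * Real.cos l = ((-τ * Real.cos l : ℝ) : ℂ) * I by push_cast; ring,
    norm_exp_ofReal_mul_I]

lemma hasDerivAt_phase (τ l : ℝ) :
    HasDerivAt (fun l : ℝ => exp (-I * τ * Real.cos l))
      (exp (-I * τ * Real.cos l) * (I * τ * Real.sin l)) l := by
  have h := ((Real.hasDerivAt_cos l).ofReal_comp.const_mul (-I * τ)).cexp
  convert h using 1
  push_cast; ring

lemma norm_sinInt_le (τ : ℝ) (m : ℕ) : ‖sinInt τ m‖ ≤ Real.pi := by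
  have := intervalIntegral.norm_integral_le_of_norm_le_const (a := 0) (b := Real.pi) (C := 1)
    (f := fun l : ℝ => exp (-I * τ * Real.cos l) * (Real.sin l : ℂ) * (Real.sin (m * l) : ℂ))
    (fun l _ => by
      rw [norm_mul, norm_mul, norm_phase, one_mul, norm_real, norm_real]
      exact mul_le_one₀ (Real.abs_sin_le_one _) (abs_nonneg _) (Real.abs_sin_le_one _))
  simpa [sinInt, abs_of_pos Real.pi_pos] using this

lemma sinInt_succ (τ : ℝ) (m : ℕ) :
    sinInt τ (m + 1) = (cosInt τ m - cosInt τ (m + 2)) / 2 := by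
  rw [cosInt, cosInt, sinInt, ← intervalIntegral.integral_sub, ← intervalIntegral.integral_div]
  · congr 1
    funext l
    have h : Real.sin l * Real.sin ((m + 1 : ℕ) * l) =
        (Real.cos (m * l) - Real.cos ((m + 2 : ℕ) * l)) / 2 := by
      have e1 : (m : ℝ) * l = ((m + 1 : ℕ) : ℝ) * l - l := by push_cast; ring
      have e2 : ((m + 2 : ℕ) : ℝ) * l = ((m + 1 : ℕ) : ℝ) * l + l := by push_cast; ring
      rw [e1, e2, Real.cos_sub, Real.cos_add]; ring
    rw [mul_assoc, ← ofReal_mul, h]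
    push_cast; ring
  · apply Continuous.intervalIntegrable; fun_prop
  · apply Continuous.intervalIntegrable; fun_prop

lemma sinInt_zero_right (τ : ℝ) : sinInt τ 0 = 0 := by simp [sinInt]

lemma natCast_mul_cosInt (τ : ℝ) (m : ℕ) : m * cosInt τ m = -I * τ * sinInt τ m := by
  have hd : ∀ l : ℝ, HasDerivAt
      (fun l : ℝ => exp (-I * τ * Real.cos l) * ((Real.sin (m * l) : ℝ) : ℂ))
      (I * τ * (exp (-I * τ * Real.cos l) * (Real.sin l : ℂ) * (Real.sin (m * l) : ℂ)) +
        m * (exp (-I * τ * Real.cos l) * (Real.cos (m * l) : ℂ))) l := fun l => by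
    have h1 : HasDerivAt (fun l : ℝ => Real.sin (m * l)) (Real.cos (m * l) * m) l := by
      simpa using ((hasDerivAt_id l).const_mul (m : ℝ)).sin
    exact ((hasDerivAt_phase τ l).mul h1.ofReal_comp).congr_deriv (by push_cast; ring)
  have h := intervalIntegral.integral_eq_sub_of_hasDerivAt (a := 0) (b := Real.pi)
    (fun l _ => hd l) (by apply Continuous.intervalIntegrable; fun_prop)
  rw [intervalIntegral.integral_add, intervalIntegral.integral_const_mul,
    intervalIntegral.integral_const_mul] at h
  · simp only [Real.sin_nat_mul_pi, mul_zero, Real.sin_zero, ofReal_zero, sub_zero] at h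
    rw [cosInt, sinInt]
    linear_combination h
  · apply Continuous.intervalIntegrable; fun_prop
  · apply Continuous.intervalIntegrable; fun_prop

lemma sinInt_zero_left (m : ℕ) : sinInt 0 (m + 1) = if m = 0 then (Real.pi : ℂ) / 2 else 0 := by
  have h : ∀ k : ℕ, cosInt 0 (k + 1) = 0 := fun k => by
    have := natCast_mul_cosInt 0 (k + 1)
    simpa [Nat.cast_add_one_ne_zero] using this
  rw [sinInt_succ, h (m + 1)]
  rcases m with _ | m
  · simp [cosInt]
  · simp [h]

lemma hasDerivAt_sinInt (τ : ℝ) (m : ℕ) :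
    HasDerivAt (fun τ => sinInt τ (m + 1)) (-I / 2 * (sinInt τ (m + 2) + sinInt τ m)) τ := by
  have h := (intervalIntegral.hasDerivAt_integral_of_dominated_loc_of_deriv_le
    (a := 0) (b := Real.pi) (μ := volume) (x₀ := τ) (s := Set.univ) (bound := fun _ => 1)
    (F := fun τ l => exp (-I * (τ : ℝ) * Real.cos l) * (Real.sin l : ℂ) *
      (Real.sin ((m + 1 : ℕ) * l) : ℂ))
    (F' := fun τ l => (exp (-I * (τ : ℝ) * Real.cos l) * (-I * Real.cos l)) * (Real.sin l : ℂ) *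
      (Real.sin ((m + 1 : ℕ) * l) : ℂ)) Filter.univ_mem
    (Eventually.of_forall fun x => Continuous.aestronglyMeasurable (by fun_prop))
    (Continuous.intervalIntegrable (by fun_prop) _ _)
    (Continuous.aestronglyMeasurable (by fun_prop))
    (Eventually.of_forall fun l _ x _ => ?_) intervalIntegrable_const
    (Eventually.of_forall fun l _ x _ => ?_)).2
  · have e : (-I / 2 * (sinInt τ (m + 2) + sinInt τ m)) =
        ∫ l in (0 : ℝ)..Real.pi, (exp (-I * (τ : ℝ) * Real.cos l) * (-I * Real.cos l)) *
          (Real.sin l : ℂ) * (Real.sin ((m + 1 : ℕ) * l) : ℂ) := by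
      rw [sinInt, sinInt, ← intervalIntegral.integral_add, ← intervalIntegral.integral_const_mul]
      · congr 1
        funext l
        have h : Real.sin ((m + 2 : ℕ) * l) + Real.sin (m * l) =
            2 * (Real.cos l * Real.sin ((m + 1 : ℕ) * l)) := by
          have e1 : (m : ℝ) * l = ((m + 1 : ℕ) : ℝ) * l - l := by push_cast; ring
          have e2 : ((m + 2 : ℕ) : ℝ) * l = ((m + 1 : ℕ) : ℝ) * l + l := by push_cast; ring
          rw [e1, e2, Real.sin_sub, Real.sin_add]; ring
        rw [← mul_add, ← ofReal_add, h]
        push_cast; ring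
      · apply Continuous.intervalIntegrable; fun_prop
      · apply Continuous.intervalIntegrable; fun_prop
    rw [e]
    exact h
  · rw [norm_mul, norm_mul, norm_mul, norm_phase, one_mul, norm_mul, norm_neg, norm_I, one_mul,
      norm_real, norm_real, norm_real]
    exact mul_le_one₀ (mul_le_one₀ (Real.abs_cos_le_one _) (abs_nonneg _)
      (Real.abs_sin_le_one _)) (abs_nonneg _) (Real.abs_sin_le_one _)
  · have h1 : HasDerivAt (fun x : ℝ => -I * (x : ℂ) * Real.cos l) (-I * Real.cos l) x := by
      simpa using ((ofRealCLM.hasDerivAt (x := x)).const_mul (-I)).mul_const (Real.cos l : ℂ)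
    exact (h1.cexp.mul_const _).mul_const _

lemma norm_cosInt_mul_le (τ : ℝ) (m : ℕ) : m * ‖cosInt τ m‖ = |τ| * ‖sinInt τ m‖ := by
  have := congrArg norm (natCast_mul_cosInt τ m)
  simpa using this

lemma exists_norm_sinInt_mul_pow_le (i : ℕ) :
    ∃ C : ℝ, 0 ≤ C ∧ ∀ (τ : ℝ) (m : ℕ), ‖sinInt τ m‖ * (m + 1) ^ i ≤ C * (1 + |τ|) ^ i := by
  induction i with
  | zero => exact ⟨Real.pi, Real.pi_pos.le, fun τ m => by simpa using norm_sinInt_le τ m⟩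
  | succ i ih =>
    obtain ⟨C, hC, h⟩ := ih
    refine ⟨3 * 2 ^ i * C + Real.pi * 2 ^ (i + 1), by positivity, fun τ m => ?_⟩
    have hτ : (1 : ℝ) ≤ (1 + |τ|) ^ (i + 1) := one_le_pow₀ (by linarith [abs_nonneg τ])
    rcases Nat.lt_or_ge m 2 with hm | hm
    · have h1 : ((m : ℝ) + 1) ^ (i + 1) ≤ 2 ^ (i + 1) := by
        gcongr
        have : (m : ℝ) ≤ 1 := by exact_mod_cast (by omega : m ≤ 1)
        linarith
      calc ‖sinInt τ m‖ * (m + 1) ^ (i + 1) ≤ Real.pi * 2 ^ (i + 1) * 1 := by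
            rw [mul_one]; gcongr; exact norm_sinInt_le τ m
        _ ≤ _ := by
            gcongr
            have : 0 ≤ 3 * 2 ^ i * C := by positivity
            linarith
    · obtain ⟨k, rfl⟩ : ∃ k, m = k + 2 := ⟨m - 2, by omega⟩
      have e : ‖sinInt τ (k + 1 + 1)‖ ≤ (‖cosInt τ (k + 1)‖ + ‖cosInt τ (k + 3)‖) / 2 := by
        rw [sinInt_succ, norm_div]
        simp only [norm_ofNat]
        gcongr
        exact norm_sub_le _ _
      have a1 := norm_cosInt_mul_le τ (k + 1)
      have a2 := norm_cosInt_mul_le τ (k + 3)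
      have b1 := h τ (k + 1)
      have b2 := h τ (k + 3)
      push_cast at a1 a2 b1 b2 ⊢
      have hk : (0 : ℝ) ≤ k := k.cast_nonneg
      have p1 : ((k : ℝ) + 2 + 1) ^ i ≤ 2 ^ i * ((k : ℝ) + 1 + 1) ^ i := by
        rw [← mul_pow]; gcongr; linarith
      have p2 : ((k : ℝ) + 2 + 1) ^ i ≤ 2 ^ i * ((k : ℝ) + 3 + 1) ^ i := by
        rw [← mul_pow]; gcongr; linarith
      have c1 : ‖cosInt τ (k + 1)‖ * (k + 2 + 1) ^ (i + 1) ≤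
          3 * 2 ^ i * C * (|τ| * (1 + |τ|) ^ i) := by
        calc ‖cosInt τ (k + 1)‖ * ((k : ℝ) + 2 + 1) ^ (i + 1)
            = ((k : ℝ) + 2 + 1) * ‖cosInt τ (k + 1)‖ * (k + 2 + 1) ^ i := by ring
          _ ≤ 3 * (((k : ℝ) + 1) * ‖cosInt τ (k + 1)‖) * (2 ^ i * ((k : ℝ) + 1 + 1) ^ i) := by
              gcongr ?_ * ?_
              nlinarith [norm_nonneg (cosInt τ (k + 1))]
          _ = 3 * 2 ^ i * |τ| * (‖sinInt τ (k + 1)‖ * ((k : ℝ) + 1 + 1) ^ i) := by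
              rw [a1]; ring
          _ ≤ 3 * 2 ^ i * |τ| * (C * (1 + |τ|) ^ i) := by gcongr
          _ = _ := by ring
      have c2 : ‖cosInt τ (k + 3)‖ * (k + 2 + 1) ^ (i + 1) ≤
          3 * 2 ^ i * C * (|τ| * (1 + |τ|) ^ i) := by
        calc ‖cosInt τ (k + 3)‖ * ((k : ℝ) + 2 + 1) ^ (i + 1)
            = ((k : ℝ) + 2 + 1) * ‖cosInt τ (k + 3)‖ * (k + 2 + 1) ^ i := by ring
          _ ≤ 3 * (((k : ℝ) + 3) * ‖cosInt τ (k + 3)‖) * (2 ^ i * ((k : ℝ) + 3 + 1) ^ i) := by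
              gcongr ?_ * ?_
              nlinarith [norm_nonneg (cosInt τ (k + 3))]
          _ = 3 * 2 ^ i * |τ| * (‖sinInt τ (k + 3)‖ * ((k : ℝ) + 3 + 1) ^ i) := by
              rw [a2]; ring
          _ ≤ 3 * 2 ^ i * |τ| * (C * (1 + |τ|) ^ i) := by gcongr
          _ = _ := by ring
      calc ‖sinInt τ (k + 2)‖ * ((k : ℝ) + 2 + 1) ^ (i + 1)
          ≤ (‖cosInt τ (k + 1)‖ + ‖cosInt τ (k + 3)‖) / 2 * ((k : ℝ) + 2 + 1) ^ (i + 1) := by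
            gcongr
        _ ≤ 3 * 2 ^ i * C * (|τ| * (1 + |τ|) ^ i) := by linarith
        _ ≤ (3 * 2 ^ i * C + Real.pi * 2 ^ (i + 1)) * ((1 + |τ|) * (1 + |τ|) ^ i) := by
            have := Real.pi_pos
            gcongr
            · linarith [show 0 ≤ Real.pi * 2 ^ (i + 1) by positivity]
            · linarith
        _ = _ := by ring

lemma integral_inv_sq_add_sq_le {c : ℝ} (hc : 0 < c) :
    ∫ l in (0 : ℝ)..Real.pi, (c ^ 2 + (2 / Real.pi * l) ^ 2)⁻¹ ≤ Real.pi ^ 2 / (4 * c) := by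
  have hpi := Real.pi_pos
  have hd : ∀ l : ℝ, HasDerivAt (fun l => Real.pi / (2 * c) * Real.arctan (2 / (Real.pi * c) * l))
      (c ^ 2 + (2 / Real.pi * l) ^ 2)⁻¹ l := fun l => by
    have h := (((hasDerivAt_id l).const_mul (2 / (Real.pi * c))).arctan).const_mul
      (Real.pi / (2 * c))
    refine h.congr_deriv ?_
    have : 0 < c ^ 2 + (2 / Real.pi * l) ^ 2 := by positivity
    have : 0 < 1 + (2 / (Real.pi * c) * l) ^ 2 := by positivity
    simp only [id_eq]
    field_simp
  rw [intervalIntegral.integral_eq_sub_of_hasDerivAt (fun l _ => hd l)]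
  · rw [mul_zero, Real.arctan_zero, mul_zero, sub_zero]
    have := (Real.arctan_lt_pi_div_two (2 / (Real.pi * c) * Real.pi)).le
    calc _ ≤ Real.pi / (2 * c) * (Real.pi / 2) := by gcongr
      _ = _ := by field_simp; norm_num
  · apply Continuous.intervalIntegrable
    refine Continuous.inv₀ (by fun_prop) fun l => ?_
    positivity

lemma inv_sq_add_sin_sq_le {c : ℝ} (hc : 0 < c) {l : ℝ} (h0 : 0 ≤ l) (h1 : l ≤ Real.pi) :
    (c ^ 2 + Real.sin l ^ 2)⁻¹ ≤
      (c ^ 2 + (2 / Real.pi * l) ^ 2)⁻¹ + (c ^ 2 + (2 / Real.pi * (Real.pi - l)) ^ 2)⁻¹ := by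
  have hpi := Real.pi_pos
  rcases le_total l (Real.pi / 2) with h | h
  · have := Real.mul_le_sin h0 h
    have h2 : (c ^ 2 + Real.sin l ^ 2)⁻¹ ≤ (c ^ 2 + (2 / Real.pi * l) ^ 2)⁻¹ := by gcongr
    have : 0 ≤ (c ^ 2 + (2 / Real.pi * (Real.pi - l)) ^ 2)⁻¹ := by positivity
    linarith
  · have := Real.mul_le_sin (x := Real.pi - l) (by linarith) (by linarith)
    rw [Real.sin_pi_sub] at this
    have h2 : (c ^ 2 + Real.sin l ^ 2)⁻¹ ≤ (c ^ 2 + (2 / Real.pi * (Real.pi - l)) ^ 2)⁻¹ := by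
      have : 0 ≤ Real.pi - l := by linarith
      gcongr
    have : 0 ≤ (c ^ 2 + (2 / Real.pi * l) ^ 2)⁻¹ := by positivity
    linarith

lemma continuous_inv_sq_add_sin_sq {c : ℝ} (hc : 0 < c) :
    Continuous fun l : ℝ => (c ^ 2 + Real.sin l ^ 2)⁻¹ :=
  Continuous.inv₀ (by fun_prop) fun l => by positivity

lemma integral_inv_sq_add_sin_sq_le {c : ℝ} (hc : 0 < c) :
    ∫ l in (0 : ℝ)..Real.pi, (c ^ 2 + Real.sin l ^ 2)⁻¹ ≤ Real.pi ^ 2 / (2 * c) := by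
  have hcont : Continuous fun l : ℝ => (c ^ 2 + (2 / Real.pi * l) ^ 2)⁻¹ :=
    Continuous.inv₀ (by fun_prop) fun l => by positivity
  have hcont2 : Continuous fun l : ℝ => (c ^ 2 + (2 / Real.pi * (Real.pi - l)) ^ 2)⁻¹ :=
    Continuous.inv₀ (by fun_prop) fun l => by positivity
  calc _ ≤ ∫ l in (0 : ℝ)..Real.pi, ((c ^ 2 + (2 / Real.pi * l) ^ 2)⁻¹ +
          (c ^ 2 + (2 / Real.pi * (Real.pi - l)) ^ 2)⁻¹) := by
        refine intervalIntegral.integral_mono_on Real.pi_pos.le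
          ((continuous_inv_sq_add_sin_sq hc).intervalIntegrable _ _)
          ((hcont.add hcont2).intervalIntegrable _ _) fun l hl => inv_sq_add_sin_sq_le hc hl.1 hl.2
    _ = 2 * ∫ l in (0 : ℝ)..Real.pi, (c ^ 2 + (2 / Real.pi * l) ^ 2)⁻¹ := by
        rw [intervalIntegral.integral_add (hcont.intervalIntegrable _ _)
          (hcont2.intervalIntegrable _ _),
          intervalIntegral.integral_comp_sub_left
            (fun l => (c ^ 2 + (2 / Real.pi * l) ^ 2)⁻¹) Real.pi]
        simp only [sub_self, sub_zero]
        ring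
    _ ≤ 2 * (Real.pi ^ 2 / (4 * c)) := by gcongr; exact integral_inv_sq_add_sq_le hc
    _ = _ := by ring

lemma hasDerivAt_regularised {c : ℝ} (hc : 0 < c) (m : ℕ) (l : ℝ) :
    HasDerivAt (fun l => Real.cos (m * l) * (Real.sin l * (c ^ 2 + Real.sin l ^ 2)⁻¹))
      (-(m * Real.sin (m * l)) * (Real.sin l * (c ^ 2 + Real.sin l ^ 2)⁻¹) +
        Real.cos (m * l) * (Real.cos l * (c ^ 2 - Real.sin l ^ 2) *
          ((c ^ 2 + Real.sin l ^ 2)⁻¹ * (c ^ 2 + Real.sin l ^ 2)⁻¹))) l := by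
  have hpos : 0 < c ^ 2 + Real.sin l ^ 2 := by positivity
  have h1 : HasDerivAt (fun l : ℝ => Real.cos (m * l)) (-(m * Real.sin (m * l))) l := by
    have := ((hasDerivAt_id l).const_mul (m : ℝ)).cos
    exact this.congr_deriv (by simp only [id_eq]; ring)
  have h2 := ((Real.hasDerivAt_sin l).pow 2).const_add (c ^ 2)
  have h3 := (Real.hasDerivAt_sin l).mul (h2.inv hpos.ne')
  refine (h1.mul h3).congr_deriv ?_
  simp only [Pi.mul_apply, Pi.pow_apply, Pi.inv_apply]
  field_simp
  ring

lemma norm_cosInt_decay {τ : ℝ} (hτ : τ ≠ 0) (m : ℕ) :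
    |τ| * ‖cosInt τ m‖ ≤ 10 * (m + 1) * Real.sqrt |τ| := by
  have hpi := Real.pi_pos
  have hτ' : 0 < |τ| := abs_pos.2 hτ
  have hs : 0 < Real.sqrt |τ| := Real.sqrt_pos.2 hτ'
  set c := (Real.sqrt |τ|)⁻¹ with hcdef
  have hc : 0 < c := inv_pos.2 hs
  have hc2 : |τ| * c ^ 2 = 1 := by
    rw [hcdef, inv_pow, Real.sq_sqrt hτ'.le, mul_inv_cancel₀ hτ'.ne']
  set w : ℝ → ℝ := fun l => (c ^ 2 + Real.sin l ^ 2)⁻¹ with hw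
  have hwc : Continuous w := continuous_inv_sq_add_sin_sq hc
  set H : ℝ → ℝ := fun l => Real.cos (m * l) * (Real.sin l * w l)
  set H' : ℝ → ℝ := fun l => -(m * Real.sin (m * l)) * (Real.sin l * w l) +
        Real.cos (m * l) * (Real.cos l * (c ^ 2 - Real.sin l ^ 2) * (w l * w l))
  have hH : ∀ l, HasDerivAt H (H' l) l := fun l => hasDerivAt_regularised hc m l
  have hH'c : Continuous H' := by fun_prop
  have hHc : Continuous H := by fun_prop
  set e : ℝ → ℂ := fun l => exp (-I * τ * Real.cos l)
  have hec : Continuous e := by fun_prop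
  have hG : ∀ l, HasDerivAt (fun l => e l * (H l : ℂ))
      (e l * (I * τ * Real.sin l) * H l + e l * H' l) l := fun l =>
    (hasDerivAt_phase τ l).mul (hH l).ofReal_comp
  have hFTC := intervalIntegral.integral_eq_sub_of_hasDerivAt (a := 0) (b := Real.pi)
    (fun l _ => hG l) (by apply Continuous.intervalIntegrable; fun_prop)
  have hFTC0 : ∫ l in (0 : ℝ)..Real.pi, (e l * (I * τ * Real.sin l) * H l + e l * H' l) = 0 := by
    rw [hFTC]; simp [H]
  have hJ : I * τ * cosInt τ m = ∫ l in (0 : ℝ)..Real.pi,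
      (I * τ * (e l * (Real.cos (m * l) * (c ^ 2 * w l) : ℝ)) - e l * H' l) := by
    rw [← sub_zero (I * τ * cosInt τ m), ← hFTC0, cosInt, ← intervalIntegral.integral_const_mul,
      ← intervalIntegral.integral_sub]
    · congr 1
      funext l
      have hpos : 0 < c ^ 2 + Real.sin l ^ 2 := by positivity
      have h1 : Real.cos (m * l) * (c ^ 2 * w l) = Real.cos (m * l) - Real.sin l * H l := by
        simp only [hw, H]; field_simp; ring
      rw [h1]
      simp only [e]
      push_cast; ring
    · apply Continuous.intervalIntegrable; fun_prop
    · apply Continuous.intervalIntegrable; fun_prop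
  have hb : ∀ l, ‖I * τ * (e l * (Real.cos (m * l) * (c ^ 2 * w l) : ℝ)) - e l * H' l‖ ≤
      2 * w l + m / (2 * c) := fun l => by
    have hpos : 0 < c ^ 2 + Real.sin l ^ 2 := by positivity
    have hwpos : 0 < w l := inv_pos.2 hpos
    have hwm : (c ^ 2 + Real.sin l ^ 2) * w l = 1 := mul_inv_cancel₀ hpos.ne'
    have n1 : ‖I * τ * (e l * (Real.cos (m * l) * (c ^ 2 * w l) : ℝ))‖ ≤ w l := by
      rw [norm_mul, norm_mul, norm_mul, norm_I, one_mul, norm_phase, one_mul, norm_real,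
        norm_real, Real.norm_eq_abs, Real.norm_eq_abs, abs_mul, abs_of_pos (by positivity :
        0 < c ^ 2 * w l)]
      calc |τ| * (|Real.cos (m * l)| * (c ^ 2 * w l)) ≤ |τ| * (1 * (c ^ 2 * w l)) := by
            gcongr; exact Real.abs_cos_le_one _
        _ = |τ| * c ^ 2 * w l := by ring
        _ = w l := by rw [hc2, one_mul]
    have n2 : ‖e l * H' l‖ ≤ m / (2 * c) + w l := by
      rw [norm_mul, norm_phase, one_mul, norm_real, Real.norm_eq_abs]
      refine (abs_add_le _ _).trans (add_le_add ?_ ?_)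
      · rw [abs_mul, abs_neg, abs_mul, Nat.abs_cast, abs_mul, abs_of_pos hwpos]
        have : |Real.sin l| * w l ≤ 1 / (2 * c) := by
          rw [le_div_iff₀ (by positivity), ← hwm]
          have : 2 * c * |Real.sin l| ≤ c ^ 2 + Real.sin l ^ 2 := by
            rw [← sq_abs (Real.sin l)]; nlinarith [sq_nonneg (c - |Real.sin l|)]
          nlinarith
        calc (m : ℝ) * |Real.sin (m * l)| * (|Real.sin l| * w l) ≤ m * 1 * (1 / (2 * c)) := by
              gcongr; exact Real.abs_sin_le_one _
          _ = _ := by ring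
      · rw [abs_mul, abs_mul, abs_mul, abs_of_pos (mul_pos hwpos hwpos)]
        have : |c ^ 2 - Real.sin l ^ 2| ≤ c ^ 2 + Real.sin l ^ 2 := by
          rw [abs_le]; constructor <;> nlinarith [sq_nonneg c, sq_nonneg (Real.sin l)]
        calc |Real.cos (m * l)| * (|Real.cos l| * |c ^ 2 - Real.sin l ^ 2| * (w l * w l))
            ≤ 1 * (1 * (c ^ 2 + Real.sin l ^ 2) * (w l * w l)) := by
              gcongr
              · exact Real.abs_cos_le_one _
              · exact Real.abs_cos_le_one _
          _ = (c ^ 2 + Real.sin l ^ 2) * w l * w l := by ring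
          _ = w l := by rw [hwm, one_mul]
    calc _ ≤ w l + (m / (2 * c) + w l) := (norm_sub_le _ _).trans (add_le_add n1 n2)
      _ = _ := by ring
  have hfin := intervalIntegral.norm_integral_le_of_norm_le (μ := volume) Real.pi_pos.le
    (Eventually.of_forall fun l _ => hb l)
    (by apply Continuous.intervalIntegrable; fun_prop)
  rw [← hJ, intervalIntegral.integral_add, intervalIntegral.integral_const_mul] at hfin
  · have h1 := integral_inv_sq_add_sin_sq_le hc
    have h2 : ‖I * τ * cosInt τ m‖ = |τ| * ‖cosInt τ m‖ := by simp
    rw [h2, intervalIntegral.integral_const, smul_eq_mul, sub_zero] at hfin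
    have hci : 1 / c = Real.sqrt |τ| := by rw [hcdef, one_div, inv_inv]
    have hpi4 := Real.pi_lt_d2
    calc |τ| * ‖cosInt τ m‖ ≤ 2 * (Real.pi ^ 2 / (2 * c)) + Real.pi * (m / (2 * c)) := by
          linarith
      _ = (Real.pi ^ 2 + Real.pi / 2 * m) * (1 / c) := by field_simp
      _ = (Real.pi ^ 2 + Real.pi / 2 * m) * Real.sqrt |τ| := by rw [hci]
      _ ≤ (10 * (m + 1)) * Real.sqrt |τ| := by
          have hm : (0 : ℝ) ≤ m := m.cast_nonneg
          gcongr
          nlinarith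
  · apply Continuous.intervalIntegrable; fun_prop
  · apply Continuous.intervalIntegrable; fun_prop

/-- The dispersive decay of the coefficients. -/
lemma norm_sinInt_decay (τ : ℝ) (m : ℕ) :
    ‖sinInt τ m‖ ≤ 40 * (m + 1) ^ 2 * (1 + |τ|) ^ (-(3 / 2) : ℝ) := by
  have hm : (0 : ℝ) ≤ m := m.cast_nonneg
  rcases lt_or_ge |τ| 1 with h | h
  · have h1 : (1 / 4 : ℝ) ≤ (1 + |τ|) ^ (-(3 / 2) : ℝ) := by
      calc (1 / 4 : ℝ) = (2 : ℝ) ^ (-2 : ℝ) := by norm_num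
        _ ≤ (2 : ℝ) ^ (-(3 / 2) : ℝ) := by
            apply Real.rpow_le_rpow_of_exponent_le <;> norm_num
        _ ≤ _ := by
            apply Real.rpow_le_rpow_of_nonpos <;> first | positivity | linarith
    calc ‖sinInt τ m‖ ≤ Real.pi := norm_sinInt_le τ m
      _ ≤ 40 * 1 * (1 / 4) := by linarith [Real.pi_lt_d2]
      _ ≤ _ := by gcongr; nlinarith
  · have hτ : τ ≠ 0 := by rintro rfl; simp at h; linarith
    have hτ' : 0 < |τ| := by linarith
    have h1 := norm_cosInt_decay hτ m
    have h2 := norm_cosInt_mul_le τ m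
    have hs : 0 < Real.sqrt |τ| := Real.sqrt_pos.2 hτ'
    have h3 : |τ| * |τ| * ‖sinInt τ m‖ ≤ 10 * (m + 1) ^ 2 * Real.sqrt |τ| := by
      calc |τ| * |τ| * ‖sinInt τ m‖ = m * (|τ| * ‖cosInt τ m‖) := by
            rw [mul_assoc, ← h2]; ring
        _ ≤ m * (10 * (m + 1) * Real.sqrt |τ|) := by gcongr
        _ ≤ (m + 1) * (10 * (m + 1) * Real.sqrt |τ|) := by gcongr; linarith
        _ = _ := by ring
    have h4 : |τ| ^ (3 / 2 : ℝ) * Real.sqrt |τ| = |τ| * |τ| := by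
      rw [Real.sqrt_eq_rpow, ← Real.rpow_add hτ']
      norm_num; ring
    have h5 : |τ| ^ (3 / 2 : ℝ) * ‖sinInt τ m‖ ≤ 10 * (m + 1) ^ 2 := by
      have : Real.sqrt |τ| * (|τ| ^ (3 / 2 : ℝ) * ‖sinInt τ m‖) ≤
          Real.sqrt |τ| * (10 * (m + 1) ^ 2) := by
        calc _ = |τ| * |τ| * ‖sinInt τ m‖ := by rw [← h4]; ring
          _ ≤ _ := by linarith
      exact le_of_mul_le_mul_left this hs
    have h6 : (1 + |τ|) ^ (3 / 2 : ℝ) ≤ 4 * |τ| ^ (3 / 2 : ℝ) := by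
      calc (1 + |τ|) ^ (3 / 2 : ℝ) ≤ (2 * |τ|) ^ (3 / 2 : ℝ) := by gcongr; linarith
        _ = 2 ^ (3 / 2 : ℝ) * |τ| ^ (3 / 2 : ℝ) := Real.mul_rpow (by norm_num) hτ'.le
        _ ≤ 2 ^ (2 : ℝ) * |τ| ^ (3 / 2 : ℝ) := by
            gcongr <;> norm_num
        _ = _ := by norm_num
    rw [Real.rpow_neg (by positivity), ← div_eq_mul_inv, le_div_iff₀ (by positivity)]
    calc ‖sinInt τ m‖ * (1 + |τ|) ^ (3 / 2 : ℝ) ≤ ‖sinInt τ m‖ * (4 * |τ| ^ (3 / 2 : ℝ)) := by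
          gcongr
      _ = 4 * (|τ| ^ (3 / 2 : ℝ) * ‖sinInt τ m‖) := by ring
      _ ≤ 4 * (10 * (m + 1) ^ 2) := by gcongr
      _ = _ := by ring

end OscInt

namespace ENNReal

/-- Hölder's inequality for sums of extended nonnegative reals. -/
lemma tsum_mul_le_Lp_mul_Lq {ι : Type*} {p q : ℝ} (hpq : p.HolderConjugate q) (f g : ι → ℝ≥0∞) :
    ∑' i, f i * g i ≤ (∑' i, f i ^ p) ^ (1 / p) * (∑' i, g i ^ q) ^ (1 / q) := by
  let _ : MeasurableSpace ι := ⊤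
  have h := ENNReal.lintegral_mul_le_Lp_mul_Lq (Measure.count : Measure ι) hpq
    (f := f) (g := g) measurable_from_top.aemeasurable measurable_from_top.aemeasurable
  simpa [lintegral_count] using h

/-- Schur's test. -/
lemma schur_test {α β : Type*} (K : α → β → ℝ≥0∞) (u : α → ℝ≥0∞) (v : β → ℝ≥0∞) (A : ℝ≥0∞)
    (hu0 : ∀ x, u x ≠ 0) (hu : ∀ x, u x ≠ ∞) (hv0 : ∀ y, v y ≠ 0) (hv : ∀ y, v y ≠ ∞)
    (h1 : ∀ x, ∑' y, K x y * v y ≤ A * u x) (h2 : ∀ y, ∑' x, K x y * u x ≤ A * v y)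
    (F : α → ℝ≥0∞) (G : β → ℝ≥0∞) :
    ∑' x, ∑' y, K x y * F x * G y ≤
      A * ((∑' x, F x ^ (2 : ℝ)) ^ (1 / 2 : ℝ) * (∑' y, G y ^ (2 : ℝ)) ^ (1 / 2 : ℝ)) := by
  have hsq : ∀ z : ℝ≥0∞, (z ^ (1 / 2 : ℝ)) ^ (2 : ℝ) = z := fun z => by
    rw [← ENNReal.rpow_mul]; norm_num
  have hsq' : ∀ z : ℝ≥0∞, (z ^ (2 : ℝ)) ^ (1 / 2 : ℝ) = z := fun z => by
    rw [← ENNReal.rpow_mul]; norm_num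
  have hhalf : ∀ z : ℝ≥0∞, z ^ (1 / 2 : ℝ) * z ^ (1 / 2 : ℝ) = z := fun z => by
    rw [← ENNReal.rpow_add_of_nonneg _ _ (by norm_num) (by norm_num)]; norm_num
  have key : ∀ x y, K x y * F x * G y =
      (K x y * F x ^ (2 : ℝ) * (v y * (u x)⁻¹)) ^ (1 / 2 : ℝ) *
        (K x y * G y ^ (2 : ℝ) * (u x * (v y)⁻¹)) ^ (1 / 2 : ℝ) := fun x y => by
    have hw : v y * (u x)⁻¹ * (u x * (v y)⁻¹) = 1 := by
      calc _ = (v y * (v y)⁻¹) * (u x * (u x)⁻¹) := by ring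
        _ = 1 := by rw [ENNReal.mul_inv_cancel (hv0 y) (hv y), ENNReal.mul_inv_cancel (hu0 x) (hu x),
                      one_mul]
    rw [← ENNReal.mul_rpow_of_nonneg _ _ (by norm_num)]
    calc K x y * F x * G y
        = ((K x y) ^ (2 : ℝ)) ^ (1 / 2 : ℝ) * (F x ^ (2 : ℝ)) ^ (1 / 2 : ℝ) *
          (G y ^ (2 : ℝ)) ^ (1 / 2 : ℝ) := by simp only [hsq']
      _ = (K x y * K x y * F x ^ (2 : ℝ) * G y ^ (2 : ℝ)) ^ (1 / 2 : ℝ) := by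
          rw [← ENNReal.mul_rpow_of_nonneg _ _ (by norm_num),
            ← ENNReal.mul_rpow_of_nonneg _ _ (by norm_num), ENNReal.rpow_two (K x y), sq]
      _ = (K x y * K x y * F x ^ (2 : ℝ) * G y ^ (2 : ℝ) *
            (v y * (u x)⁻¹ * (u x * (v y)⁻¹))) ^ (1 / 2 : ℝ) := by rw [hw, mul_one]
      _ = _ := by congr 1; ring
  have hF : ∑' x, ∑' y, K x y * F x ^ (2 : ℝ) * (v y * (u x)⁻¹) ≤ A * ∑' x, F x ^ (2 : ℝ) := by
    rw [← ENNReal.tsum_mul_left]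
    refine ENNReal.tsum_le_tsum fun x => ?_
    calc ∑' y, K x y * F x ^ (2 : ℝ) * (v y * (u x)⁻¹)
        = (F x ^ (2 : ℝ) * (u x)⁻¹) * ∑' y, K x y * v y := by
          rw [← ENNReal.tsum_mul_left]; congr 1; funext y; ring
      _ ≤ (F x ^ (2 : ℝ) * (u x)⁻¹) * (A * u x) := by gcongr; exact h1 x
      _ = A * F x ^ (2 : ℝ) * (u x * (u x)⁻¹) := by ring
      _ = _ := by rw [ENNReal.mul_inv_cancel (hu0 x) (hu x), mul_one]
  have hG : ∑' x, ∑' y, K x y * G y ^ (2 : ℝ) * (u x * (v y)⁻¹) ≤ A * ∑' y, G y ^ (2 : ℝ) := by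
    rw [ENNReal.tsum_comm, ← ENNReal.tsum_mul_left]
    refine ENNReal.tsum_le_tsum fun y => ?_
    calc ∑' x, K x y * G y ^ (2 : ℝ) * (u x * (v y)⁻¹)
        = (G y ^ (2 : ℝ) * (v y)⁻¹) * ∑' x, K x y * u x := by
          rw [← ENNReal.tsum_mul_left]; congr 1; funext x; ring
      _ ≤ (G y ^ (2 : ℝ) * (v y)⁻¹) * (A * v y) := by gcongr; exact h2 y
      _ = A * G y ^ (2 : ℝ) * (v y * (v y)⁻¹) := by ring
      _ = _ := by rw [ENNReal.mul_inv_cancel (hv0 y) (hv y), mul_one]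
  simp_rw [key]
  rw [← ENNReal.tsum_prod]
  refine (tsum_mul_le_Lp_mul_Lq Real.HolderConjugate.two_two _ _).trans ?_
  simp only [hsq]
  rw [ENNReal.tsum_prod (f := fun x y => K x y * F x ^ (2 : ℝ) * (v y * (u x)⁻¹)),
    ENNReal.tsum_prod (f := fun x y => K x y * G y ^ (2 : ℝ) * (u x * (v y)⁻¹))]
  calc _ ≤ (A * ∑' x, F x ^ (2 : ℝ)) ^ (1 / 2 : ℝ) * (A * ∑' y, G y ^ (2 : ℝ)) ^ (1 / 2 : ℝ) := by
        gcongr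
    _ = _ := by
        rw [ENNReal.mul_rpow_of_nonneg _ _ (by norm_num),
          ENNReal.mul_rpow_of_nonneg _ _ (by norm_num)]
        nth_rewrite 3 [← hhalf A]
        ring

end ENNReal

namespace HomTree

variable {Q : ℕ} (T : HomTree Q)

lemma tsum_ker_ground (hQ : 2 ≤ Q) (o : T.V) (n : ℕ) (x : T.V) :
    ∑' y, ENNReal.ofReal (T.ker n x y) * ENNReal.ofReal (ground Q (T.graph.dist y o)) =
      (n + 1) * ENNReal.ofReal (ground Q (T.graph.dist x o)) := by
  rw [tsum_eq_sum (s := T.ballFinset x n) fun y hy => by simp [T.ker_eq_zero hy]]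
  simp_rw [← ENNReal.ofReal_mul (T.ker_nonneg n x _)]
  rw [← ENNReal.ofReal_sum_of_nonneg fun y _ =>
    mul_nonneg (T.ker_nonneg n x y) (ground_pos hQ _).le,
    T.sum_ker_ground hQ o n x _ subset_rfl, ENNReal.ofReal_mul (by positivity)]
  congr 1
  rw [ENNReal.ofReal_add (by positivity) zero_le_one]
  simp

/-- The kernel of `U_n` is bounded on `ℓ²` with norm at most `n + 1`. -/
lemma tsum_ker_mul_le (hQ : 2 ≤ Q) (n : ℕ) (F G : T.V → ℝ≥0∞) :
    ∑' x, ∑' y, ENNReal.ofReal (T.ker n x y) * F x * G y ≤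
      (n + 1) * ((∑' x, F x ^ (2 : ℝ)) ^ (1 / 2 : ℝ) * (∑' y, G y ^ (2 : ℝ)) ^ (1 / 2 : ℝ)) := by
  rcases isEmpty_or_nonempty T.V with h | ⟨⟨o⟩⟩
  · simp
  have hpos : ∀ x, ENNReal.ofReal (ground Q (T.graph.dist x o)) ≠ 0 := fun x => by
    simpa using ground_pos hQ _
  refine ENNReal.schur_test _ (fun x => ENNReal.ofReal (ground Q (T.graph.dist x o)))
    (fun x => ENNReal.ofReal (ground Q (T.graph.dist x o))) _ hpos
    (fun _ => ENNReal.ofReal_ne_top) hpos (fun _ => ENNReal.ofReal_ne_top)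
    (fun x => (T.tsum_ker_ground hQ o n x).le) (fun y => ?_) F G
  simp_rw [T.ker_comm n _ y]
  exact (T.tsum_ker_ground hQ o n y).le

/-- Interpolated off-diagonal estimate for the kernel of `U_n`. -/
lemma tsum_ker_mul_le_of_two_lt (hQ : 2 ≤ Q) {r : ℝ} (hr : 2 < r) (n : ℕ) (F G : T.V → ℝ≥0∞) :
    ∑' x, ∑' y, ENNReal.ofReal (T.ker n x y) * F x * G y ≤
      ((n : ℝ≥0∞) + 1) ^ (2 / r) * ENNReal.ofReal ((Real.sqrt Q)⁻¹ ^ n) ^ (1 - 2 / r) *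
      ((∑' x, F x ^ (r / (r - 1))) ^ (1 / (r / (r - 1))) *
        (∑' y, G y ^ (r / (r - 1))) ^ (1 / (r / (r - 1)))) := by
  set r' := r / (r - 1) with hr'
  have hr'0 : 0 < r' := by rw [hr']; apply div_pos <;> linarith
  set a := 2 / r with ha
  have ha0 : 0 < a := by rw [ha]; positivity
  have ha1 : 0 < 1 - a := by rw [ha, sub_pos, div_lt_one] <;> linarith
  have hexp : r' / 2 * a + r' * (1 - a) = 1 := by
    have : r - 1 ≠ 0 := by linarith
    rw [hr', ha]; field_simp; ring
  have hpq : (1 / a).HolderConjugate (1 / (1 - a)) := by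
    rw [Real.holderConjugate_iff]
    refine ⟨?_, by simp⟩
    rw [lt_div_iff₀ ha0]; linarith
  set k : T.V → T.V → ℝ≥0∞ := fun x y => ENNReal.ofReal (T.ker n x y)
  have hpow : ∀ z : ℝ≥0∞, z = (z ^ (r' / 2)) ^ a * (z ^ r') ^ (1 - a) := fun z => by
    rw [← ENNReal.rpow_mul, ← ENNReal.rpow_mul, ← ENNReal.rpow_add_of_nonneg _ _ (by positivity)
      (by positivity), hexp, ENNReal.rpow_one]
  have hpow1 : ∀ z : ℝ≥0∞, z = z ^ a * z ^ (1 - a) := fun z => by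
    rw [← ENNReal.rpow_add_of_nonneg _ _ ha0.le ha1.le, add_sub_cancel, ENNReal.rpow_one]
  have key : ∀ x y, k x y * F x * G y =
      (k x y * F x ^ (r' / 2) * G y ^ (r' / 2)) ^ a *
        (k x y * F x ^ r' * G y ^ r') ^ (1 - a) := fun x y => by
    simp only [ENNReal.mul_rpow_of_nonneg _ _ ha0.le, ENNReal.mul_rpow_of_nonneg _ _ ha1.le]
    nth_rewrite 1 [hpow1 (k x y), hpow (F x), hpow (G y)]
    ring
  have e1 : ∑' x, ∑' y, k x y * F x ^ (r' / 2) * G y ^ (r' / 2) ≤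
      (n + 1) * ((∑' x, F x ^ r') ^ (1 / 2 : ℝ) * (∑' y, G y ^ r') ^ (1 / 2 : ℝ)) := by
    refine (T.tsum_ker_mul_le hQ n (fun x => F x ^ (r' / 2)) (fun x => G x ^ (r' / 2))).trans
      (le_of_eq ?_)
    simp_rw [← ENNReal.rpow_mul]
    norm_num
  have e2 : ∑' x, ∑' y, k x y * F x ^ r' * G y ^ r' ≤
      ENNReal.ofReal ((Real.sqrt Q)⁻¹ ^ n) * ((∑' x, F x ^ r') * (∑' y, G y ^ r')) := by
    rw [← ENNReal.tsum_mul_right, ← ENNReal.tsum_mul_left]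
    refine ENNReal.tsum_le_tsum fun x => ?_
    rw [← ENNReal.tsum_mul_left, ← ENNReal.tsum_mul_left]
    refine ENNReal.tsum_le_tsum fun y => ?_
    rw [mul_assoc]
    gcongr
    exact ENNReal.ofReal_le_ofReal (T.ker_le n x y)
  simp_rw [show ∀ x y, ENNReal.ofReal (T.ker n x y) * F x * G y = _ from key]
  rw [← ENNReal.tsum_prod]
  refine (ENNReal.tsum_mul_le_Lp_mul_Lq hpq _ _).trans ?_
  have ha' : a * (1 / a) = 1 := by field_simp
  have ha'' : (1 - a) * (1 / (1 - a)) = 1 := by field_simp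
  simp_rw [← ENNReal.rpow_mul, ha', ha'', ENNReal.rpow_one, one_div_one_div]
  rw [ENNReal.tsum_prod (f := fun x y => k x y * F x ^ (r' / 2) * G y ^ (r' / 2)),
    ENNReal.tsum_prod (f := fun x y => k x y * F x ^ r' * G y ^ r')]
  refine (mul_le_mul' (ENNReal.rpow_le_rpow e1 ha0.le) (ENNReal.rpow_le_rpow e2 ha1.le)).trans
    (le_of_eq ?_)
  simp only [ENNReal.mul_rpow_of_nonneg _ _ ha0.le, ENNReal.mul_rpow_of_nonneg _ _ ha1.le]
  have hfin : ∀ z : ℝ≥0∞, z ^ (1 / r') = (z ^ (1 / 2 : ℝ)) ^ a * z ^ (1 - a) := fun z => by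
    rw [← ENNReal.rpow_mul, ← ENNReal.rpow_add_of_nonneg _ _ (by positivity) ha1.le]
    congr 1
    field_simp
    linarith
  rw [hfin, hfin]
  ring

end HomTree

namespace HomTree

variable {Q : ℕ} (T : HomTree Q)

/-- The Hilbert space `L²(𝕋)`. -/
abbrev Hil := lp (fun _ : T.V => ℂ) 2

lemma sum_norm_sum_nbr_le (g : T.Hil) (s : Finset T.V) :
    ∑ x ∈ s, ‖∑ z ∈ T.nbr x, g z‖ ^ (2 : ℝ≥0∞).toReal ≤ (((Q : ℝ) + 1) * ‖g‖) ^ (2 : ℝ≥0∞).toReal := by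
  classical
  simp only [ENNReal.toReal_ofNat, Real.rpow_ofNat]
  have h2 := lp.sum_rpow_le_norm_rpow (by simp) g (s.biUnion T.nbr)
  simp only [ENNReal.toReal_ofNat, Real.rpow_ofNat] at h2
  calc ∑ x ∈ s, ‖∑ z ∈ T.nbr x, g z‖ ^ 2
      ≤ ∑ x ∈ s, ((Q : ℝ) + 1) * ∑ z ∈ T.nbr x, ‖g z‖ ^ 2 := by
        gcongr with x
        calc ‖∑ z ∈ T.nbr x, g z‖ ^ 2 ≤ (∑ z ∈ T.nbr x, ‖g z‖) ^ 2 := by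
              gcongr; exact norm_sum_le _ _
          _ ≤ (T.nbr x).card * ∑ z ∈ T.nbr x, ‖g z‖ ^ 2 := sq_sum_le_card_mul_sum_sq
          _ = _ := by rw [T.card_nbr]; push_cast; ring
    _ = ((Q : ℝ) + 1) * ∑ z ∈ s.biUnion T.nbr, ∑ x ∈ s.filter (· ∈ T.nbr z), ‖g z‖ ^ 2 := by
        rw [← Finset.mul_sum]
        congr 1
        refine Finset.sum_comm' fun x y => ?_
        simp only [mem_nbr, Finset.mem_filter, Finset.mem_biUnion]
        exact ⟨fun h => ⟨⟨h.1, h.2.symm⟩, x, h.1, h.2⟩, fun h => ⟨h.1.1, h.1.2.symm⟩⟩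
    _ ≤ ((Q : ℝ) + 1) * ∑ z ∈ s.biUnion T.nbr, ((Q : ℝ) + 1) * ‖g z‖ ^ 2 := by
        gcongr with z
        rw [Finset.sum_const, nsmul_eq_mul]
        gcongr
        have : (s.filter (· ∈ T.nbr z)).card ≤ (T.nbr z).card :=
          Finset.card_le_card fun x hx => (Finset.mem_filter.1 hx).2
        rw [T.card_nbr] at this
        exact_mod_cast this
    _ = ((Q : ℝ) + 1) ^ 2 * ∑ z ∈ s.biUnion T.nbr, ‖g z‖ ^ 2 := by rw [← Finset.mul_sum]; ring
    _ ≤ ((Q : ℝ) + 1) ^ 2 * ‖g‖ ^ 2 := by gcongr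
    _ = _ := by ring

/-- The adjacency operator on `L²(𝕋)`. -/
def adjacency : T.Hil →L[ℂ] T.Hil :=
  LinearMap.mkContinuous
    { toFun := fun g => ⟨fun x => ∑ z ∈ T.nbr x, g z, memℓp_gen' (T.sum_norm_sum_nbr_le g)⟩
      map_add' := fun f g => by
        ext x; exact Finset.sum_add_distrib
      map_smul' := fun c g => by
        ext x; simp [Finset.mul_sum] }
    ((Q : ℝ) + 1) fun g => by
      exact lp.norm_le_of_forall_sum_le (by simp) (by positivity) (T.sum_norm_sum_nbr_le g)

lemma adjacency_apply (g : T.Hil) (x : T.V) : T.adjacency g x = ∑ z ∈ T.nbr x, g z := rfl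

lemma adjacency_single [DecidableEq T.V] (x : T.V) (a : ℂ) :
    T.adjacency (lp.single 2 x a) = ∑ z ∈ T.nbr x, lp.single 2 z a := by
  ext w
  rw [adjacency_apply, lp.coeFn_sum, Finset.sum_apply]
  simp only [lp.single_apply, Pi.single_apply, Finset.sum_ite_eq, Finset.sum_ite_eq']
  exact if_congr (by rw [mem_nbr, mem_nbr, T.graph.adj_comm]) rfl rfl

lemma adjacency_isSelfAdjoint : IsSelfAdjoint T.adjacency := by
  classical
  rw [ContinuousLinearMap.isSelfAdjoint_iff_isSymmetric]
  intro f g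
  change inner ℂ (T.adjacency f) g = inner ℂ f (T.adjacency g)
  have h1 := lp.hasSum_inner (𝕜 := ℂ) (T.adjacency f) g
  have h2 := (lp.hasSum_single (by simp) g).mapL ((innerSL ℂ f).comp T.adjacency)
  refine h1.unique (h2.congr_fun fun x => ?_)
  simp only [ContinuousLinearMap.comp_apply, innerSL_apply_apply, adjacency_single, inner_sum,
    lp.inner_single_right, adjacency_apply, sum_inner]

/-- The adjacency operator divided by `√Q`. -/
def stepOp : T.Hil →L[ℂ] T.Hil := ((Real.sqrt Q)⁻¹ : ℂ) • T.adjacency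

lemma stepOp_apply (g : T.Hil) (x : T.V) :
    T.stepOp g x = ((Real.sqrt Q)⁻¹ : ℂ) * ∑ z ∈ T.nbr x, g z := rfl

lemma stepOp_isSelfAdjoint : IsSelfAdjoint T.stepOp := by
  refine IsSelfAdjoint.smul ?_ T.adjacency_isSelfAdjoint
  rw [isSelfAdjoint_iff, ← ofReal_inv, RCLike.star_def, conj_ofReal]

/-- The Chebyshev polynomials of the second kind in `stepOp / 2`. -/
def chebOp : ℕ → (T.Hil →L[ℂ] T.Hil)
  | 0 => 1
  | 1 => T.stepOp
  | n + 2 => T.stepOp * chebOp (n + 1) - chebOp n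

lemma chebOp_apply (hQ : 2 ≤ Q) (n : ℕ) (g : T.Hil) (x : T.V) (S : Finset T.V)
    (hS : T.ballFinset x n ⊆ S) : T.chebOp n g x = ∑ y ∈ S, (T.ker n x y : ℂ) * g y := by
  classical
  induction n using Nat.twoStepInduction generalizing x S with
  | zero =>
    have hx : x ∈ S := hS (by simp)
    simp [chebOp, ker_zero, hx, apply_ite ((↑) : ℝ → ℂ)]
  | one =>
    have h0 : ∀ z ∈ T.nbr x, z ∈ S := fun z hz => hS <| by
      simp [(SimpleGraph.dist_eq_one_iff_adj.2 (T.mem_nbr.1 hz)).le]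
    simp only [chebOp, stepOp_apply, ker_one]
    push_cast
    simp_rw [mul_assoc, Finset.sum_mul]
    rw [← Finset.mul_sum, Finset.sum_comm]
    congr 1
    refine Finset.sum_congr rfl fun z hz => ?_
    simp [ker_zero, h0 z hz, apply_ite ((↑) : ℝ → ℂ)]
  | more n ih0 ih1 =>
    have h0 : ∀ z ∈ T.nbr x, T.ballFinset z (n + 1) ⊆ S := fun z hz y hy => hS <| by
      have := SimpleGraph.dist_eq_one_iff_adj.2 (T.mem_nbr.1 hz)
      have h3 := T.isTree.connected.dist_triangle (u := x) (v := z) (w := y)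
      rw [mem_ballFinset] at hy ⊢
      omega
    have h1 : T.ballFinset x n ⊆ S := fun y hy => hS <| by
      rw [mem_ballFinset] at hy ⊢
      omega
    have e : T.chebOp (n + 2) g x =
        ((Real.sqrt Q)⁻¹ : ℂ) * ∑ z ∈ T.nbr x, T.chebOp (n + 1) g z - T.chebOp n g x := rfl
    rw [e, ih0 x S h1, Finset.sum_congr rfl fun z hz => ih1 z S (h0 z hz)]
    simp only [ker_add_two T hQ]
    push_cast
    simp_rw [sub_mul, mul_assoc, Finset.sum_mul]
    rw [Finset.sum_sub_distrib, ← Finset.mul_sum, Finset.sum_comm]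

lemma enorm_inner_chebOp_le (hQ : 2 ≤ Q) (n : ℕ) (h g : T.Hil) :
    ‖inner ℂ h (T.chebOp n g)‖ₑ ≤
      ∑' x, ∑' y, ENNReal.ofReal (T.ker n x y) * ‖h x‖ₑ * ‖g y‖ₑ := by
  rw [lp.inner_eq_tsum]
  refine enorm_tsum_le_tsum_enorm.trans (ENNReal.tsum_le_tsum fun x => ?_)
  rw [T.chebOp_apply hQ n g x _ subset_rfl, RCLike.inner_apply, enorm_mul, RCLike.enorm_conj,
    tsum_eq_sum (s := T.ballFinset x n) fun y hy => by simp [T.ker_eq_zero hy]]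
  calc _ ≤ (∑ y ∈ T.ballFinset x n, ‖(T.ker n x y : ℂ) * g y‖ₑ) * ‖h x‖ₑ := by
        gcongr; exact enorm_sum_le _ _
    _ = _ := by
        rw [Finset.sum_mul]
        refine Finset.sum_congr rfl fun y _ => ?_
        rw [enorm_mul, ← ofReal_norm (T.ker n x y : ℂ), norm_real,
          Real.norm_of_nonneg (T.ker_nonneg n x y)]
        ring

lemma enorm_eq_tsum (g : T.Hil) : (∑' x, ‖g x‖ₑ ^ (2 : ℝ)) ^ (1 / 2 : ℝ) = ‖g‖ₑ := by
  have hs := lp.hasSum_norm (p := 2) (by simp) g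
  simp only [ENNReal.toReal_ofNat] at hs
  have e : ∑' x, ‖g x‖ₑ ^ (2 : ℝ) = ‖g‖ₑ ^ (2 : ℝ) := by
    simp_rw [← ofReal_norm, ENNReal.ofReal_rpow_of_nonneg (norm_nonneg _) zero_le_two]
    rw [← hs.tsum_eq, ENNReal.ofReal_tsum_of_nonneg (fun _ => by positivity) hs.summable]
  rw [e, ← ENNReal.rpow_mul]
  norm_num

lemma norm_chebOp_le (hQ : 2 ≤ Q) (n : ℕ) : ‖T.chebOp n‖ ≤ n + 1 := by
  refine ContinuousLinearMap.opNorm_le_bound _ (by positivity) fun g => ?_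
  have h := (T.enorm_inner_chebOp_le hQ n (T.chebOp n g) g).trans
    (T.tsum_ker_mul_le hQ n (fun x => ‖T.chebOp n g x‖ₑ) (fun x => ‖g x‖ₑ))
  rw [T.enorm_eq_tsum, T.enorm_eq_tsum] at h
  have h' : ‖T.chebOp n g‖ * ‖T.chebOp n g‖ ≤ (n + 1) * (‖T.chebOp n g‖ * ‖g‖) := by
    have := ENNReal.toReal_mono (by finiteness) h
    simpa [inner_self_eq_norm_sq_to_K, ENNReal.toReal_add, sq] using this
  rcases (norm_nonneg (T.chebOp n g)).eq_or_lt with h0 | h0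
  · rw [← h0]; positivity
  · refine le_of_mul_le_mul_left (h'.trans_eq ?_) h0
    ring

end HomTree

namespace HomTree

open OscInt

variable {Q : ℕ} (T : HomTree Q)

lemma norm_two_div_pi_le : ‖(2 / Real.pi : ℂ)‖ ≤ 1 := by
  rw [norm_div, norm_real, Real.norm_of_nonneg Real.pi_pos.le, RCLike.norm_ofNat,
    div_le_one Real.pi_pos]
  exact Real.two_le_pi

lemma exists_norm_sinInt_le (R : ℝ) :
    ∃ K : ℝ, 0 ≤ K ∧ ∀ τ : ℝ, |τ| < R → ∀ m k : ℕ, m ≤ k →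
      ‖(2 / Real.pi : ℂ) * sinInt τ k‖ * (m + 1) ≤ K * (((m : ℝ) + 1) ^ 2)⁻¹ := by
  obtain ⟨C, hC, h⟩ := exists_norm_sinInt_mul_pow_le 3
  refine ⟨C * (1 + |R|) ^ 3, by positivity, fun τ hτ m k hmk => ?_⟩
  have h1 : ‖sinInt τ k‖ * ((m : ℝ) + 1) ^ 3 ≤ C * (1 + |R|) ^ 3 := by
    calc _ ≤ ‖sinInt τ k‖ * ((k : ℝ) + 1) ^ 3 := by gcongr
      _ ≤ C * (1 + |τ|) ^ 3 := h τ k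
      _ ≤ _ := by
        have := hτ.le.trans (le_abs_self R)
        gcongr C * (1 + ?_) ^ 3
  rw [norm_mul, ← div_eq_mul_inv, le_div_iff₀ (by positivity)]
  calc _ ≤ 1 * ‖sinInt τ k‖ * (m + 1) * ((m : ℝ) + 1) ^ 2 := by
        gcongr; exact norm_two_div_pi_le
    _ = ‖sinInt τ k‖ * ((m : ℝ) + 1) ^ 3 := by ring
    _ ≤ _ := h1

lemma exists_norm_smul_chebOp_le (hQ : 2 ≤ Q) (R : ℝ) :
    ∃ K : ℝ, 0 ≤ K ∧ ∀ τ : ℝ, |τ| < R → ∀ m k : ℕ, m ≤ k →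
      ‖((2 / Real.pi : ℂ) * sinInt τ k) • T.chebOp m‖ ≤ K * (((m : ℝ) + 1) ^ 2)⁻¹ := by
  obtain ⟨K, hK, h⟩ := exists_norm_sinInt_le R
  refine ⟨K, hK, fun τ hτ m k hmk => (h τ hτ m k hmk).trans' ?_⟩
  rw [norm_smul]
  gcongr
  exact T.norm_chebOp_le hQ m

lemma summable_inv_succ_sq : Summable fun m : ℕ => (((m : ℝ) + 1) ^ 2)⁻¹ := by
  have := (summable_nat_add_iff 1).2 (Real.summable_nat_pow_inv (p := 2).2 one_lt_two)
  exact_mod_cast this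

lemma summable_smul_chebOp (hQ : 2 ≤ Q) (τ : ℝ) (j : ℕ) :
    Summable fun m : ℕ => ((2 / Real.pi : ℂ) * sinInt τ (m + j)) • T.chebOp m := by
  obtain ⟨K, -, h⟩ := T.exists_norm_smul_chebOp_le hQ (|τ| + 1)
  exact Summable.of_norm_bounded (summable_inv_succ_sq.mul_left K) fun m =>
    h τ (by linarith) m _ (Nat.le_add_right _ _)

/-- The expansion of `exp (-iτ/2 · stepOp)` in Chebyshev polynomials. -/
def chebSeries (τ : ℝ) : T.Hil →L[ℂ] T.Hil :=
  ∑' m : ℕ, ((2 / Real.pi : ℂ) * sinInt τ (m + 1)) • T.chebOp m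

lemma chebSeries_zero : T.chebSeries 0 = 1 := by
  rw [chebSeries, tsum_eq_single 0 fun m hm => by simp [sinInt_zero_left, hm]]
  have : (Real.pi : ℂ) ≠ 0 := ofReal_ne_zero.2 Real.pi_ne_zero
  rw [sinInt_zero_left, if_pos rfl]
  have h2 : (2 / Real.pi : ℂ) * (Real.pi / 2) = 1 := by field_simp
  rw [h2, one_smul, chebOp]

lemma hasDerivAt_chebSeries (hQ : 2 ≤ Q) (τ : ℝ) :
    HasDerivAt T.chebSeries ((-I / 2) • (T.stepOp * T.chebSeries τ)) τ := by
  set c : ℝ → ℕ → ℂ := fun τ m => (2 / Real.pi : ℂ) * sinInt τ m with hc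
  obtain ⟨K, hK, h⟩ := T.exists_norm_smul_chebOp_le hQ (|τ| + 1)
  have hder : HasDerivAt T.chebSeries
      (∑' m : ℕ, ((-I / 2) • (c τ (m + 2) • T.chebOp m + c τ m • T.chebOp m))) τ := by
    refine hasDerivAt_tsum_of_isPreconnected (t := Set.Ioo (-(|τ| + 1)) (|τ| + 1)) (y₀ := τ)
      (g' := fun m τ => (-I / 2) • (c τ (m + 2) • T.chebOp m + c τ m • T.chebOp m))
      (summable_inv_succ_sq.mul_left K) isOpen_Ioo isPreconnected_Ioo (fun m y _ => ?_)
      (fun m y hy => ?_) (abs_lt.1 (by linarith)) (T.summable_smul_chebOp hQ τ 1)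
      (abs_lt.1 (by linarith))
    · refine (((hasDerivAt_sinInt y m).const_mul (2 / Real.pi : ℂ)).smul_const
        (T.chebOp m)).congr_deriv ?_
      simp only [hc, ← add_smul, smul_smul]
      congr 1
      ring
    · have hn : ‖(-I / 2 : ℂ)‖ = 1 / 2 := by simp
      have h1 := h y (abs_lt.2 hy) m (m + 2) (by omega)
      have h2 := h y (abs_lt.2 hy) m m le_rfl
      rw [norm_smul, hn]
      linarith [norm_add_le (c y (m + 2) • T.chebOp m) (c y m • T.chebOp m)]
  refine hder.congr_deriv ?_
  have hB := (T.summable_smul_chebOp hQ τ 2).hasSum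
  have hA := (T.summable_smul_chebOp hQ τ 0).hasSum
  have hS := (T.summable_smul_chebOp hQ τ 1).hasSum
  simp only [add_zero] at hA
  have hA' := (hasSum_nat_add_iff' 1).2 hA
  simp only [Finset.sum_range_one, sinInt_zero_right, mul_zero, zero_smul, sub_zero] at hA'
  have hN : HasSum (fun m : ℕ => c τ (m + 1) • (if m = 0 then 0 else T.chebOp (m - 1)))
      (∑' m : ℕ, c τ (m + 2) • T.chebOp m) := by
    rw [← hasSum_nat_add_iff' 1]
    simpa using hB
  have hrec : ∀ m, T.stepOp * T.chebOp m =
      T.chebOp (m + 1) + (if m = 0 then 0 else T.chebOp (m - 1)) := fun m => by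
    cases m with
    | zero => simp [chebOp]
    | succ m => simp [chebOp]
  have hY : HasSum (fun m : ℕ => T.stepOp * (c τ (m + 1) • T.chebOp m))
      (T.stepOp * T.chebSeries τ) := hS.mul_left _
  have hY2 := hA'.add hN
  rw [((hB.add hA).const_smul (-I / 2)).tsum_eq]
  congr 1
  refine (add_comm _ _).trans (hY2.unique (hY.congr_fun fun m => ?_))
  rw [mul_smul_comm, hrec, smul_add]

/-- The generator `1 - γ(0)/2 · stepOp` of the Schrödinger group, multiplied by `i`. -/
def generator : T.Hil →L[ℂ] T.Hil :=
  I • (1 - ((gammaZero Q / 2 : ℝ) : ℂ) • T.stepOp)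

lemma real_smul_eq (r : ℝ) (X : T.Hil →L[ℂ] T.Hil) : r • X = (r : ℂ) • X := rfl

/-- The Schrödinger group on `L²(𝕋)`. -/
def group (t : ℝ) : T.Hil →L[ℂ] T.Hil := NormedSpace.exp (t • T.generator)

lemma group_zero : T.group 0 = 1 := by simp [group]

lemma group_add (s t : ℝ) : T.group (s + t) = T.group s * T.group t := by
  let _ : NormedAlgebra ℚ (T.Hil →L[ℂ] T.Hil) := .restrictScalars ℚ ℂ _
  rw [group, group, group, add_smul]
  exact NormedSpace.exp_add_of_commute
    (((Commute.refl T.generator).smul_left s).smul_right t)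

lemma star_generator : star T.generator = -T.generator := by
  have h : IsSelfAdjoint (1 - ((gammaZero Q / 2 : ℝ) : ℂ) • T.stepOp) := by
    refine (IsSelfAdjoint.one _).sub (IsSelfAdjoint.smul ?_ T.stepOp_isSelfAdjoint)
    rw [isSelfAdjoint_iff, RCLike.star_def, conj_ofReal]
  rw [generator, star_smul, h.star_eq, RCLike.star_def, conj_I, neg_smul]

lemma star_group (t : ℝ) : star (T.group t) = T.group (-t) := by
  rw [group, group, NormedSpace.star_exp, real_smul_eq, star_smul, star_generator,
    RCLike.star_def, conj_ofReal, smul_neg, neg_smul, real_smul_eq]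

lemma inner_group (t : ℝ) (f g : T.Hil) :
    inner ℂ (T.group t f) g = inner ℂ f (T.group (-t) g) := by
  rw [← star_group, ContinuousLinearMap.star_eq_adjoint, ContinuousLinearMap.adjoint_inner_right]

lemma group_neg_apply_group_apply (t : ℝ) (f : T.Hil) : T.group (-t) (T.group t f) = f := by
  rw [← mul_apply_eq_comp, ← group_add, neg_add_cancel, group_zero,
    one_apply_eq_self]

lemma norm_group_apply (t : ℝ) (f : T.Hil) : ‖T.group t f‖ = ‖f‖ := by
  have h : inner ℂ (T.group t f) (T.group t f) = inner ℂ f f := by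
    rw [inner_group, group_neg_apply_group_apply]
  rw [inner_self_eq_norm_sq_to_K, inner_self_eq_norm_sq_to_K] at h
  have h2 : ‖T.group t f‖ ^ 2 = ‖f‖ ^ 2 := by exact_mod_cast h
  exact (pow_left_inj₀ (norm_nonneg _) (norm_nonneg _) two_ne_zero).1 h2

lemma group_eq_chebSeries (hQ : 2 ≤ Q) (t : ℝ) :
    T.group t = exp (I * t) • T.chebSeries (gammaZero Q * t) := by
  set W : ℝ → (T.Hil →L[ℂ] T.Hil) := fun t => exp (I * t) • T.chebSeries (gammaZero Q * t) with hW
  have hWd : ∀ t, HasDerivAt W (T.generator * W t) t := fun t => by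
    have h1 : HasDerivAt (fun t : ℝ => exp (I * t)) (exp (I * t) * I) t := by
      simpa using ((ofRealCLM.hasDerivAt (x := t)).const_mul I).cexp
    have h2 : HasDerivAt (fun t : ℝ => T.chebSeries (gammaZero Q * t))
        (gammaZero Q • ((-I / 2) • (T.stepOp * T.chebSeries (gammaZero Q * t)))) t := by
      have := (hasDerivAt_id t).const_mul (gammaZero Q)
      rw [mul_one] at this
      exact (T.hasDerivAt_chebSeries hQ (gammaZero Q * t)).scomp t this
    refine (h1.smul h2).congr_deriv ?_
    simp only [hW, generator, smul_mul_assoc, mul_smul_comm, sub_mul, one_mul, smul_sub, smul_smul]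
    rw [real_smul_eq, smul_smul, smul_smul]
    push_cast
    rw [add_comm, sub_eq_add_neg, ← neg_smul]
    congr 2; ring
  have hVd : ∀ t, HasDerivAt (fun t => T.group (-t) * W t) 0 t := fun t => by
    have h1 : HasDerivAt (fun t => T.group (-t)) (-(T.group (-t) * T.generator)) t := by
      have := (hasDerivAt_exp_smul_const (𝕂 := ℝ) T.generator (-t)).scomp t (hasDerivAt_neg t)
      rw [neg_smul, one_smul] at this
      exact this
    refine (h1.mul (hWd t)).congr_deriv ?_
    noncomm_ring
  have hconst := is_const_of_deriv_eq_zero (fun t => (hVd t).differentiableAt)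
    (fun t => (hVd t).deriv) t 0
  have h0 : T.group (-t) * W t = 1 := by
    rw [hconst]; simp [hW, group_zero, chebSeries_zero]
  calc T.group t = T.group t * (T.group (-t) * W t) := by rw [h0, mul_one]
    _ = W t := by rw [← mul_assoc, ← group_add, add_neg_cancel, group_zero, one_mul]

end HomTree

namespace HomTree

open OscInt

variable {Q : ℕ} (T : HomTree Q)

lemma schKernel_eq (hQ : 2 ≤ Q) (t : ℝ) (x y : T.V) :
    schKernel Q t (T.graph.dist x y) = exp (I * t) * ∑' m : ℕ,
      ((2 / Real.pi : ℂ) * sinInt (gammaZero Q * t) (m + 1)) * (T.ker m x y : ℂ) := by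
  set d := T.graph.dist x y with hd
  have hinj : Function.Injective fun k : ℕ => d + 2 * k := fun a b h => by
    simp only at h; omega
  rw [← hinj.tsum_eq, schKernel, mul_assoc, ← tsum_mul_left]
  · congr 2
    funext k
    have e1 : (Q : ℝ) ^ (-(d : ℝ) / 2 - (k : ℝ)) = T.ker (d + 2 * k) x y := by
      have hp : parityBall (d + 2 * k) (T.graph.dist x y) := ⟨by omega, by omega⟩
      rw [ker, if_pos hp, mul_one, Real.sqrt_eq_rpow, ← Real.rpow_neg (by positivity),
        ← Real.rpow_natCast, ← Real.rpow_mul (by positivity)]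
      congr 1
      push_cast
      ring
    have e2 : (∫ l in (0 : ℝ)..Real.pi, exp (-I * (gammaZero Q) * t * Real.cos l) *
          (Real.sin l : ℂ) * (Real.sin (((d : ℝ) + 2 * k + 1) * l) : ℂ)) =
        sinInt (gammaZero Q * t) (d + 2 * k + 1) := by
      rw [sinInt]
      congr 1
      funext l
      push_cast
      ring_nf
    rw [e1, e2]
    ring
  · intro m hm
    by_contra hne
    refine hm ?_
    have : ¬ parityBall m (T.graph.dist x y) := fun ⟨h1, h2⟩ => hne ⟨(m - d) / 2, by
      simp only; omega⟩
    simp [ker, this]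

lemma tsum_ker_mul_enorm_le (hQ : 2 ≤ Q) (m : ℕ) (g : T.Hil) (x : T.V) :
    ∑' y, ENNReal.ofReal (T.ker m x y) * ‖g y‖ₑ ≤ (m + 1) * ‖g‖ₑ := by
  classical
  have h := T.tsum_ker_mul_le hQ m (Pi.single x 1) (fun y => ‖g y‖ₑ)
  have e1 : ∑' z, (Pi.single x 1 : T.V → ℝ≥0∞) z ^ (2 : ℝ) = 1 := by
    rw [tsum_eq_single x fun z hz => by simp [Pi.single_eq_of_ne hz]]; simp
  have e2 : ∑' z, ∑' y, ENNReal.ofReal (T.ker m z y) * (Pi.single x 1 : T.V → ℝ≥0∞) z * ‖g y‖ₑ =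
      ∑' y, ENNReal.ofReal (T.ker m x y) * ‖g y‖ₑ := by
    rw [tsum_eq_single x fun z hz => by simp [Pi.single_eq_of_ne hz]]; simp
  rw [enorm_eq_tsum, e1, e2] at h
  simpa using h

lemma tsum_enorm_coef_ne_top (τ : ℝ) :
    ∑' m : ℕ, ‖(2 / Real.pi : ℂ) * sinInt τ (m + 1)‖ₑ * (m + 1) ≠ ∞ := by
  obtain ⟨K, hK, h⟩ := exists_norm_sinInt_le (|τ| + 1)
  have hs := summable_inv_succ_sq.mul_left K
  refine ne_top_of_le_ne_top (hs.tsum_ofReal_ne_top) (ENNReal.tsum_le_tsum fun m => ?_)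
  have e : ((m : ℝ≥0∞) + 1) = ENNReal.ofReal (m + 1) := by
    rw [ENNReal.ofReal_add (by positivity) zero_le_one]; simp
  rw [e, ← ofReal_norm, ← ENNReal.ofReal_mul (norm_nonneg _)]
  exact ENNReal.ofReal_le_ofReal (h τ (by linarith) m _ (Nat.le_succ m))

/-- The kernel `propagate` acts on `L²(𝕋)` as the Schrödinger group. -/
lemma propagate_eq_group (hQ : 2 ≤ Q) (t : ℝ) (g : T.Hil) (x : T.V) :
    propagate T t g x = T.group t g x := by
  set τ := gammaZero Q * t with hτ
  set c : ℕ → ℂ := fun m => (2 / Real.pi : ℂ) * sinInt τ (m + 1) with hc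
  have hsum : Summable fun p : ℕ × T.V => c p.1 * ((T.ker p.1 x p.2 : ℂ) * g p.2) := by
    refine Summable.of_nnnorm (ENNReal.tsum_coe_ne_top_iff_summable.1 ?_)
    change ∑' p : ℕ × T.V, ‖c p.1 * ((T.ker p.1 x p.2 : ℂ) * g p.2)‖ₑ ≠ ∞
    rw [ENNReal.tsum_prod (f := fun m y => ‖c m * ((T.ker m x y : ℂ) * g y)‖ₑ)]
    have hb : ∀ m, ∑' y, ‖c m * ((T.ker m x y : ℂ) * g y)‖ₑ ≤ ‖c m‖ₑ * (m + 1) * ‖g‖ₑ := fun m => by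
      simp_rw [enorm_mul]
      rw [ENNReal.tsum_mul_left, mul_assoc]
      gcongr
      refine (T.tsum_ker_mul_enorm_le hQ m g x).trans' (le_of_eq ?_)
      congr 1; funext y
      rw [← ofReal_norm (T.ker m x y : ℂ), norm_real, Real.norm_of_nonneg (T.ker_nonneg m x y)]
    refine ne_top_of_le_ne_top ?_ (ENNReal.tsum_le_tsum hb)
    rw [ENNReal.tsum_mul_right]
    exact ENNReal.mul_ne_top (tsum_enorm_coef_ne_top τ) enorm_ne_top
  have h1 : ∑' p : ℕ × T.V, c p.1 * ((T.ker p.1 x p.2 : ℂ) * g p.2) = T.chebSeries τ g x := by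
    rw [hsum.tsum_prod]
    have hS := (T.summable_smul_chebOp hQ τ 1).hasSum
    have hS2 := (hS.mapL (ContinuousLinearMap.apply ℂ T.Hil g)).mapL
      (lp.evalCLM ℂ (fun _ : T.V => ℂ) 2 x)
    refine (tsum_congr fun m => ?_).trans hS2.tsum_eq
    refine tsum_mul_left.trans (congrArg (c m * ·) ?_)
    refine (tsum_eq_sum (s := T.ballFinset x m) fun y hy => by simp [T.ker_eq_zero hy]).trans ?_
    exact (T.chebOp_apply hQ m g x _ subset_rfl).symm
  have hsum' : Summable fun p : T.V × ℕ => c p.2 * ((T.ker p.2 x p.1 : ℂ) * g p.1) :=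
    (Equiv.prodComm T.V ℕ).summable_iff.2 hsum
  have h2 : ∑' p : ℕ × T.V, c p.1 * ((T.ker p.1 x p.2 : ℂ) * g p.2) =
      ∑' y, (∑' m, c m * (T.ker m x y : ℂ)) * g y := by
    rw [← (Equiv.prodComm T.V ℕ).tsum_eq]
    refine hsum'.tsum_prod.trans (tsum_congr fun y => ?_)
    rw [← tsum_mul_right]
    exact tsum_congr fun m => by ring
  have hsumy : Summable fun y => (∑' m, c m * (T.ker m x y : ℂ)) * g y := by
    refine hsum'.prod.congr fun y => ?_
    rw [← tsum_mul_right]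
    exact tsum_congr fun m => by ring
  have h3 := (hsumy.hasSum.mul_left (exp (I * t))).tsum_fiberwise (fun y => T.graph.dist x y)
  rw [group_eq_chebSeries T hQ]
  change _ = exp (I * t) * T.chebSeries τ g x
  rw [← h1, h2, ← h3.tsum_eq, propagate]
  refine tsum_congr fun n => ?_
  rw [sphereSum, ← tsum_mul_left]
  refine tsum_congr fun y => ?_
  have e : schKernel Q t n = schKernel Q t (T.graph.dist x y.1) := by rw [y.2]
  exact (congrArg (· * g y.1) (e.trans (T.schKernel_eq hQ t x y.1))).trans (mul_assoc _ _ _)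

/-- The `ℓ^r` norm of a function on the vertices, for a real exponent. -/
def lpSum (r : ℝ) (F : T.V → ℂ) : ℝ≥0∞ := (∑' x, ‖F x‖ₑ ^ r) ^ (1 / r)

lemma exists_tsum_coef_le {ρ : ℝ≥0∞} (hρ : ρ < 1) {a : ℝ} (ha : a ≤ 1) :
    ∃ C : ℝ≥0, ∀ τ : ℝ, ∑' m : ℕ, ‖(2 / Real.pi : ℂ) * sinInt τ (m + 1)‖ₑ *
      (((m : ℝ≥0∞) + 1) ^ a * ρ ^ m) ≤ C * ENNReal.ofReal ((1 + |τ|) ^ (-(3 / 2) : ℝ)) := by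
  lift ρ to ℝ≥0 using hρ.ne_top
  have hρ1 : ‖(ρ : ℝ)‖ < 1 := by simpa using hρ
  have hs : Summable fun m : ℕ => 40 * ((m : ℝ) + 2) ^ 3 * (ρ : ℝ) ^ m := by
    have h3 := summable_pow_mul_geometric_of_norm_lt_one 3 hρ1
    have h0 := summable_pow_mul_geometric_of_norm_lt_one 0 hρ1
    have h1 := summable_pow_mul_geometric_of_norm_lt_one 1 hρ1
    have h2 := summable_pow_mul_geometric_of_norm_lt_one 2 hρ1
    refine ((((h3.add (h2.mul_left 6)).add (h1.mul_left 12)).add (h0.mul_left 8)).mul_left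
      40).congr fun m => ?_
    ring
  refine ⟨(∑' m : ℕ, ENNReal.ofReal (40 * ((m : ℝ) + 2) ^ 3 * (ρ : ℝ) ^ m)).toNNReal, fun τ => ?_⟩
  rw [ENNReal.coe_toNNReal hs.tsum_ofReal_ne_top, ← ENNReal.tsum_mul_right]
  refine ENNReal.tsum_le_tsum fun m => ?_
  have e : ((m : ℝ≥0∞) + 1) ^ a ≤ ENNReal.ofReal (m + 1) := by
    have e' : ENNReal.ofReal ((m : ℝ) + 1) = m + 1 := by
      rw [ENNReal.ofReal_add (by positivity) zero_le_one]; simp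
    rw [e']
    conv_rhs => rw [← ENNReal.rpow_one ((m : ℝ≥0∞) + 1)]
    exact ENNReal.rpow_le_rpow_of_exponent_le (by simp) ha
  have e2 : (ρ : ℝ≥0∞) ^ m = ENNReal.ofReal ((ρ : ℝ) ^ m) := by
    rw [ENNReal.ofReal_pow ρ.coe_nonneg, ENNReal.ofReal_coe_nnreal]
  have e3 : ‖(2 / Real.pi : ℂ) * sinInt τ (m + 1)‖ ≤
      40 * ((m : ℝ) + 2) ^ 2 * (1 + |τ|) ^ (-(3 / 2) : ℝ) := by
    rw [norm_mul]
    refine (mul_le_mul norm_two_div_pi_le (norm_sinInt_decay τ (m + 1)) (norm_nonneg _)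
      zero_le_one).trans (le_of_eq ?_)
    push_cast; ring
  calc _ ≤ ENNReal.ofReal (40 * ((m : ℝ) + 2) ^ 2 * (1 + |τ|) ^ (-(3 / 2) : ℝ)) *
        (ENNReal.ofReal (m + 1) * ENNReal.ofReal ((ρ : ℝ) ^ m)) := by
        rw [← ofReal_norm, e2]; gcongr
    _ = ENNReal.ofReal (40 * ((m : ℝ) + 2) ^ 2 * (1 + |τ|) ^ (-(3 / 2) : ℝ) *
        ((m + 1) * (ρ : ℝ) ^ m)) := by
        rw [← ENNReal.ofReal_mul (by positivity), ← ENNReal.ofReal_mul (by positivity)]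
    _ ≤ ENNReal.ofReal (40 * ((m : ℝ) + 2) ^ 3 * (ρ : ℝ) ^ m * (1 + |τ|) ^ (-(3 / 2) : ℝ)) := by
        refine ENNReal.ofReal_le_ofReal ?_
        calc _ = 40 * ((m : ℝ) + 2) ^ 2 * (m + 1) * (ρ : ℝ) ^ m * (1 + |τ|) ^ (-(3 / 2) : ℝ) := by
              ring
          _ ≤ 40 * ((m : ℝ) + 2) ^ 2 * (m + 2) * (ρ : ℝ) ^ m * (1 + |τ|) ^ (-(3 / 2) : ℝ) := by
              gcongr; norm_num
          _ = _ := by ring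
    _ = _ := ENNReal.ofReal_mul (by positivity)

lemma gammaZero_pos (hQ : 2 ≤ Q) : 0 < gammaZero Q := by
  have : 0 < Real.sqrt Q := Real.sqrt_pos.2 (by exact_mod_cast (by omega : 0 < Q))
  unfold gammaZero; positivity

lemma exists_decay_gammaZero_le (hQ : 2 ≤ Q) :
    ∃ C : ℝ≥0, ∀ t : ℝ, ENNReal.ofReal ((1 + |gammaZero Q * t|) ^ (-(3 / 2) : ℝ)) ≤
      C * ENNReal.ofReal ((1 + |t|) ^ (-(3 / 2) : ℝ)) := by
  have hγ := gammaZero_pos hQ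
  set c := min 1 (gammaZero Q) with hc
  have hc0 : 0 < c := lt_min one_pos hγ
  refine ⟨(c ^ (-(3 / 2) : ℝ)).toNNReal, fun t => ?_⟩
  change _ ≤ ENNReal.ofReal _ * _
  rw [← ENNReal.ofReal_mul (by positivity), ← Real.mul_rpow hc0.le (by positivity)]
  refine ENNReal.ofReal_le_ofReal (Real.rpow_le_rpow_of_nonpos (by positivity) ?_ (by norm_num))
  rw [mul_add, mul_one, abs_mul, abs_of_pos hγ]
  gcongr
  · exact min_le_left _ _
  · exact min_le_right _ _

/-- The dispersive estimate, in bilinear form. -/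
lemma exists_enorm_inner_group_le (hQ : 2 ≤ Q) {r : ℝ} (hr : 2 < r) :
    ∃ C : ℝ≥0, ∀ (t : ℝ) (h g : T.Hil), ‖inner ℂ h (T.group t g)‖ₑ ≤
      C * ENNReal.ofReal ((1 + |t|) ^ (-(3 / 2) : ℝ)) *
        (T.lpSum (r / (r - 1)) h * T.lpSum (r / (r - 1)) g) := by
  have hs : 1 < Real.sqrt Q := by
    rw [Real.lt_sqrt zero_le_one, one_pow]; exact_mod_cast hQ
  have ha : 2 / r ≤ 1 := by rw [div_le_one] <;> linarith
  have ha' : 0 < 1 - 2 / r := by rw [sub_pos, div_lt_one] <;> linarith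
  set ρ : ℝ≥0∞ := ENNReal.ofReal (Real.sqrt Q)⁻¹ ^ (1 - 2 / r) with hρ
  have hρ1 : ρ < 1 := by
    refine ENNReal.rpow_lt_one ?_ ha'
    rw [← ENNReal.ofReal_one, ENNReal.ofReal_lt_ofReal_iff one_pos]
    exact inv_lt_one_of_one_lt₀ hs
  obtain ⟨C1, h1⟩ := exists_tsum_coef_le hρ1 ha
  obtain ⟨C2, h2⟩ := exists_decay_gammaZero_le hQ
  refine ⟨C1 * C2, fun t h g => ?_⟩
  set τ := gammaZero Q * t with hτ
  have hS := ((T.summable_smul_chebOp hQ τ 1).hasSum.mapL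
    (ContinuousLinearMap.apply ℂ T.Hil g)).mapL (innerSL ℂ h)
  have e1 : inner ℂ h (T.group t g) = exp (I * t) * inner ℂ h (T.chebSeries τ g) := by
    rw [group_eq_chebSeries T hQ, smul_apply, inner_smul_right]
  have e2 : ‖exp (I * t)‖ₑ = 1 := by
    rw [← ofReal_norm, mul_comm, norm_exp_ofReal_mul_I, ENNReal.ofReal_one]
  have e3 : inner ℂ h (T.chebSeries τ g) =
      ∑' m : ℕ, ((2 / Real.pi : ℂ) * sinInt τ (m + 1)) * inner ℂ h (T.chebOp m g) := by
    refine hS.tsum_eq.symm.trans (tsum_congr fun m => ?_)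
    exact inner_smul_right h (T.chebOp m g) _
  rw [e1, enorm_mul, e2, one_mul, e3]
  set N := T.lpSum (r / (r - 1)) h * T.lpSum (r / (r - 1)) g
  calc _ ≤ ∑' m : ℕ, ‖((2 / Real.pi : ℂ) * sinInt τ (m + 1)) * inner ℂ h (T.chebOp m g)‖ₑ :=
        enorm_tsum_le_tsum_enorm
    _ ≤ ∑' m : ℕ, ‖(2 / Real.pi : ℂ) * sinInt τ (m + 1)‖ₑ *
        (((m : ℝ≥0∞) + 1) ^ (2 / r) * ρ ^ m) * N := by
        refine ENNReal.tsum_le_tsum fun m => ?_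
        rw [enorm_mul, mul_assoc]
        gcongr
        refine ((T.enorm_inner_chebOp_le hQ m h g).trans
          (T.tsum_ker_mul_le_of_two_lt hQ hr m _ _)).trans (le_of_eq ?_)
        rw [ENNReal.ofReal_pow (by positivity), hρ, ← ENNReal.rpow_natCast,
          ← ENNReal.rpow_natCast, ← ENNReal.rpow_mul, ← ENNReal.rpow_mul, mul_comm (m : ℝ)]
        rfl
    _ ≤ C1 * (C2 * ENNReal.ofReal ((1 + |t|) ^ (-(3 / 2) : ℝ))) * N := by
        rw [ENNReal.tsum_mul_right]
        gcongr
        exact (h1 τ).trans (by gcongr; exact h2 t)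
    _ = _ := by push_cast; ring

end HomTree

lemma ENNReal.tsum_rpow_rpow_le {ι : Type*} (x : ι → ℝ≥0∞) {a b : ℝ} (ha : 0 < a) (hab : a ≤ b) :
    (∑' i, x i ^ b) ^ (1 / b) ≤ (∑' i, x i ^ a) ^ (1 / a) := by
  have hb : 0 < b := ha.trans_le hab
  set S := ∑' i, x i ^ a with hS
  have h : ∑' i, x i ^ b ≤ S ^ (b / a) := by
    calc ∑' i, x i ^ b ≤ ∑' i, x i ^ a * S ^ ((b - a) / a) := by
          refine ENNReal.tsum_le_tsum fun i => ?_
          have e : x i ^ b = x i ^ a * x i ^ (b - a) := by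
            rw [← ENNReal.rpow_add_of_nonneg _ _ ha.le (by linarith)]; congr 1; ring
          rw [e]
          gcongr
          calc x i ^ (b - a) = (x i ^ a) ^ ((b - a) / a) := by
                rw [← ENNReal.rpow_mul]; congr 1; field_simp
            _ ≤ _ := ENNReal.rpow_le_rpow (ENNReal.le_tsum i) (div_nonneg (by linarith) ha.le)
      _ = S ^ (b / a) := by
          rw [ENNReal.tsum_mul_right, ← hS]
          conv_lhs => rw [← ENNReal.rpow_one S, ← ENNReal.rpow_mul, one_mul]
          rw [← ENNReal.rpow_add_of_nonneg _ _ zero_le_one (div_nonneg (by linarith) ha.le)]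
          congr 1; field_simp; ring
  refine (ENNReal.rpow_le_rpow h (by positivity)).trans (le_of_eq ?_)
  rw [← ENNReal.rpow_mul]; congr 1; field_simp

lemma ENNReal.tsum_Lp_add_le {ι : Type*} (f g : ι → ℝ≥0∞) {p : ℝ} (hp : 1 ≤ p) :
    (∑' i, (f i + g i) ^ p) ^ (1 / p) ≤
      (∑' i, f i ^ p) ^ (1 / p) + (∑' i, g i ^ p) ^ (1 / p) := by
  have hp0 : 0 < p := by linarith
  rw [one_div, ENNReal.rpow_inv_le_iff hp0, ENNReal.tsum_eq_iSup_sum]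
  refine iSup_le fun s => ?_
  rw [← ENNReal.rpow_inv_le_iff hp0, ← one_div]
  refine (ENNReal.Lp_add_le s f g hp).trans ?_
  gcongr <;> exact ENNReal.sum_le_tsum s

lemma ENNReal.tsum_convolution_sq_le (κ ν : ℤ → ℝ≥0∞) :
    (∑' k, (∑' l, κ (k - l) * ν l) ^ (2 : ℝ)) ^ (1 / 2 : ℝ) ≤
      (∑' j, κ j) * (∑' l, ν l ^ (2 : ℝ)) ^ (1 / 2 : ℝ) := by
  have hs (k : ℤ) : ∑' l, κ (k - l) = ∑' j, κ j := (Equiv.subLeft k).tsum_eq κ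
  have hs' (l : ℤ) : ∑' k, κ (k - l) = ∑' j, κ j := (Equiv.subRight l).tsum_eq κ
  set M := ∑' j, κ j
  have h (k : ℤ) : (∑' l, κ (k - l) * ν l) ^ (2 : ℝ) ≤ M * ∑' l, κ (k - l) * ν l ^ (2 : ℝ) := by
    have h1 := ENNReal.tsum_mul_le_Lp_mul_Lq Real.HolderConjugate.two_two
      (fun l => κ (k - l) ^ (1 / 2 : ℝ)) (fun l => κ (k - l) ^ (1 / 2 : ℝ) * ν l)
    have e (a b : ℝ≥0∞) : a ^ (1 / 2 : ℝ) * (a ^ (1 / 2 : ℝ) * b) = a * b := by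
      rw [← mul_assoc, ← ENNReal.rpow_add_of_nonneg _ _ (by norm_num) (by norm_num)]
      norm_num
    have e2 (a b : ℝ≥0∞) : (a ^ (1 / 2 : ℝ) * b) ^ (2 : ℝ) = a * b ^ (2 : ℝ) := by
      rw [ENNReal.mul_rpow_of_nonneg _ _ (by norm_num), ← ENNReal.rpow_mul]; norm_num
    have e3 (a : ℝ≥0∞) : (a ^ (1 / 2 : ℝ)) ^ (2 : ℝ) = a := by
      rw [← ENNReal.rpow_mul]; norm_num
    simp only [e, e2, e3, hs] at h1
    refine (ENNReal.rpow_le_rpow h1 (by norm_num)).trans (le_of_eq ?_)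
    rw [ENNReal.mul_rpow_of_nonneg _ _ (by norm_num), e3, e3]
  rw [one_div, ENNReal.rpow_inv_le_iff two_pos, ENNReal.mul_rpow_of_nonneg _ _ zero_le_two,
    ← ENNReal.rpow_mul]
  calc _ ≤ ∑' k, M * ∑' l, κ (k - l) * ν l ^ (2 : ℝ) := ENNReal.tsum_le_tsum h
    _ = M * ∑' l, ∑' k, κ (k - l) * ν l ^ (2 : ℝ) := by rw [ENNReal.tsum_mul_left, ENNReal.tsum_comm]
    _ = M * (M * ∑' l, ν l ^ (2 : ℝ)) := by
        congr 1
        rw [← ENNReal.tsum_mul_left]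
        exact tsum_congr fun l => by rw [ENNReal.tsum_mul_right, hs']
    _ = _ := by
        rw [← mul_assoc, inv_mul_cancel₀ two_ne_zero, ENNReal.rpow_one, ENNReal.rpow_two, sq]

lemma lintegral_eq_tsum_Ico_int (f : ℝ → ℝ≥0∞) :
    ∫⁻ s, f s = ∑' l : ℤ, ∫⁻ s in Set.Ico (l : ℝ) (l + 1), f s := by
  rw [← lintegral_iUnion (fun l => measurableSet_Ico) (Set.pairwise_disjoint_Ico_intCast ℝ),
    iUnion_Ico_intCast, Measure.restrict_univ]

lemma lintegral_rpow_le_of_measure_le_one {α : Type*} [MeasurableSpace α] {μ : Measure α}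
    (hμ : μ Set.univ ≤ 1) (f : α → ℝ≥0∞) {p : ℝ} (hp : 1 < p) :
    (∫⁻ s, f s ∂μ) ^ p ≤ ∫⁻ s, f s ^ p ∂μ := by
  obtain ⟨g, hg, hgf, he⟩ := exists_measurable_le_lintegral_eq μ f
  have hp0 : 0 < p := by linarith
  rw [he, ← ENNReal.le_rpow_inv_iff hp0]
  have h := ENNReal.lintegral_mul_le_Lp_mul_Lq μ (Real.HolderConjugate.conjExponent hp)
    hg.aemeasurable (aemeasurable_const (b := (1 : ℝ≥0∞)))
  simp only [Pi.mul_apply, mul_one, ENNReal.one_rpow, lintegral_const, one_mul] at h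
  refine h.trans ?_
  rw [← one_div]
  calc _ ≤ (∫⁻ a, g a ^ p ∂μ) ^ (1 / p) * 1 := by
        gcongr
        refine ENNReal.rpow_le_one hμ ?_
        have := (Real.HolderConjugate.conjExponent hp).symm.pos
        positivity
    _ ≤ _ := by
        rw [mul_one]
        gcongr with a
        exact hgf a

lemma tsum_sq_lintegral_Ico_le (N : ℝ → ℝ≥0∞) {p : ℝ} (hp : 1 < p) (hp2 : p ≤ 2) :
    (∑' l : ℤ, (∫⁻ s in Set.Ico (l : ℝ) (l + 1), N s) ^ (2 : ℝ)) ^ (1 / 2 : ℝ) ≤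
      (∫⁻ s, N s ^ p) ^ (1 / p) := by
  refine (ENNReal.tsum_rpow_rpow_le _ (by linarith) hp2).trans ?_
  rw [lintegral_eq_tsum_Ico_int]
  gcongr with l
  exact lintegral_rpow_le_of_measure_le_one (by simp) _ hp

lemma lintegral_rpow_le_tsum_sq {u : ℝ → ℝ≥0∞} {W : ℤ → ℝ≥0∞}
    (h : ∀ (k : ℤ), ∀ t ∈ Set.Ico (k : ℝ) (k + 1), u t ≤ W k) {p : ℝ} (hp : 2 ≤ p) :
    (∫⁻ s, u s ^ p) ^ (1 / p) ≤ (∑' k, W k ^ (2 : ℝ)) ^ (1 / 2 : ℝ) := by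
  refine le_trans ?_ (ENNReal.tsum_rpow_rpow_le _ two_pos hp)
  rw [lintegral_eq_tsum_Ico_int]
  gcongr with k
  calc _ ≤ ∫⁻ s in Set.Ico (k : ℝ) (k + 1), W k ^ p := by
        refine setLIntegral_mono' measurableSet_Ico fun s hs => ?_
        gcongr
        exact h k s hs
    _ = _ := by simp

/-- A summable majorant of the dispersive decay rate, over unit time windows. -/
def windowDecay (j : ℤ) : ℝ≥0∞ := ENNReal.ofReal (((1 + |(j : ℝ)|) / 2) ^ (-(3 / 2) : ℝ))

lemma tsum_windowDecay_ne_top : ∑' j, windowDecay j ≠ ∞ := by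
  have h : Summable fun j : ℤ => ((1 + |(j : ℝ)|) / 2) ^ (-(3 / 2) : ℝ) := by
    refine Summable.of_norm_bounded_eventually (g := fun j : ℤ => 2 ^ (3 / 2 : ℝ) * |(j : ℝ)| ^ (-(3 / 2) : ℝ))
      ((Real.summable_abs_int_rpow (by norm_num)).mul_left _) ?_
    filter_upwards [(Set.finite_singleton (0 : ℤ)).compl_mem_cofinite] with j hj
    have hj : 0 < |(j : ℝ)| := by simpa using hj
    rw [Real.norm_of_nonneg (by positivity)]
    have e : (2 : ℝ) ^ (3 / 2 : ℝ) = (1 / 2) ^ (-(3 / 2) : ℝ) := by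
      rw [Real.rpow_neg (by norm_num), ← Real.inv_rpow (by norm_num)]; norm_num
    rw [e, ← Real.mul_rpow (by norm_num) hj.le]
    refine Real.rpow_le_rpow_of_nonpos (by positivity) ?_ (by norm_num)
    linarith
  exact h.tsum_ofReal_ne_top

lemma ofReal_decay_le_windowDecay {k l : ℤ} {t s : ℝ} (ht : t ∈ Set.Ico (k : ℝ) (k + 1))
    (hs : s ∈ Set.Ico (l : ℝ) (l + 1)) :
    ENNReal.ofReal ((1 + |t - s|) ^ (-(3 / 2) : ℝ)) ≤ windowDecay (k - l) := by
  refine ENNReal.ofReal_le_ofReal (Real.rpow_le_rpow_of_nonpos (by positivity) ?_ (by norm_num))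
  obtain ⟨h1, h2⟩ := ht
  obtain ⟨h3, h4⟩ := hs
  have h0 := abs_nonneg (t - s)
  have ha : |((k - l : ℤ) : ℝ)| ≤ 1 + |t - s| := by
    push_cast
    refine abs_le.2 ⟨?_, ?_⟩
    · linarith [neg_abs_le (t - s)]
    · linarith [le_abs_self (t - s)]
  linarith

namespace HomTree
variable {Q : ℕ} (T : HomTree Q)

lemma lpSum_two_eq_enorm (g : T.Hil) : T.lpSum 2 g = ‖g‖ₑ := T.enorm_eq_tsum g

lemma lpSum_le_lpSum {a b : ℝ} (ha : 0 < a) (hab : a ≤ b) (F : T.V → ℂ) :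
    T.lpSum b F ≤ T.lpSum a F := ENNReal.tsum_rpow_rpow_le _ ha hab

lemma lpSum_ne_top {a : ℝ} (ha : 2 ≤ a) (g : T.Hil) : T.lpSum a g ≠ ∞ :=
  ne_top_of_le_ne_top (by rw [lpSum_two_eq_enorm]; exact enorm_ne_top)
    (T.lpSum_le_lpSum two_pos ha g)

lemma eq_zero_of_lpSum_eq_zero {a : ℝ} (ha : 0 < a) {F : T.V → ℂ} (h : T.lpSum a F = 0) :
    F = 0 := by
  rw [lpSum, ENNReal.rpow_eq_zero_iff_of_pos (by positivity), ENNReal.tsum_eq_zero] at h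
  funext x
  simpa [ha.not_gt, ha] using h x

lemma lpSum_zero {a : ℝ} (ha : 0 < a) : T.lpSum a 0 = 0 := by
  simp [lpSum, ha]

lemma lpSum_rpow {a : ℝ} (ha : 0 < a) (F : T.V → ℂ) :
    T.lpSum a F ^ a = ∑' x, ‖F x‖ₑ ^ a := by
  rw [lpSum, ← ENNReal.rpow_mul, one_div, inv_mul_cancel₀ ha.ne', ENNReal.rpow_one]

/-- The normalised dual function of an element of `ℓ²`, seen in `ℓ^a`. -/
lemma exists_dual {a : ℝ} (ha : 2 ≤ a) (h : T.Hil) : ∃ g : T.Hil,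
    T.lpSum (a / (a - 1)) g = T.lpSum a h ∧
    inner ℂ g h = (((T.lpSum a h ^ (2 : ℝ)).toReal : ℝ) : ℂ) ∧ ∀ x, h x = 0 → g x = 0 := by
  have ha0 : 0 < a := by linarith
  have ha1 : 0 < a - 1 := by linarith
  set L := T.lpSum a h with hL
  by_cases hL0 : L = 0
  · refine ⟨0, ?_, ?_, fun x _ => rfl⟩
    · rw [hL0]; exact T.lpSum_zero (by positivity)
    · rw [inner_zero_left, hL0]; simp
  have hLt : L ≠ ∞ := T.lpSum_ne_top ha h
  set c : ℝ≥0∞ := L ^ (2 - a) with hc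
  have hct : c ≠ ∞ := ENNReal.rpow_ne_top_of_ne_zero hL0 hLt
  have hmem : Memℓp (fun x => ((c.toReal * ‖h x‖ ^ (a - 2) : ℝ) : ℂ) * h x) 2 := by
    refine ((lp.memℓp h).const_smul ((c.toReal * ‖h‖ ^ (a - 2) : ℝ) : ℂ)).mono' fun x => ?_
    rw [norm_mul, Pi.smul_apply, norm_smul, norm_real, norm_real]
    gcongr
    rw [Real.norm_of_nonneg (by positivity), Real.norm_of_nonneg (by positivity)]
    have := lp.norm_apply_le_norm two_ne_zero h x
    gcongr
  have hen (x : T.V) : ‖((c.toReal * ‖h x‖ ^ (a - 2) : ℝ) : ℂ) * h x‖ₑ =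
      c * ‖h x‖ₑ ^ (a - 1) := by
    rw [enorm_mul, ← ofReal_norm, norm_real, Real.norm_of_nonneg (by positivity),
      ENNReal.ofReal_mul (by positivity), ENNReal.ofReal_toReal hct,
      ← ENNReal.ofReal_rpow_of_nonneg (norm_nonneg _) (by linarith), ofReal_norm, mul_assoc]
    congr 1
    conv_lhs => rw [← ENNReal.rpow_one ‖h x‖ₑ, ← ENNReal.rpow_mul, one_mul]
    rw [← ENNReal.rpow_add_of_nonneg _ _ (by linarith) zero_le_one]
    congr 1; ring
  refine ⟨⟨_, hmem⟩, ?_, ?_, fun x hx => ?_⟩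
  · change (∑' x, ‖((c.toReal * ‖h x‖ ^ (a - 2) : ℝ) : ℂ) * h x‖ₑ ^ (a / (a - 1))) ^
      (1 / (a / (a - 1))) = L
    have e (x : T.V) : ‖((c.toReal * ‖h x‖ ^ (a - 2) : ℝ) : ℂ) * h x‖ₑ ^ (a / (a - 1)) =
        c ^ (a / (a - 1)) * ‖h x‖ₑ ^ a := by
      rw [hen, ENNReal.mul_rpow_of_nonneg _ _ (by positivity)]
      exact congrArg (c ^ (a / (a - 1)) * ·) ((ENNReal.rpow_mul _ _ _).symm.trans
        (congrArg (‖h x‖ₑ ^ ·) (mul_div_cancel₀ a ha1.ne')))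
    simp only [e]
    rw [ENNReal.tsum_mul_left, ← T.lpSum_rpow ha0, ← hL,
      ENNReal.mul_rpow_of_nonneg _ _ (by positivity), hc, ← ENNReal.rpow_mul, ← ENNReal.rpow_mul,
      ← ENNReal.rpow_mul, ← ENNReal.rpow_add _ _ hL0 hLt]
    conv_rhs => rw [← ENNReal.rpow_one L]
    congr 1; field_simp; ring
  · rw [lp.inner_eq_tsum]
    have e (x : T.V) : inner ℂ (((c.toReal * ‖h x‖ ^ (a - 2) : ℝ) : ℂ) * h x) (h x) =
        ((c.toReal * (‖h x‖ₑ ^ a).toReal : ℝ) : ℂ) := by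
      rw [RCLike.inner_apply, map_mul, conj_ofReal, mul_left_comm, mul_comm (h x), mul_comm _ (h x),
        mul_conj, normSq_eq_norm_sq, ← ofReal_mul, mul_assoc]
      have e' : (‖h x‖ₑ ^ a).toReal = ‖h x‖ ^ a :=
        (ENNReal.toReal_rpow _ _).symm.trans (congrArg (· ^ a) (toReal_enorm (h x)))
      rw [e', ← Real.rpow_two, ← Real.rpow_add_of_nonneg (norm_nonneg _) (by linarith) zero_le_two]
      congr 3; ring
    refine (tsum_congr e).trans ?_
    have hfin : ∀ x, ‖h x‖ₑ ^ a ≠ ∞ := fun x => ENNReal.rpow_ne_top_of_nonneg ha0.le enorm_ne_top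
    rw [← ofReal_tsum, tsum_mul_left, ← ENNReal.tsum_toReal_eq hfin, ← T.lpSum_rpow ha0, ← hL,
      ← ENNReal.toReal_mul, hc, ← ENNReal.rpow_add _ _ hL0 hLt]
    congr 3; ring
  · change _ * h x = 0
    rw [hx, mul_zero]

lemma sum_inner_group_le {M : ℝ≥0∞} {κ : ℤ → ℝ≥0∞} (hκ : ∑' j, κ j = M) (L : ℤ → ℝ≥0∞)
    (J : Finset ℤ) :
    ∑ k ∈ J, ∑ l ∈ J, κ (k - l) * (L k * L l) ≤ M * ∑ k ∈ J, L k ^ (2 : ℝ) := by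
  have h := ENNReal.schur_test (fun k l : ℤ => κ (k - l)) 1 1 M (by simp) (by simp) (by simp)
    (by simp) (fun k => by
      simp only [Pi.one_apply, mul_one]
      exact ((Equiv.subLeft k).tsum_eq κ).le.trans hκ.le) (fun l => by
      simp only [Pi.one_apply, mul_one]
      exact ((Equiv.subRight l).tsum_eq κ).le.trans hκ.le)
      (fun k => if k ∈ J then L k else 0) (fun k => if k ∈ J then L k else 0)
  have e : ∑' k, (if k ∈ J then L k else 0) ^ (2 : ℝ) = ∑ k ∈ J, L k ^ (2 : ℝ) := by
    rw [tsum_eq_sum (s := J) fun k hk => by simp [hk]]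
    exact Finset.sum_congr rfl fun k hk => by rw [if_pos hk]
  rw [e, ← ENNReal.rpow_add_of_nonneg _ _ (by norm_num) (by norm_num)] at h
  rw [show (1 / 2 + 1 / 2 : ℝ) = 1 by norm_num, ENNReal.rpow_one] at h
  refine le_trans ?_ h
  calc ∑ k ∈ J, ∑ l ∈ J, κ (k - l) * (L k * L l)
      = ∑ k ∈ J, ∑ l ∈ J, κ (k - l) * (if k ∈ J then L k else 0) * (if l ∈ J then L l else 0) := by
        refine Finset.sum_congr rfl fun k hk => Finset.sum_congr rfl fun l hl => ?_
        rw [if_pos hk, if_pos hl, mul_assoc]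
    _ ≤ ∑ k ∈ J, ∑' l, κ (k - l) * (if k ∈ J then L k else 0) * (if l ∈ J then L l else 0) :=
        Finset.sum_le_sum fun k _ => ENNReal.sum_le_tsum J
    _ ≤ _ := by simpa using ENNReal.sum_le_tsum J

/-- Homogeneous Strichartz estimate in discrete time. -/
lemma exists_tsum_lpSum_group_sq_le (hQ : 2 ≤ Q) {r : ℝ} (hr : 2 < r) :
    ∃ C : ℝ≥0, ∀ (τ : ℤ → ℝ), (∀ k : ℤ, τ k ∈ Set.Ico (k : ℝ) (k + 1)) → ∀ f : T.Hil,
      ∑' k, T.lpSum r (T.group (τ k) f) ^ (2 : ℝ) ≤ C * ‖f‖ₑ ^ (2 : ℝ) := by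
  obtain ⟨C, hC⟩ := T.exists_enorm_inner_group_le hQ hr
  have hM : (∑' j, windowDecay j) = ((∑' j, windowDecay j).toNNReal : ℝ≥0∞) :=
    (ENNReal.coe_toNNReal tsum_windowDecay_ne_top).symm
  set M := (∑' j, windowDecay j).toNNReal
  refine ⟨C * M, fun τ hτ f => ?_⟩
  choose g hg1 hg2 _ using fun k => T.exists_dual hr.le (T.group (τ k) f)
  set L : ℤ → ℝ≥0∞ := fun k => T.lpSum r (T.group (τ k) f) with hL
  rw [ENNReal.tsum_eq_iSup_sum]
  refine iSup_le fun J => ?_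
  set S := ∑ k ∈ J, L k ^ (2 : ℝ) with hS
  have hLt : ∀ k, L k ^ (2 : ℝ) ≠ ∞ := fun k =>
    ENNReal.rpow_ne_top_of_nonneg zero_le_two (T.lpSum_ne_top hr.le _)
  have hSt : S ≠ ∞ := ENNReal.sum_ne_top.2 fun k _ => hLt k
  set v : T.Hil := ∑ k ∈ J, T.group (-τ k) (g k) with hv
  have h1 : inner ℂ v f = ((S.toReal : ℝ) : ℂ) := by
    rw [hv, sum_inner, hS, ENNReal.toReal_sum fun k _ => hLt k, ofReal_sum]
    refine Finset.sum_congr rfl fun k _ => ?_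
    rw [inner_group, neg_neg, hg2]
  have h2 : S ≤ ‖v‖ₑ * ‖f‖ₑ := by
    have e : S = ‖inner ℂ v f‖ₑ := by
      rw [h1, ← ofReal_norm, norm_real, Real.norm_of_nonneg ENNReal.toReal_nonneg,
        ENNReal.ofReal_toReal hSt]
    rw [e, ← ofReal_norm, ← ofReal_norm, ← ofReal_norm, ← ENNReal.ofReal_mul (norm_nonneg _)]
    exact ENNReal.ofReal_le_ofReal (norm_inner_le_norm v f)
  have h3 : ‖v‖ₑ ^ (2 : ℝ) ≤ C * M * S := by
    have e : ‖v‖ₑ ^ (2 : ℝ) = ‖inner ℂ v v‖ₑ := by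
      rw [inner_self_eq_norm_sq_to_K, enorm_pow, ENNReal.rpow_two]
      congr 1
      rw [← ofReal_norm, ← ofReal_norm]
      simp
    rw [e, hv, sum_inner]
    simp only [inner_sum]
    calc _ ≤ ∑ k ∈ J, ∑ l ∈ J, ‖inner ℂ (T.group (-τ k) (g k)) (T.group (-τ l) (g l))‖ₑ :=
          (enorm_sum_le _ _).trans (Finset.sum_le_sum fun k _ => enorm_sum_le _ _)
      _ ≤ ∑ k ∈ J, ∑ l ∈ J, C * (windowDecay (k - l) * (L k * L l)) := by
          refine Finset.sum_le_sum fun k _ => Finset.sum_le_sum fun l _ => ?_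
          rw [inner_group, neg_neg, ← mul_apply_eq_comp, ← group_add, ← sub_eq_add_neg]
          refine (hC _ _ _).trans ?_
          rw [hg1, hg1, mul_assoc]
          gcongr
          exact ofReal_decay_le_windowDecay (hτ k) (hτ l)
      _ ≤ C * (M * S) := by
          simp only [← Finset.mul_sum]
          gcongr
          exact sum_inner_group_le hM L J
      _ = _ := by rw [mul_assoc]
  by_cases hS0 : S = 0
  · rw [hS0]; exact zero_le
  have h4 : S * S ≤ S * (C * M * ‖f‖ₑ ^ (2 : ℝ)) := by
    calc S * S ≤ (‖v‖ₑ * ‖f‖ₑ) * (‖v‖ₑ * ‖f‖ₑ) := by gcongr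
      _ = ‖v‖ₑ ^ (2 : ℝ) * ‖f‖ₑ ^ (2 : ℝ) := by
          rw [ENNReal.rpow_two, ENNReal.rpow_two]; ring
      _ ≤ C * M * S * ‖f‖ₑ ^ (2 : ℝ) := by gcongr
      _ = _ := by ring
  push_cast
  exact (ENNReal.mul_le_mul_iff_right hS0 hSt).1 h4

/-- Homogeneous Strichartz estimate in the amalgam norm. -/
lemma exists_tsum_iSup_lpSum_group_le (hQ : 2 ≤ Q) {r : ℝ} (hr : 2 < r) :
    ∃ C : ℝ≥0, C ≠ 0 ∧ ∀ f : T.Hil,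
      (∑' k : ℤ, (⨆ t ∈ Set.Ico (k : ℝ) (k + 1), T.lpSum r (T.group t f)) ^ (2 : ℝ)) ^ (1 / 2 : ℝ) ≤
        C * ‖f‖ₑ := by
  obtain ⟨C, hC⟩ := T.exists_tsum_lpSum_group_sq_le hQ hr
  refine ⟨2 * (C + 1) ^ (1 / 2 : ℝ), by positivity, fun f => ?_⟩
  set W : ℤ → ℝ≥0∞ := fun k => ⨆ t ∈ Set.Ico (k : ℝ) (k + 1), T.lpSum r (T.group t f) with hW
  have hWt (k : ℤ) : W k ≠ ∞ := by
    refine ne_top_of_le_ne_top (enorm_ne_top (x := f)) (iSup₂_le fun t _ => ?_)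
    refine (T.lpSum_le_lpSum two_pos hr.le _).trans (le_of_eq ?_)
    rw [lpSum_two_eq_enorm, ← ofReal_norm, norm_group_apply, ofReal_norm]
  have hτ (k : ℤ) : ∃ t ∈ Set.Ico (k : ℝ) (k + 1), W k ≤ 2 * T.lpSum r (T.group t f) := by
    by_cases h0 : W k = 0
    · exact ⟨k, by simp, by rw [h0]; exact zero_le⟩
    · have h : W k / 2 < W k := ENNReal.half_lt_self h0 (hWt k)
      conv_rhs at h => rw [hW]
      obtain ⟨t, ht⟩ := lt_iSup_iff.1 h
      obtain ⟨ht', ht⟩ := lt_iSup_iff.1 ht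
      refine ⟨t, ht', ?_⟩
      rw [mul_comm]
      exact (ENNReal.div_le_iff two_ne_zero ENNReal.ofNat_ne_top).1 ht.le
  choose τ hτ1 hτ2 using hτ
  have h := hC τ hτ1 f
  calc _ ≤ (∑' k, (2 * T.lpSum r (T.group (τ k) f)) ^ (2 : ℝ)) ^ (1 / 2 : ℝ) := by
        gcongr with k; exact hτ2 k
    _ = 2 * (∑' k, T.lpSum r (T.group (τ k) f) ^ (2 : ℝ)) ^ (1 / 2 : ℝ) := by
        simp only [ENNReal.mul_rpow_of_nonneg _ _ (zero_le_two (α := ℝ))]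
        rw [ENNReal.tsum_mul_left, ENNReal.mul_rpow_of_nonneg _ _ (by norm_num), ← ENNReal.rpow_mul]
        norm_num
    _ ≤ 2 * ((C + 1 : ℝ≥0) * ‖f‖ₑ ^ (2 : ℝ)) ^ (1 / 2 : ℝ) := by
        gcongr
        refine h.trans ?_
        gcongr
        simp
    _ = _ := by
        rw [ENNReal.mul_rpow_of_nonneg _ _ (by norm_num), ← ENNReal.rpow_mul, ENNReal.coe_mul,
          ENNReal.coe_rpow_of_nonneg _ (by norm_num)]
        norm_num [mul_assoc]

end HomTree

namespace HomTree
variable {Q : ℕ} (T : HomTree Q)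

lemma div_sub_one_le_two {a : ℝ} (ha : 2 ≤ a) : a / (a - 1) ≤ 2 := by
  rw [div_le_iff₀] <;> linarith

/-- The Duhamel term `∫₀ᵗ e^{i(t-s)ℒ}F(s) ds`. -/
def duhamel (F : ℝ → T.V → ℂ) (t : ℝ) (x : T.V) : ℂ :=
  ∫ s in (0 : ℝ)..t, propagate T (t - s) (F s) x

lemma exists_coe_eq_of_lpSum_two_ne_top {F : T.V → ℂ} (h : T.lpSum 2 F ≠ ∞) :
    ∃ φ : T.Hil, ⇑φ = F := by
  refine ⟨⟨F, memℓp_gen ?_⟩, rfl⟩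
  have h' : ∑' x, ‖F x‖ₑ ^ (2 : ℝ) ≠ ∞ := by
    rw [← T.lpSum_rpow two_pos]; exact ENNReal.rpow_ne_top_of_nonneg zero_le_two h
  refine (ENNReal.summable_toReal h').congr fun x => ?_
  rw [← ENNReal.toReal_rpow, toReal_enorm]; norm_num

lemma enorm_inner_le_lpSum {a : ℝ} (ha : 1 < a) (g h : T.Hil) :
    ‖inner ℂ g h‖ₑ ≤ T.lpSum (a / (a - 1)) g * T.lpSum a h := by
  rw [lp.inner_eq_tsum]
  refine enorm_tsum_le_tsum_enorm.trans ?_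
  refine le_trans (ENNReal.tsum_le_tsum fun x => ?_) (ENNReal.tsum_mul_le_Lp_mul_Lq
    (Real.HolderConjugate.conjExponent ha).symm (fun x => ‖g x‖ₑ) (fun x => ‖h x‖ₑ))
  rw [RCLike.inner_apply, enorm_mul, RCLike.enorm_conj, mul_comm]

lemma inner_eq_sum {g : T.Hil} {S : Finset T.V} (hg : ∀ x ∉ S, g x = 0) (h : T.Hil) :
    inner ℂ g h = ∑ x ∈ S, h x * (starRingEnd ℂ) (g x) := by
  rw [lp.inner_eq_tsum, tsum_eq_sum (s := S) fun x hx => by rw [hg x hx, inner_zero_left]]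
  exact Finset.sum_congr rfl fun x _ => RCLike.inner_apply _ _

/-- Duality for the Duhamel term: it suffices to bound the lower integral of its integrand
against test functions. -/
lemma lpSum_duhamel_le (hQ : 2 ≤ Q) {a : ℝ} (ha : 2 ≤ a) (F : ℝ → T.V → ℂ) (t : ℝ) (K : ℝ≥0∞)
    (H : ∀ g : T.Hil, T.lpSum (a / (a - 1)) g ≠ 0 → T.lpSum (a / (a - 1)) g ≠ ∞ →
      ∃ B : ℝ → ℝ≥0∞, (∀ s, T.lpSum 2 (F s) = ∞ → B s = ∞) ∧
        (∀ s (φ : T.Hil), ⇑φ = F s → ‖inner ℂ g (T.group (t - s) φ)‖ₑ ≤ B s) ∧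
        ∫⁻ s, B s ≤ K * T.lpSum (a / (a - 1)) g) :
    T.lpSum a (T.duhamel F t) ≤ K := by
  classical
  have ha0 : 0 < a := by linarith
  set u := T.duhamel F t with hu
  rw [lpSum, one_div, ENNReal.rpow_inv_le_iff ha0, ENNReal.tsum_eq_iSup_sum]
  refine iSup_le fun S => ?_
  rw [← ENNReal.rpow_inv_le_iff ha0, ← one_div]
  have hmem : Memℓp (fun x => if x ∈ S then u x else 0) 2 :=
    (memℓp_zero (S.finite_toSet.subset fun x hx => by
      by_contra hxS
      exact hx (if_neg hxS))).of_exponent_ge zero_le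
  set h : T.Hil := ⟨_, hmem⟩ with hh
  have hhx (x : T.V) : h x = if x ∈ S then u x else 0 := rfl
  have hL : (∑ x ∈ S, ‖u x‖ₑ ^ a) ^ (1 / a) = T.lpSum a h := by
    rw [lpSum, tsum_eq_sum (s := S) fun x hx => by rw [hhx, if_neg hx]; simp [ha0]]
    congr 1
    exact Finset.sum_congr rfl fun x hx => by rw [hhx, if_pos hx]
  rw [hL]
  obtain ⟨g, hg1, hg2, hg3⟩ := T.exists_dual ha h
  set L := T.lpSum a h with hLdef
  by_cases hL0 : L = 0
  · rw [hL0]; exact zero_le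
  have hLt : L ≠ ∞ := T.lpSum_ne_top ha h
  obtain ⟨B, hB1, hB2, hB3⟩ := H g (by rwa [hg1]) (by rwa [hg1])
  rw [hg1] at hB3
  set S' := S.filter fun x => u x ≠ 0 with hS'
  have hgS : ∀ x ∉ S', g x = 0 := fun x hx => hg3 x <| by
    rw [hhx]
    split_ifs with hxS
    · by_contra h0
      exact hx (Finset.mem_filter.2 ⟨hxS, h0⟩)
    · rfl
  have hFTC : ∀ x ∈ S', IntervalIntegrable (fun s => propagate T (t - s) (F s) x) volume 0 t := by
    intro x hx
    by_contra h0
    exact (Finset.mem_filter.1 hx).2 (intervalIntegral.integral_undef h0)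
  have e : inner ℂ g h = ∫ s in (0 : ℝ)..t,
      ∑ x ∈ S', propagate T (t - s) (F s) x * (starRingEnd ℂ) (g x) := by
    rw [T.inner_eq_sum hgS, intervalIntegral.integral_finsetSum
      fun x hx => (hFTC x hx).mul_const _]
    refine Finset.sum_congr rfl fun x hx => ?_
    rw [intervalIntegral.integral_mul_const, hhx, if_pos (Finset.mem_filter.1 hx).1]
    rfl
  have hle : L * L ≤ L * K := by
    calc L * L = ‖inner ℂ g h‖ₑ := by
          rw [hg2, ← ofReal_norm, norm_real, Real.norm_of_nonneg ENNReal.toReal_nonneg,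
            ENNReal.ofReal_toReal (ENNReal.rpow_ne_top_of_nonneg zero_le_two hLt),
            ENNReal.rpow_two, sq]
      _ ≤ ∫⁻ s in Set.uIoc 0 t,
          ‖∑ x ∈ S', propagate T (t - s) (F s) x * (starRingEnd ℂ) (g x)‖ₑ := by
          rw [e, ← ofReal_norm, intervalIntegral.norm_intervalIntegral_eq, ofReal_norm]
          exact enorm_integral_le_lintegral_enorm _
      _ ≤ ∫⁻ s, B s := by
          refine (setLIntegral_le_lintegral _ _).trans (lintegral_mono fun s => ?_)
          by_cases hs : T.lpSum 2 (F s) = ∞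
          · rw [hB1 s hs]; exact le_top
          · obtain ⟨φ, hφ⟩ := T.exists_coe_eq_of_lpSum_two_ne_top hs
            refine le_trans (le_of_eq ?_) (hB2 s φ hφ)
            rw [T.inner_eq_sum hgS, ← hφ]
            congr 1
            exact Finset.sum_congr rfl fun x _ => by rw [T.propagate_eq_group hQ]
      _ ≤ L * K := by rw [mul_comm]; exact hB3
  exact (ENNReal.mul_le_mul_iff_right hL0 hLt).1 hle

lemma lpSum_eq_top_of_lpSum_two {a : ℝ} (ha : 0 < a) (ha2 : a ≤ 2) {F : T.V → ℂ}
    (h : T.lpSum 2 F = ∞) : T.lpSum a F = ∞ :=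
  top_le_iff.1 (h ▸ T.lpSum_le_lpSum ha ha2 F)

/-- The energy estimate for the Duhamel term. -/
lemma lpSum_two_duhamel_le_lintegral (hQ : 2 ≤ Q) (F : ℝ → T.V → ℂ) (t : ℝ) :
    T.lpSum 2 (T.duhamel F t) ≤ ∫⁻ s, T.lpSum 2 (F s) := by
  refine T.lpSum_duhamel_le hQ le_rfl F t _ fun g hg0 hgt => ?_
  have e2 : (2 / (2 - 1) : ℝ) = 2 := by norm_num
  rw [e2] at hg0 hgt ⊢
  refine ⟨fun s => T.lpSum 2 (F s) * T.lpSum 2 g, fun s hs => ?_, fun s φ hφ => ?_, ?_⟩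
  · beta_reduce
    rw [hs, ENNReal.top_mul hg0]
  · beta_reduce
    rw [← hφ, lpSum_two_eq_enorm, lpSum_two_eq_enorm, ← ofReal_norm, ← ofReal_norm, ← ofReal_norm,
      ← ENNReal.ofReal_mul (norm_nonneg _), mul_comm]
    refine ENNReal.ofReal_le_ofReal ((norm_inner_le_norm _ _).trans ?_)
    rw [norm_group_apply]
  · rw [lintegral_mul_const' _ _ hgt]

lemma exists_lpSum_duhamel_le_tsum (hQ : 2 ≤ Q) {r : ℝ} (hr : 2 < r) :
    ∃ C : ℝ≥0, ∀ (F : ℝ → T.V → ℂ) (k : ℤ), ∀ t ∈ Set.Ico (k : ℝ) (k + 1),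
      T.lpSum r (T.duhamel F t) ≤ C * ∑' l : ℤ, windowDecay (k - l) *
        ∫⁻ s in Set.Ico (l : ℝ) (l + 1), T.lpSum (r / (r - 1)) (F s) := by
  obtain ⟨C, hC⟩ := T.exists_enorm_inner_group_le hQ hr
  have hr1 : 0 < r - 1 := by linarith
  refine ⟨C + 1, fun F k t ht => T.lpSum_duhamel_le hQ hr.le F t _ fun g hg0 hgt => ?_⟩
  set G := T.lpSum (r / (r - 1)) g
  refine ⟨fun s => (C + 1 : ℝ≥0) * ENNReal.ofReal ((1 + |t - s|) ^ (-(3 / 2) : ℝ)) *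
    (G * T.lpSum (r / (r - 1)) (F s)), fun s hs => ?_, fun s φ hφ => ?_, ?_⟩
  · beta_reduce
    rw [T.lpSum_eq_top_of_lpSum_two (by positivity) (div_sub_one_le_two hr.le) hs,
      ENNReal.mul_top hg0, ENNReal.mul_top]
    refine mul_ne_zero (by simp) ?_
    rw [Ne, ENNReal.ofReal_eq_zero, not_le]
    positivity
  · refine (hC _ _ _).trans ?_
    rw [hφ]
    beta_reduce
    gcongr
    simp
  · rw [lintegral_eq_tsum_Ico_int, mul_assoc, ← ENNReal.tsum_mul_right, ← ENNReal.tsum_mul_left]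
    refine ENNReal.tsum_le_tsum fun l => ?_
    have hc : (C + 1 : ℝ≥0) * windowDecay (k - l) * G ≠ ∞ :=
      ENNReal.mul_ne_top (ENNReal.mul_ne_top ENNReal.coe_ne_top ENNReal.ofReal_ne_top) hgt
    calc _ ≤ ∫⁻ s in Set.Ico (l : ℝ) (l + 1), (C + 1 : ℝ≥0) * windowDecay (k - l) * G *
          T.lpSum (r / (r - 1)) (F s) := by
          refine setLIntegral_mono' measurableSet_Ico fun s hs => ?_
          rw [mul_assoc _ G]
          gcongr
          exact ofReal_decay_le_windowDecay ht hs
      _ = _ := by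
          rw [lintegral_const_mul' _ _ hc]; ring

/-- The diagonal Duhamel estimate in the amalgam norm. -/
lemma exists_lpSum_two_duhamel_le (hQ : 2 ≤ Q) {r : ℝ} (hr : 2 < r) :
    ∃ C : ℝ≥0, ∀ (F : ℝ → T.V → ℂ) (t : ℝ), T.lpSum 2 (T.duhamel F t) ≤
      C * (∑' l : ℤ, (∫⁻ s in Set.Ico (l : ℝ) (l + 1), T.lpSum (r / (r - 1)) (F s)) ^ (2 : ℝ)) ^
        (1 / 2 : ℝ) := by
  obtain ⟨C, -, hC⟩ := T.exists_tsum_iSup_lpSum_group_le hQ hr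
  have hr1 : 0 < r - 1 := by linarith
  refine ⟨C, fun F t => T.lpSum_duhamel_le hQ le_rfl F t _ fun g hg0 hgt => ?_⟩
  have e2 : (2 / (2 - 1) : ℝ) = 2 := by norm_num
  rw [e2] at hg0 hgt ⊢
  set f : T.Hil := T.group (-t) g with hf
  have hf0 : f ≠ 0 := by
    intro h0
    rw [lpSum_two_eq_enorm, ← ofReal_norm, ← T.norm_group_apply (-t), ← hf, h0] at hg0
    simp at hg0
  set w : ℤ → ℝ≥0∞ := fun l => ⨆ s ∈ Set.Ico (l : ℝ) (l + 1), T.lpSum r (T.group s f) with hw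
  have hwge (s : ℝ) : T.lpSum r (T.group s f) ≤ w ⌊s⌋ :=
    le_iSup₂_of_le s ⟨Int.floor_le s, Int.lt_floor_add_one s⟩ le_rfl
  have hwf : (∑' k, w k ^ (2 : ℝ)) ^ (1 / 2 : ℝ) ≤ C * T.lpSum 2 g := by
    refine (hC f).trans (le_of_eq ?_)
    rw [lpSum_two_eq_enorm, ← ofReal_norm, hf, norm_group_apply, ofReal_norm]
  have hwt (k : ℤ) : w k ≠ ∞ := by
    intro h
    have h1 : w k ^ (2 : ℝ) ≤ ∑' k, w k ^ (2 : ℝ) := ENNReal.le_tsum k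
    rw [h, ENNReal.top_rpow_of_pos two_pos, top_le_iff] at h1
    rw [h1, ENNReal.top_rpow_of_pos (by norm_num), top_le_iff] at hwf
    exact ENNReal.mul_ne_top ENNReal.coe_ne_top hgt hwf
  refine ⟨fun s => w ⌊s⌋ * T.lpSum (r / (r - 1)) (F s), fun s hs => ?_, fun s φ hφ => ?_, ?_⟩
  · beta_reduce
    rw [T.lpSum_eq_top_of_lpSum_two (by positivity) (div_sub_one_le_two hr.le) hs,
      ENNReal.mul_top]
    intro h0
    have h1 := T.eq_zero_of_lpSum_eq_zero (by linarith) (le_antisymm ((hwge s).trans h0.le) zero_le)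
    have h2 : T.group s f = 0 := lp.ext h1
    refine hf0 (norm_eq_zero.1 ?_)
    rw [← T.norm_group_apply s, h2, norm_zero]
  · have e : inner ℂ g (T.group (t - s) φ) = inner ℂ (T.group s f) φ := by
      rw [hf, ← mul_apply_eq_comp, ← group_add, inner_group]
      congr 3; ring
    rw [e, ← inner_conj_symm, RCLike.enorm_conj]
    refine (T.enorm_inner_le_lpSum (by linarith) _ _).trans ?_
    rw [hφ, mul_comm]
    beta_reduce
    gcongr
    exact hwge s
  · rw [lintegral_eq_tsum_Ico_int]
    calc _ = ∑' l : ℤ, w l * ∫⁻ s in Set.Ico (l : ℝ) (l + 1), T.lpSum (r / (r - 1)) (F s) := by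
          refine tsum_congr fun l => ?_
          rw [← lintegral_const_mul' _ _ (hwt l)]
          refine setLIntegral_congr_fun measurableSet_Ico fun s hs => ?_
          simp only [Int.floor_eq_iff.2 hs]
      _ ≤ _ := ENNReal.tsum_mul_le_Lp_mul_Lq Real.HolderConjugate.two_two _ _
      _ ≤ C * T.lpSum 2 g * _ := by gcongr
      _ = _ := by ring

end HomTree

/-- Minkowski's inequality for lower integrals, without measurability. -/
lemma tsum_sq_lintegral_le {α ι : Type*} [MeasurableSpace α] {μ : Measure α}
    {W : ι → α → ℝ≥0∞} {N : α → ℝ≥0∞} (h : ∀ s, (∑' k, W k s ^ (2 : ℝ)) ^ (1 / 2 : ℝ) ≤ N s) :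
    (∑' k, (∫⁻ s, W k s ∂μ) ^ (2 : ℝ)) ^ (1 / 2 : ℝ) ≤ ∫⁻ s, N s ∂μ := by
  by_cases hN : ∫⁻ s, N s ∂μ = ∞
  · rw [hN]; exact le_top
  choose m hm hmW hmI using fun k => exists_measurable_le_lintegral_eq μ (W k)
  have hWN (k : ι) (s : α) : W k s ≤ N s := by
    refine le_trans ?_ (h s)
    rw [one_div, ENNReal.le_rpow_inv_iff two_pos]
    exact ENNReal.le_tsum k
  set I : ι → ℝ≥0∞ := fun k => ∫⁻ s, W k s ∂μ with hI
  have hIt (k : ι) : I k ≠ ∞ := ne_top_of_le_ne_top hN (lintegral_mono (hWN k))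
  rw [one_div, ENNReal.rpow_inv_le_iff two_pos, ENNReal.tsum_eq_iSup_sum]
  refine iSup_le fun J => ?_
  rw [← ENNReal.rpow_inv_le_iff two_pos, ← one_div]
  set S := ∑ k ∈ J, I k ^ (2 : ℝ) with hS
  have hSt : S ≠ ∞ :=
    ENNReal.sum_ne_top.2 fun k _ => ENNReal.rpow_ne_top_of_nonneg zero_le_two (hIt k)
  by_cases hS0 : S = 0
  · rw [hS0, ENNReal.zero_rpow_of_pos (by norm_num)]; exact zero_le
  set R := S ^ (1 / 2 : ℝ) with hR
  have hR0 : R ≠ 0 := by simp [hR, hS0, hSt]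
  have hRt : R ≠ ∞ := ENNReal.rpow_ne_top_of_nonneg (by norm_num) hSt
  have hRR : R * R = S := by
    rw [hR, ← ENNReal.rpow_add_of_nonneg _ _ (by norm_num) (by norm_num)]; norm_num
  refine (ENNReal.mul_le_mul_iff_right hR0 hRt).1 ?_
  calc R * R = ∑ k ∈ J, ∫⁻ s, I k * m k s ∂μ := by
        rw [hRR, hS]
        refine Finset.sum_congr rfl fun k _ => ?_
        rw [lintegral_const_mul _ (hm k), ← hmI k, ENNReal.rpow_two, sq]
    _ = ∫⁻ s, ∑ k ∈ J, I k * m k s ∂μ :=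
        (lintegral_finsetSum _ fun k _ => (hm k).const_mul _).symm
    _ ≤ ∫⁻ s, R * N s ∂μ := by
        refine lintegral_mono fun s => ?_
        refine (ENNReal.inner_le_Lp_mul_Lq J I (fun k => m k s) Real.HolderConjugate.two_two).trans ?_
        refine mul_le_mul' le_rfl (le_trans ?_ (h s))
        gcongr
        calc _ ≤ ∑ k ∈ J, W k s ^ (2 : ℝ) :=
              Finset.sum_le_sum fun k _ => ENNReal.rpow_le_rpow (hmW k s) zero_le_two
          _ ≤ _ := ENNReal.sum_le_tsum J
    _ = R * ∫⁻ s, N s ∂μ := lintegral_const_mul' _ _ hRt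

namespace HomTree
variable {Q : ℕ} (T : HomTree Q)

/-- The Duhamel estimate in the amalgam norm with energy data. -/
lemma exists_lpSum_duhamel_le_lintegral (hQ : 2 ≤ Q) {r : ℝ} (hr : 2 < r) :
    ∃ C : ℝ≥0, ∀ F : ℝ → T.V → ℂ, ∃ W : ℤ → ℝ≥0∞,
      (∀ k : ℤ, ∀ t ∈ Set.Ico (k : ℝ) (k + 1), T.lpSum r (T.duhamel F t) ≤ W k) ∧
      (∑' k, W k ^ (2 : ℝ)) ^ (1 / 2 : ℝ) ≤ C * ∫⁻ s, T.lpSum 2 (F s) := by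
  classical
  obtain ⟨C, hC0, hC⟩ := T.exists_tsum_iSup_lpSum_group_le hQ hr
  refine ⟨C, fun F => ?_⟩
  have key (s : ℝ) : ∃ w : ℤ → ℝ≥0∞, (T.lpSum 2 (F s) = ∞ → ∀ k, w k = ∞) ∧
      (∀ φ : T.Hil, ⇑φ = F s → ∀ k : ℤ, ∀ t ∈ Set.Ico (k : ℝ) (k + 1),
        T.lpSum r (T.group (t - s) φ) ≤ w k) ∧
      (∑' k, w k ^ (2 : ℝ)) ^ (1 / 2 : ℝ) ≤ C * T.lpSum 2 (F s) := by
    by_cases hs : T.lpSum 2 (F s) = ∞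
    · refine ⟨fun _ => ∞, fun _ _ => rfl, fun _ _ _ _ _ => le_top, ?_⟩
      rw [hs, ENNReal.mul_top (by simpa using hC0)]
      exact le_top
    · obtain ⟨φ, hφ⟩ := T.exists_coe_eq_of_lpSum_two_ne_top hs
      refine ⟨_, fun h => absurd h hs, fun ψ hψ k t ht => ?_, (hC (T.group (-s) φ)).trans_eq ?_⟩
      · have e : ψ = φ := lp.ext (hψ.trans hφ.symm)
        refine le_iSup₂_of_le t ht (le_of_eq ?_)
        rw [← mul_apply_eq_comp, ← group_add, e, sub_eq_add_neg]
      · rw [← hφ, lpSum_two_eq_enorm, ← ofReal_norm, norm_group_apply, ofReal_norm]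
  choose w hw1 hw2 hw3 using key
  refine ⟨fun k => ∫⁻ s, w s k, fun k t ht => ?_, ?_⟩
  · refine T.lpSum_duhamel_le hQ hr.le F t _ fun g hg0 hgt => ?_
    refine ⟨fun s => w s k * T.lpSum (r / (r - 1)) g, fun s hs => ?_, fun s φ hφ => ?_, ?_⟩
    · beta_reduce
      rw [hw1 s hs, ENNReal.top_mul hg0]
    · refine (T.enorm_inner_le_lpSum (by linarith) _ _).trans ?_
      rw [mul_comm]
      exact mul_le_mul' (hw2 s φ hφ k t ht) le_rfl
    · rw [lintegral_mul_const' _ _ hgt]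
  · refine (tsum_sq_lintegral_le (W := fun k s => w s k) hw3).trans (le_of_eq ?_)
    rw [lintegral_const_mul' _ _ ENNReal.coe_ne_top]

end HomTree

lemma ENNReal.exists_two_lt_ofReal_le {q : ℝ≥0∞} (hq : 2 < q) :
    ∃ r : ℝ, 2 < r ∧ ENNReal.ofReal r ≤ q := by
  obtain ⟨m, h2m, hmq⟩ := exists_between hq
  have hm : m ≠ ∞ := hmq.ne_top
  refine ⟨m.toReal, ?_, by rw [ENNReal.ofReal_toReal hm]; exact hmq.le⟩
  simpa using (ENNReal.toReal_lt_toReal ENNReal.ofNat_ne_top hm).2 h2m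

namespace HomTree
variable {Q : ℕ} (T : HomTree Q)

lemma spaceNorm_eq_lpSum {q : ℝ≥0∞} (hq : q ≠ ∞) (g : T.V → ℂ) :
    spaceNorm T q g = T.lpSum q.toReal g := if_neg hq

lemma spaceNorm_two (g : T.V → ℂ) : spaceNorm T 2 g = T.lpSum 2 g := by
  rw [T.spaceNorm_eq_lpSum ENNReal.ofNat_ne_top, ENNReal.toReal_ofNat]

lemma spaceNorm_le_lpSum {q : ℝ≥0∞} {r : ℝ} (hr : 0 < r) (hrq : ENNReal.ofReal r ≤ q)
    (g : T.V → ℂ) : spaceNorm T q g ≤ T.lpSum r g := by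
  by_cases hq : q = ∞
  · rw [spaceNorm, if_pos hq]
    refine iSup_le fun x => ?_
    rw [lpSum, one_div, ENNReal.le_rpow_inv_iff hr]
    exact ENNReal.le_tsum (f := fun x => ‖g x‖ₑ ^ r) x
  · rw [T.spaceNorm_eq_lpSum hq]
    exact T.lpSum_le_lpSum hr ((ENNReal.ofReal_le_iff_le_toReal hq).1 hrq) g

lemma lpSum_sub_le {r : ℝ} (hr : 1 ≤ r) (a b : T.V → ℂ) :
    T.lpSum r (fun x => a x - I * b x) ≤ T.lpSum r a + T.lpSum r b := by
  refine le_trans ?_ (ENNReal.tsum_Lp_add_le _ _ hr)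
  rw [lpSum]
  gcongr with x
  refine enorm_sub_le.trans (le_of_eq ?_)
  rw [enorm_mul, ← ofReal_norm I, norm_I, ENNReal.ofReal_one, one_mul]

lemma mixedNorm_le_tsum_sq {p q : ℝ≥0∞} (hp : p ≠ ∞) (hp2 : 2 ≤ p) {r : ℝ} (hr : 0 < r)
    (hrq : ENNReal.ofReal r ≤ q) {u : ℝ → T.V → ℂ} {W : ℤ → ℝ≥0∞}
    (h : ∀ k : ℤ, ∀ t ∈ Set.Ico (k : ℝ) (k + 1), T.lpSum r (u t) ≤ W k) :
    mixedNorm T p q Set.univ u ≤ (∑' k, W k ^ (2 : ℝ)) ^ (1 / 2 : ℝ) := by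
  rw [mixedNorm, if_neg hp, Measure.restrict_univ]
  refine lintegral_rpow_le_tsum_sq
    (fun k t ht => (T.spaceNorm_le_lpSum hr hrq (u t)).trans (h k t ht)) ?_
  simpa using ENNReal.toReal_mono hp hp2

lemma tsum_sq_lintegral_lpSum_le_mixedNorm {p q : ℝ≥0∞} (hp1 : 1 < p) (hp2 : p ≤ 2)
    (hq0 : q ≠ 0) {r : ℝ} (hr : 0 < r) (hqr : q ≤ ENNReal.ofReal r) (F : ℝ → T.V → ℂ) :
    (∑' l : ℤ, (∫⁻ s in Set.Ico (l : ℝ) (l + 1), T.lpSum r (F s)) ^ (2 : ℝ)) ^ (1 / 2 : ℝ) ≤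
      mixedNorm T p q Set.univ F := by
  have hp : p ≠ ∞ := ne_top_of_le_ne_top ENNReal.ofNat_ne_top hp2
  have hq : q ≠ ∞ := ne_top_of_le_ne_top ENNReal.ofReal_ne_top hqr
  rw [mixedNorm, if_neg hp, Measure.restrict_univ]
  have h1 : 1 < p.toReal := by
    simpa using (ENNReal.toReal_lt_toReal ENNReal.one_ne_top hp).2 hp1
  have h2 : p.toReal ≤ 2 := by simpa using ENNReal.toReal_mono ENNReal.ofNat_ne_top hp2
  refine (tsum_sq_lintegral_Ico_le _ h1 h2).trans ?_
  gcongr with s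
  rw [T.spaceNorm_eq_lpSum hq]
  exact T.lpSum_le_lpSum (ENNReal.toReal_pos hq0 hq) (ENNReal.toReal_le_of_le_ofReal hr.le hqr) _

lemma mixedNorm_one_two (F : ℝ → T.V → ℂ) :
    mixedNorm T 1 2 Set.univ F = ∫⁻ s, T.lpSum 2 (F s) := by
  rw [mixedNorm, if_neg ENNReal.one_ne_top]
  simp [spaceNorm_two]

end HomTree

lemma ENNReal.le_ofReal_conj_of_inv_add_inv {q q' : ℝ≥0∞} (h : q⁻¹ + q'⁻¹ = 1) {r : ℝ} (hr : 1 < r)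
    (hrq : ENNReal.ofReal r ≤ q) : q' ≤ ENNReal.ofReal (r / (r - 1)) := by
  have hr0 : 0 < r := by linarith
  have hr1 : 0 < r - 1 := by linarith
  have e : (ENNReal.ofReal r)⁻¹ + (ENNReal.ofReal (r / (r - 1)))⁻¹ = 1 := by
    rw [← ENNReal.ofReal_inv_of_pos hr0, ← ENNReal.ofReal_inv_of_pos (by positivity),
      ← ENNReal.ofReal_add (by positivity) (by positivity), ← ENNReal.ofReal_one]
    congr 1; field_simp; ring
  rw [← ENNReal.inv_le_inv, ← ENNReal.add_le_add_iff_left (a := (ENNReal.ofReal r)⁻¹)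
    (ENNReal.inv_ne_top.2 (by simpa using hr0)), e, ← h]
  gcongr

lemma ENNReal.ne_zero_of_inv_add_inv {q q' : ℝ≥0∞} (h : q⁻¹ + q'⁻¹ = 1) : q' ≠ 0 := by
  rintro rfl
  simp at h

lemma ENNReal.one_lt_of_inv_add_inv {p p' : ℝ≥0∞} (h : p⁻¹ + p'⁻¹ = 1) (hp : p ≠ ∞) :
    1 < p' := by
  rw [← ENNReal.inv_lt_one, ← h, add_comm]
  exact ENNReal.lt_add_right (ne_top_of_le_ne_top ENNReal.one_ne_top (h ▸ le_add_self))
    (ENNReal.inv_ne_zero.2 hp)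

lemma ENNReal.le_two_of_inv_add_inv {p p' : ℝ≥0∞} (h : p⁻¹ + p'⁻¹ = 1) (hp : 2 ≤ p) :
    p' ≤ 2 := by
  rw [← ENNReal.inv_le_inv, ← ENNReal.add_le_add_iff_left (a := (2 : ℝ≥0∞)⁻¹) (by simp),
    ENNReal.inv_two_add_inv_two, ← h]
  gcongr

lemma ENNReal.eq_two_of_inv_add_inv {q' : ℝ≥0∞} (h : 2⁻¹ + q'⁻¹ = 1) : q' = 2 := by
  rw [← ENNReal.inv_two_add_inv_two] at h
  exact inv_injective ((ENNReal.add_right_inj (by simp)).1 h)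

lemma admissiblePair.cases {p q : ℝ≥0∞} (h : admissiblePair p q) :
    (p ≠ ∞ ∧ 2 ≤ p ∧ 2 < q) ∨ (p = ∞ ∧ q = 2) := by
  rcases h with ⟨h1, h2, h3⟩ | ⟨h1, h2⟩
  · exact .inl ⟨ENNReal.inv_pos.1 h1, ENNReal.inv_le_inv.1 h2, ENNReal.inv_lt_inv.1 h3⟩
  · exact .inr ⟨ENNReal.inv_eq_zero.1 h1, inv_injective h2⟩

namespace HomTree
variable {Q : ℕ} (T : HomTree Q)

/-- The Duhamel estimate in the amalgam norm, for both kinds of admissible data. -/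
lemma exists_amalgam_duhamel_le (hQ : 2 ≤ Q) {q tp tq tp' tq' : ℝ≥0∞} (hq : 2 < q)
    (htpq : admissiblePair tp tq) (hp' : tp⁻¹ + tp'⁻¹ = 1) (hq' : tq⁻¹ + tq'⁻¹ = 1) :
    ∃ r : ℝ, 2 < r ∧ ENNReal.ofReal r ≤ q ∧ ∃ C : ℝ≥0, ∀ F : ℝ → T.V → ℂ, ∃ W : ℤ → ℝ≥0∞,
      (∀ k : ℤ, ∀ t ∈ Set.Ico (k : ℝ) (k + 1), T.lpSum r (T.duhamel F t) ≤ W k) ∧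
      (∑' k, W k ^ (2 : ℝ)) ^ (1 / 2 : ℝ) ≤ C * mixedNorm T tp' tq' Set.univ F := by
  rcases htpq.cases with ⟨htp, htp2, htq⟩ | ⟨rfl, rfl⟩
  · obtain ⟨r, hr, hrm⟩ := ENNReal.exists_two_lt_ofReal_le (lt_min hq htq)
    refine ⟨r, hr, hrm.trans (min_le_left _ _), ?_⟩
    obtain ⟨C, hC⟩ := T.exists_lpSum_duhamel_le_tsum hQ hr
    refine ⟨C * (∑' j, windowDecay j).toNNReal, fun F => ⟨_, hC F, ?_⟩⟩
    simp only [ENNReal.mul_rpow_of_nonneg _ _ (zero_le_two (α := ℝ))]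
    rw [ENNReal.tsum_mul_left, ENNReal.mul_rpow_of_nonneg _ _ (by norm_num), ← ENNReal.rpow_mul,
      mul_one_div_cancel two_ne_zero, ENNReal.rpow_one, ENNReal.coe_mul, mul_assoc,
      ENNReal.coe_toNNReal tsum_windowDecay_ne_top]
    gcongr
    refine (ENNReal.tsum_convolution_sq_le _ _).trans ?_
    gcongr
    have hr1 : 0 < r - 1 := by linarith
    exact T.tsum_sq_lintegral_lpSum_le_mixedNorm (ENNReal.one_lt_of_inv_add_inv hp' htp)
      (ENNReal.le_two_of_inv_add_inv hp' htp2) (ENNReal.ne_zero_of_inv_add_inv hq') (by positivity)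
      (ENNReal.le_ofReal_conj_of_inv_add_inv hq' (by linarith) (hrm.trans (min_le_right _ _))) F
  · obtain ⟨r, hr, hrq⟩ := ENNReal.exists_two_lt_ofReal_le hq
    obtain ⟨C, hC⟩ := T.exists_lpSum_duhamel_le_lintegral hQ hr
    refine ⟨r, hr, hrq, C, ?_⟩
    obtain rfl : tp' = 1 := by simpa using hp'
    obtain rfl : tq' = 2 := ENNReal.eq_two_of_inv_add_inv hq'
    simpa only [mixedNorm_one_two] using hC

/-- The energy bound for the Duhamel term, for both kinds of admissible data. -/
lemma exists_energy_duhamel_le (hQ : 2 ≤ Q) {tp tq tp' tq' : ℝ≥0∞}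
    (htpq : admissiblePair tp tq) (hp' : tp⁻¹ + tp'⁻¹ = 1) (hq' : tq⁻¹ + tq'⁻¹ = 1) :
    ∃ C : ℝ≥0, ∀ (F : ℝ → T.V → ℂ) (t : ℝ),
      T.lpSum 2 (T.duhamel F t) ≤ C * mixedNorm T tp' tq' Set.univ F := by
  rcases htpq.cases with ⟨htp, htp2, htq⟩ | ⟨rfl, rfl⟩
  · obtain ⟨r, hr, hrq⟩ := ENNReal.exists_two_lt_ofReal_le htq
    obtain ⟨C, hC⟩ := T.exists_lpSum_two_duhamel_le hQ hr
    refine ⟨C, fun F t => (hC F t).trans ?_⟩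
    gcongr
    have hr1 : 0 < r - 1 := by linarith
    exact T.tsum_sq_lintegral_lpSum_le_mixedNorm (ENNReal.one_lt_of_inv_add_inv hp' htp)
      (ENNReal.le_two_of_inv_add_inv hp' htp2) (ENNReal.ne_zero_of_inv_add_inv hq') (by positivity)
      (ENNReal.le_ofReal_conj_of_inv_add_inv hq' (by linarith) hrq) F
  · obtain rfl : tp' = 1 := by simpa using hp'
    obtain rfl : tq' = 2 := ENNReal.eq_two_of_inv_add_inv hq'
    refine ⟨1, fun F t => ?_⟩
    rw [mixedNorm_one_two, ENNReal.coe_one, one_mul]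
    exact T.lpSum_two_duhamel_le_lintegral hQ F t

end HomTree

/-- Strichartz estimates on the homogeneous tree: if `(1/p, 1/q)` and
`(1/p̃, 1/q̃)` belong to `𝒞 = ((0,1/2] × [0,1/2)) ∪ {(0,1/2)}`, then the Duhamel
solution `u(t) = e^{itℒ}f - i∫₀ᵗ e^{i(t-s)ℒ}F(s) ds` of the inhomogeneous
linear Schrödinger equation satisfies
`‖u‖_{L^p_t L^q_x} ≤ C (‖f‖_{L²} + ‖F‖_{L^{p̃'}_t L^{q̃'}_x})`. -/
theorem strichartz_estimates (Q : ℕ) (hQ : 2 ≤ Q) (T : HomTree Q)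
    (p q tp tq tp' tq' : ℝ≥0∞)
    (hpq : admissiblePair p q) (htpq : admissiblePair tp tq)
    (hp' : tp⁻¹ + tp'⁻¹ = 1) (hq' : tq⁻¹ + tq'⁻¹ = 1) :
    ∃ C : ℝ≥0, 0 < C ∧ ∀ (f : T.V → ℂ) (F : ℝ → T.V → ℂ),
      mixedNorm T p q Set.univ
          (fun t x => propagate T t f x -
            Complex.I * ∫ s in (0 : ℝ)..t, propagate T (t - s) (F s) x) ≤
        (C : ℝ≥0∞) * (spaceNorm T 2 f + mixedNorm T tp' tq' Set.univ F) := by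
  suffices h : ∃ A B : ℝ≥0, ∀ (f : T.Hil) (F : ℝ → T.V → ℂ),
      mixedNorm T p q Set.univ (fun t x => T.group t f x - I * T.duhamel F t x) ≤
        A * ‖f‖ₑ + B * mixedNorm T tp' tq' Set.univ F by
    obtain ⟨A, B, h⟩ := h
    refine ⟨A + B + 1, by positivity, fun f F => ?_⟩
    by_cases hf : T.lpSum 2 f = ∞
    · rw [T.spaceNorm_two, hf, top_add, ENNReal.mul_top (by simp)]
      exact le_top
    obtain ⟨φ, rfl⟩ := T.exists_coe_eq_of_lpSum_two_ne_top hf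
    simp only [T.propagate_eq_group hQ]
    refine (h φ F).trans ?_
    rw [T.spaceNorm_two, T.lpSum_two_eq_enorm, mul_add]
    have hA : (A : ℝ≥0∞) ≤ (A + B + 1 : ℝ≥0) := by
      exact_mod_cast (le_self_add.trans le_self_add : A ≤ A + B + 1)
    have hB : (B : ℝ≥0∞) ≤ (A + B + 1 : ℝ≥0) := by
      exact_mod_cast (le_add_self.trans le_self_add : B ≤ A + B + 1)
    gcongr
  rcases hpq.cases with ⟨hp, hp2, hq⟩ | ⟨rfl, rfl⟩
  · obtain ⟨r, hr, hrq, B, hB⟩ := T.exists_amalgam_duhamel_le hQ hq htpq hp' hq'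
    obtain ⟨A, -, hA⟩ := T.exists_tsum_iSup_lpSum_group_le hQ hr
    refine ⟨A, B, fun f F => ?_⟩
    obtain ⟨W, hW, hWF⟩ := hB F
    refine (T.mixedNorm_le_tsum_sq hp hp2 (by linarith) hrq fun k t ht =>
      (T.lpSum_sub_le (by linarith) _ _).trans (add_le_add
        (le_iSup₂ (f := fun t (_ : t ∈ Set.Ico (k : ℝ) (k + 1)) => T.lpSum r (T.group t f)) t ht)
        (hW k t ht))).trans ?_
    exact (ENNReal.tsum_Lp_add_le _ _ one_le_two).trans (add_le_add (hA f) hWF)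
  · obtain ⟨B, hB⟩ := T.exists_energy_duhamel_le hQ htpq hp' hq'
    refine ⟨1, B, fun f F => ?_⟩
    rw [mixedNorm, if_pos rfl]
    refine iSup₂_le fun t _ => ?_
    rw [T.spaceNorm_two]
    refine (T.lpSum_sub_le one_le_two _ _).trans (add_le_add (le_of_eq ?_) (hB F t))
    rw [T.lpSum_two_eq_enorm, ← ofReal_norm, T.norm_group_apply, ofReal_norm, ENNReal.coe_one,
      one_mul]
end
end
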